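/- arXiv:1909.02610 — 3 statements merged into one kernel-verified Lean document; each statement's English description precedes it below -/
import Mathlib

section
/- For every integer n ≥ 1, depth(S_{n,2}/I(P_{n,2})) = sdepth(S_{n,2}/I(P_{n,2})) = ⌈n/3⌉. -/
open MvPolynomial

section Defs

variable (K : Type) [Field K] (σ : Type)
variable (M : Type) [AddCommGroup M] [Module K M] [Module (MvPolynomial σ K) M]
  [IsScalarTower K (MvPolynomial σ K) M]

/-- The Stanley space `w K[A]`: the `K`-span of `{u • w : u a monomial in the variables of A}`. -/
noncomputable def stanleySpace (w : M) (A : Finset σ) : Submodule K M :=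
  Submodule.span K { m | ∃ u : σ →₀ ℕ, (↑u.support : Set σ) ⊆ ↑A ∧
    m = (monomial u (1 : K) : MvPolynomial σ K) • w }

/-- `(w, A)` indexed by `Fin r` gives a Stanley decomposition of `M`:
each Stanley space `wᵢ K[Aᵢ]` is a free `K[Aᵢ]`-module and `M` is their internal direct
sum as a `K`-vector space. -/
def IsStanleyDecomp {r : ℕ} (w : Fin r → M) (A : Fin r → Finset σ) : Prop :=
  (∀ i (f : MvPolynomial σ K), (↑f.vars : Set σ) ⊆ ↑(A i) → f • w i = 0 → f = 0) ∧
  (iSupIndep fun i => stanleySpace K σ M (w i) (A i)) ∧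
  (⨆ i, stanleySpace K σ M (w i) (A i)) = ⊤

/-- The Stanley depth of `M`: the largest value of `minᵢ |Aᵢ|` over all Stanley
decompositions of `M`. -/
noncomputable def sdepth : ℕ :=
  sSup { d | ∃ r, ∃ w : Fin r → M, ∃ A : Fin r → Finset σ,
    IsStanleyDecomp K σ M w A ∧ d = sInf (Set.range fun i => (A i).card) }

/-- The depth of `M` with respect to the maximal graded ideal `(x₁, …, x_N)`:
the maximal length of an `M`-regular sequence of elements of that ideal. -/
noncomputable def rdepth : ℕ :=
  sSup { d | ∃ rs : List (MvPolynomial σ K), rs.length = d ∧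
    (∀ f ∈ rs, f ∈ Ideal.span (Set.range (X : σ → MvPolynomial σ K))) ∧
    RingTheory.Sequence.IsRegular M rs }

end Defs

/-- Adjacency in the strong product `Pₙ ⊠ Pₘ` (vertices `(i,j)`, `0`-indexed): distinct
vertices are adjacent iff both coordinates differ by at most `1`. -/
def pAdj (n m : ℕ) (a b : Fin n × Fin m) : Prop :=
  a ≠ b ∧ |((a.1 : ℤ) - (b.1 : ℤ))| ≤ 1 ∧ |((a.2 : ℤ) - (b.2 : ℤ))| ≤ 1

/-- Adjacency in the strong product `Cₙ ⊠ Pₘ` (vertices `(i,j)`, `0`-indexed). -/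
def cAdj (n m : ℕ) (a b : Fin n × Fin m) : Prop :=
  a ≠ b ∧ min ((a.1 : ℤ) - (b.1 : ℤ)).natAbs (n - ((a.1 : ℤ) - (b.1 : ℤ)).natAbs) ≤ 1 ∧
    |((a.2 : ℤ) - (b.2 : ℤ))| ≤ 1

/-- The edge ideal of the graph with vertex set `V` and adjacency relation `Adj`. -/
noncomputable def edgeIdeal (K : Type) [Field K] {V : Type} (Adj : V → V → Prop) :
    Ideal (MvPolynomial V K) :=
  Ideal.span { p | ∃ a b : V, Adj a b ∧ p = X a * X b }


namespace SD

/-! ### Regular sequences through colon ideals -/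

section WRsec
variable {R : Type} [CommRing R]

/-- The ideal generated by the first `i` terms of the sequence. -/
def Th (θ : ℕ → R) (i : ℕ) : Ideal R := Ideal.span (θ '' Set.Iio i)

theorem Th_succ (θ : ℕ → R) (i : ℕ) : Th θ (i + 1) = Th θ i ⊔ Ideal.span {θ i} := by
  unfold Th
  rw [← Ideal.span_union]
  congr 1
  ext x
  simp only [Set.mem_image, Set.mem_Iio, Set.mem_union, Set.mem_singleton_iff]
  constructor
  · rintro ⟨j, hj, rfl⟩
    rcases Nat.lt_succ_iff_lt_or_eq.mp hj with h | rfl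
    · exact Or.inl ⟨j, h, rfl⟩
    · exact Or.inr rfl
  · rintro (⟨j, hj, rfl⟩ | rfl)
    · exact ⟨j, by omega, rfl⟩
    · exact ⟨i, by omega, rfl⟩

/-- The sequence `θ 0, …, θ (d-1)` is weakly regular on `R ⧸ J`. -/
def WR (θ : ℕ → R) (d : ℕ) (J : Ideal R) : Prop :=
  ∀ i < d, ∀ f, θ i * f ∈ J ⊔ Th θ i → f ∈ J ⊔ Th θ i

theorem WR_split {θ : ℕ → R} {d : ℕ} {J J1 J2 : Ideal R} {v : R}
    (h1 : ∀ h, v * h ∈ J → h ∈ J1) (h1' : ∀ h ∈ J1, v * h ∈ J)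
    (h2 : J2 = J ⊔ Ideal.span {v}) (H1 : WR θ d J1) (H2 : WR θ d J2) : WR θ d J := by
  have dec : ∀ i f, f ∈ J2 ⊔ Th θ i → ∃ g, f - v * g ∈ J ⊔ Th θ i := by
    intro i f hf
    have : J2 ⊔ Th θ i = (J ⊔ Th θ i) ⊔ Ideal.span {v} := by
      rw [h2, sup_right_comm]
    rw [this] at hf
    obtain ⟨a, ha, b, hb, rfl⟩ := Submodule.mem_sup.mp hf
    obtain ⟨g, rfl⟩ := Ideal.mem_span_singleton'.mp hb
    exact ⟨g, by simpa [mul_comm] using ha⟩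
  have le2 : ∀ i, J ⊔ Th θ i ≤ J2 ⊔ Th θ i := fun i =>
    sup_le_sup_right (by rw [h2]; exact le_sup_left) _
  have colon : ∀ i ≤ d, ∀ h, v * h ∈ J ⊔ Th θ i → h ∈ J1 ⊔ Th θ i := by
    intro i
    induction i with
    | zero =>
      intro _ h hh
      have : Th θ 0 = ⊥ := by simp [Th]
      rw [this, sup_bot_eq] at hh ⊢
      exact h1 h hh
    | succ i ih =>
      intro hi h hh
      rw [Th_succ, ← sup_assoc] at hh ⊢
      obtain ⟨s, hs, b, hb, e⟩ := Submodule.mem_sup.mp hh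
      obtain ⟨q, rfl⟩ := Ideal.mem_span_singleton'.mp hb
      have hv : v ∈ J2 := by rw [h2]; exact Ideal.mem_sup_right (Ideal.mem_span_singleton_self v)
      have hq : θ i * q ∈ J2 ⊔ Th θ i := by
        have : θ i * q = v * h - s := by rw [← e]; ring
        rw [this]
        exact Ideal.sub_mem _ (Ideal.mem_sup_left (Ideal.mul_mem_right _ _ hv)) (le2 i hs)
      obtain ⟨q', hq'⟩ := dec i q (H2 i (by omega) q hq)
      have h3 : v * (h - θ i * q') ∈ J ⊔ Th θ i := by
        have : v * (h - θ i * q') = s + θ i * (q - v * q') := by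
          linear_combination -e
        rw [this]
        exact Ideal.add_mem _ hs (Ideal.mul_mem_left _ _ hq')
      have h4 := ih (by omega) _ h3
      have : h = (h - θ i * q') + q' * θ i := by ring
      rw [this]
      exact Submodule.add_mem_sup h4 (Ideal.mem_span_singleton'.mpr ⟨q', rfl⟩)
  intro i hi f hf
  obtain ⟨g, hg⟩ := dec i f (H2 i hi f (le2 i hf))
  have h3 : v * (θ i * g) ∈ J ⊔ Th θ i := by
    have : v * (θ i * g) = θ i * f - θ i * (f - v * g) := by ring
    rw [this]
    exact Ideal.sub_mem _ hf (Ideal.mul_mem_left _ _ hg)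
  have h4 := H1 i hi g (colon i hi.le _ h3)
  obtain ⟨a, ha, b, hb, rfl⟩ := Submodule.mem_sup.mp h4
  have : f = (f - v * (a + b)) + (v * a + v * b) := by ring
  rw [this]
  exact Ideal.add_mem _ hg (Submodule.add_mem_sup (h1' a ha) (Ideal.mul_mem_left _ _ hb))

end WRsec

/-! ### Independent sets and monomials -/

section Graph
variable {V : Type} [DecidableEq V]

/-- Independent sets. -/
def Ind (Adj : V → V → Prop) (T : Finset V) : Prop := ∀ a ∈ T, ∀ b ∈ T, ¬ Adj a b

/-- Monomials with independent support inside `W`. -/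
def Mon (Adj : V → V → Prop) (W : Finset V) (u : V →₀ ℕ) : Prop :=
  u.support ⊆ W ∧ Ind Adj u.support

/-- The graph can be decomposed by vertex splittings into independent sets that meet each of the
first `d` blocks. -/
inductive Good (Adj : V → V → Prop) (blk : V → ℕ) (d : ℕ) : Finset V → Prop
  | leaf (W : Finset V) (h : Ind Adj W) (hb : ∀ j < d, ∃ v ∈ W, blk v = j) : Good Adj blk d W
  | split (W W1 : Finset V) (v : V) (hv : v ∈ W) (hW1 : ∀ x, x ∈ W1 ↔ x ∈ W ∧ ¬ Adj v x)
      (h1 : Good Adj blk d W1) (h2 : Good Adj blk d (W.erase v)) : Good Adj blk d W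

/-- Exponents of the generators of the ideal of non-faces. -/
def gens (Adj : V → V → Prop) (W : Finset V) : Set (V →₀ ℕ) :=
  {u | (∃ a b, Adj a b ∧ u = Finsupp.single a 1 + Finsupp.single b 1) ∨
    ∃ v, v ∉ W ∧ u = Finsupp.single v 1}

variable (K : Type) [Field K]

/-- The edge ideal plus the variables outside `W`. -/
noncomputable def J (Adj : V → V → Prop) (W : Finset V) : Ideal (MvPolynomial V K) :=
  Ideal.span ((fun u => monomial u (1 : K)) '' gens Adj W)

variable {K}
variable {Adj : V → V → Prop}

theorem mem_J (hirr : ∀ a, ¬ Adj a a) {W : Finset V} {f : MvPolynomial V K} :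
    f ∈ J K Adj W ↔ ∀ u ∈ f.support, ¬ Mon Adj W u := by
  unfold J
  rw [MvPolynomial.mem_ideal_span_monomial_image]
  refine forall₂_congr fun u _ => ?_
  constructor
  · rintro ⟨s, (⟨a, b, hab, rfl⟩ | ⟨v, hv, rfl⟩), hle⟩ ⟨h1, h2⟩
    · refine h2 a ?_ b ?_ hab
      · have := hle a; simp at this ⊢; omega
      · have := hle b; simp at this ⊢; omega
    · refine hv (h1 ?_)
      have := hle v; simp at this ⊢; omega
  · intro h
    by_cases hs : u.support ⊆ W
    · have : ¬ Ind Adj u.support := fun h' => h ⟨hs, h'⟩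
      unfold Ind at this
      push Not at this
      obtain ⟨a, ha, b, hb, hab⟩ := this
      refine ⟨_, Or.inl ⟨a, b, hab, rfl⟩, ?_⟩
      have hne : a ≠ b := by rintro rfl; exact hirr a hab
      intro x
      simp only [Finsupp.mem_support_iff] at ha hb
      simp only [Finsupp.add_apply, Finsupp.single_apply]
      split_ifs with h1 h2 h2
      · exact absurd (h1.trans h2.symm) hne
      · subst h1; omega
      · subst h2; omega
      · omega
    · obtain ⟨v, hv, hvW⟩ := Finset.not_subset.mp hs
      refine ⟨_, Or.inr ⟨v, hvW, rfl⟩, ?_⟩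
      simp only [Finsupp.mem_support_iff] at hv
      rw [Finsupp.single_le_iff]; omega

theorem edgeIdeal_eq [Fintype V] : edgeIdeal K Adj = J K Adj Finset.univ := by
  unfold edgeIdeal J
  congr 1
  ext p
  simp only [Set.mem_setOf_eq, Set.mem_image, gens, Finset.mem_univ, not_true, false_and,
    exists_false, or_false]
  constructor
  · rintro ⟨a, b, h, rfl⟩
    exact ⟨_, ⟨a, b, h, rfl⟩, by simp [X, monomial_mul]⟩
  · rintro ⟨_, ⟨a, b, h, rfl⟩, rfl⟩
    exact ⟨a, b, h, by simp [X, monomial_mul]⟩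

theorem Mon_single_add (hsym : ∀ a b, Adj a b → Adj b a) (hirr : ∀ a, ¬ Adj a a)
    {W W1 : Finset V} {v : V} (hv : v ∈ W) (hW1 : ∀ x, x ∈ W1 ↔ x ∈ W ∧ ¬ Adj v x)
    (u : V →₀ ℕ) : Mon Adj W (Finsupp.single v 1 + u) ↔ Mon Adj W1 u := by
  have hs : (Finsupp.single v 1 + u).support = insert v u.support := by
    ext x
    simp only [Finsupp.mem_support_iff, Finsupp.add_apply, Finsupp.single_apply, Finset.mem_insert]
    split_ifs with h
    · simp [h.symm]
    · simp [Ne.symm h]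
  unfold Mon Ind
  rw [hs]
  constructor
  · rintro ⟨h1, h2⟩
    refine ⟨fun x hx => (hW1 x).mpr ⟨h1 (Finset.mem_insert_of_mem hx), ?_⟩, ?_⟩
    · exact h2 v (Finset.mem_insert_self _ _) x (Finset.mem_insert_of_mem hx)
    · exact fun a ha b hb => h2 a (Finset.mem_insert_of_mem ha) b (Finset.mem_insert_of_mem hb)
  · rintro ⟨h1, h2⟩
    refine ⟨Finset.insert_subset hv fun x hx => ((hW1 x).mp (h1 hx)).1, ?_⟩
    intro a ha b hb hab
    rcases Finset.mem_insert.mp ha with ha | ha <;> rcases Finset.mem_insert.mp hb with hb | hb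
    · rw [ha, hb] at hab; exact hirr _ hab
    · rw [ha] at hab; exact ((hW1 b).mp (h1 hb)).2 hab
    · rw [hb] at hab; exact ((hW1 a).mp (h1 ha)).2 (hsym _ _ hab)
    · exact h2 a ha b hb hab

theorem X_mul_mem_J (hsym : ∀ a b, Adj a b → Adj b a) (hirr : ∀ a, ¬ Adj a a)
    {W W1 : Finset V} {v : V} (hv : v ∈ W) (hW1 : ∀ x, x ∈ W1 ↔ x ∈ W ∧ ¬ Adj v x)
    (h : MvPolynomial V K) : X v * h ∈ J K Adj W ↔ h ∈ J K Adj W1 := by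
  rw [mem_J hirr, mem_J hirr, support_X_mul]
  simp only [Finset.mem_map, addLeftEmbedding_apply, forall_exists_index, and_imp,
    forall_apply_eq_imp_iff₂]
  refine forall₂_congr fun u _ => ?_
  rw [Mon_single_add hsym hirr hv hW1]

theorem J_erase {W : Finset V} {v : V} :
    J K Adj (W.erase v) = J K Adj W ⊔ Ideal.span {X v} := by
  unfold J
  rw [← Ideal.span_union]
  apply le_antisymm
  · apply Ideal.span_le.mpr
    rintro _ ⟨u, (h | ⟨x, hx, rfl⟩), rfl⟩
    · exact Ideal.subset_span (Or.inl ⟨u, Or.inl h, rfl⟩)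
    · by_cases hxv : x = v
      · subst hxv; exact Ideal.subset_span (Or.inr rfl)
      · refine Ideal.subset_span (Or.inl ⟨_, Or.inr ⟨x, ?_, rfl⟩, rfl⟩)
        intro h; exact hx (Finset.mem_erase.mpr ⟨hxv, h⟩)
  · apply Ideal.span_mono
    rintro _ (⟨u, (h | ⟨x, hx, rfl⟩), rfl⟩ | rfl)
    · exact ⟨u, Or.inl h, rfl⟩
    · exact ⟨_, Or.inr ⟨x, fun h => hx (Finset.mem_of_mem_erase h), rfl⟩, rfl⟩
    · exact ⟨_, Or.inr ⟨v, Finset.notMem_erase v W, rfl⟩, rfl⟩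

/-- The sum of the variables in a block. -/
noncomputable def theta (K : Type) [Field K] [Fintype V] (blk : V → ℕ) (j : ℕ) : MvPolynomial V K :=
  ∑ v with blk v = j, X v

theorem WR_leaf [Fintype V] {blk : V → ℕ} {d : ℕ} {W : Finset V} (hW : Ind Adj W)
    (hb : ∀ j < d, ∃ v ∈ W, blk v = j) : WR (theta K blk) d (J K Adj W) := by
  classical
  intro i hi f hf
  haveI : Nonempty V := ⟨(hb i hi).choose⟩
  choose! pick hpW hpb using hb
  set Q := J K Adj W ⊔ Th (theta K blk) i with hQ
  let T : ℕ → MvPolynomial V K := fun j => ∑ w ∈ W with blk w = j, X w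
  let g : V → MvPolynomial V K := fun u => if u ∈ W then
    (if blk u < i ∧ u = pick (blk u) then X u - T (blk u) else X u) else 0
  let φ : MvPolynomial V K →ₐ[K] MvPolynomial V K := aeval g
  have hφX : ∀ u, φ (X u) = g u := fun u => by simp [φ]
  have hXJ : ∀ u, u ∉ W → (X u : MvPolynomial V K) ∈ J K Adj W := fun u hu =>
    Ideal.subset_span ⟨_, Or.inr ⟨u, hu, rfl⟩, rfl⟩
  have hthT : ∀ j, theta K blk j - T j ∈ J K Adj W := by
    intro j
    have : theta K blk j - T j = ∑ v with blk v = j, if v ∈ W then 0 else X v := by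
      simp only [theta, T]
      rw [sub_eq_iff_eq_add]
      have e : (W.filter fun w => blk w = j) = (Finset.univ.filter fun v => blk v = j).filter
        fun v => v ∈ W := by ext; simp [and_comm]
      rw [e, Finset.sum_filter (fun v => v ∈ W), ← Finset.sum_add_distrib]
      refine Finset.sum_congr rfl fun v _ => ?_
      split_ifs <;> simp
    rw [this]
    refine Ideal.sum_mem _ fun v _ => ?_
    split_ifs with h
    · exact Ideal.zero_mem _
    · exact hXJ v h
  have hsub : ∀ f, f - φ f ∈ Q := by
    intro f
    induction f using MvPolynomial.induction_on with
    | C a => simp [φ, Ideal.zero_mem]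
    | add p q hp hq =>
      have : p + q - φ (p + q) = (p - φ p) + (q - φ q) := by rw [map_add]; ring
      rw [this]; exact Ideal.add_mem _ hp hq
    | mul_X p u hp =>
      have hu : X u - g u ∈ Q := by
        simp only [g]
        split_ifs with h1 h2
        · have h3 : X u - (X u - T (blk u)) = theta K blk (blk u) - (theta K blk (blk u) - T (blk u)) := by
            ring
          rw [h3]
          refine Ideal.sub_mem _ (Ideal.mem_sup_right (Ideal.subset_span ⟨_, h2.1, rfl⟩))
            (Ideal.mem_sup_left (hthT _))
        · simp [Ideal.zero_mem]
        · simpa using Ideal.mem_sup_left (hXJ u h1)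
      have : p * X u - φ (p * X u) = (p - φ p) * X u + φ p * (X u - g u) := by
        rw [map_mul, hφX]; ring
      rw [this]
      exact Ideal.add_mem _ (Ideal.mul_mem_right _ _ hp) (Ideal.mul_mem_left _ _ hu)
  have hφth : ∀ j, φ (theta K blk j) = ∑ w ∈ W with blk w = j, g w := by
    intro j
    simp only [theta, map_sum, hφX]
    have e : (W.filter fun w => blk w = j) = (Finset.univ.filter fun v => blk v = j).filter
        fun v => v ∈ W := by ext; simp [and_comm]
    rw [e, Finset.sum_filter (fun v => v ∈ W)]
    refine Finset.sum_congr rfl fun v _ => ?_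
    simp only [g]; split_ifs <;> rfl
  have hker : ∀ f ∈ Q, φ f = 0 := by
    intro f hf
    have : Q ≤ RingHom.ker φ := by
      apply sup_le
      · apply Ideal.span_le.mpr
        rintro _ ⟨u, (⟨a, b, hab, rfl⟩ | ⟨v, hv, rfl⟩), rfl⟩
        · have : (monomial (Finsupp.single a 1 + Finsupp.single b 1) (1:K)) = X a * X b := by
            simp [X, monomial_mul]
          simp only [this, SetLike.mem_coe, RingHom.mem_ker, map_mul, hφX]
          by_cases ha : a ∈ W
          · by_cases hb' : b ∈ W
            · exact absurd hab (hW a ha b hb')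
            · simp [g, hb']
          · simp [g, ha]
        · change φ (X v) = 0
          rw [hφX]; simp [g, hv]
      · apply Ideal.span_le.mpr
        rintro _ ⟨j, hj, rfl⟩
        have hj' : j < i := hj
        change φ (theta K blk j) = 0
        rw [hφth]
        have : ∀ w ∈ W.filter (fun w => blk w = j), g w = X w - if w = pick j then T j else 0 := by
          intro w hw
          obtain ⟨h1, h2⟩ := Finset.mem_filter.mp hw
          simp only [g, h1, h2, hj', if_true, true_and]
          split_ifs <;> simp
        rw [Finset.sum_congr rfl this, Finset.sum_sub_distrib, Finset.sum_ite_eq', if_pos]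
        · exact sub_self _
        · exact Finset.mem_filter.mpr ⟨hpW j (by omega), hpb j (by omega)⟩
    exact this hf
  have h0 : φ (theta K blk i) ≠ 0 := by
    rw [hφth]
    have : ∀ w ∈ W.filter (fun w => blk w = i), g w = X w := by
      intro w hw
      obtain ⟨h1, h2⟩ := Finset.mem_filter.mp hw
      simp [g, h1, h2]
    rw [Finset.sum_congr rfl this]
    intro h
    have h2 := congrArg (coeff (Finsupp.single (pick i) 1)) h
    rw [coeff_sum, coeff_zero] at h2
    simp only [coeff_X'] at h2
    have h3 : ∀ w ∈ W.filter (fun w => blk w = i),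
        (if Finsupp.single w 1 = Finsupp.single (pick i) 1 then (1:K) else 0) =
        if w = pick i then 1 else 0 := by
      intro w _
      simp [Finsupp.single_left_inj]
    rw [Finset.sum_congr rfl h3, Finset.sum_ite_eq', if_pos] at h2
    · exact one_ne_zero h2
    · exact Finset.mem_filter.mpr ⟨hpW i hi, hpb i hi⟩
  have h1 := hker _ hf
  rw [map_mul] at h1
  have h2 := (mul_eq_zero.mp h1).resolve_left h0
  have h3 := hsub f
  rwa [h2, sub_zero] at h3

theorem WR_good [Fintype V] (hsym : ∀ a b, Adj a b → Adj b a) (hirr : ∀ a, ¬ Adj a a)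
    {blk : V → ℕ} {d : ℕ} {W : Finset V} (h : Good Adj blk d W) :
    WR (theta K blk) d (J K Adj W) := by
  induction h with
  | leaf W h hb => exact WR_leaf h hb
  | split W W1 v hv hW1 _ _ ih1 ih2 =>
    exact WR_split (fun h => (X_mul_mem_J hsym hirr hv hW1 h).mp)
      (fun h => (X_mul_mem_J hsym hirr hv hW1 h).mpr) J_erase ih1 ih2

end Graph

/-! ### Depth is at most the dimension of an associated prime -/

section DepthUpper
open scoped Pointwise

theorem exists_ass_step {R : Type} [CommRing R] [IsNoetherianRing R] (m : Ideal R) [m.IsPrime]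
    {M : Type} [AddCommGroup M] [Module R M] [Module.Finite R M] {r : R} (hr : r ∈ m)
    (hreg : IsSMulRegular M r) {P : Ideal R} (hPm : P ≤ m) {x : M}
    (hx : ∀ a : R, a • x = 0 ↔ a ∈ P) :
    ∃ Q : Ideal R, Q.IsPrime ∧ Q ≤ m ∧ P ≤ Q ∧ r ∈ Q ∧
      ∃ y : QuotSMulTop r M, ∀ a : R, a • y = 0 ↔ a ∈ Q := by
  classical
  have hmp : m.IsPrime := inferInstance
  let N : Submodule R M :=
    { carrier := {y | ∀ p ∈ P, p • y = 0}
      add_mem' := by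
        intro a b ha hb p hp
        rw [smul_add, ha p hp, hb p hp, add_zero]
      zero_mem' := by intro p _; exact smul_zero p
      smul_mem' := by
        intro c y hy p hp
        rw [smul_comm, hy p hp, smul_zero] }
  have hxN : x ∈ N := fun p hp => (hx p).mpr hp
  have key : ∃ y ∈ N, ∀ s : R, s • y ∈ r • (⊤ : Submodule R M) → s ∈ m := by
    by_contra hcon
    push Not at hcon
    choose! c hc1 hc2 using hcon
    obtain ⟨T, hT⟩ : N.FG := IsNoetherian.noetherian N
    have hTN : ∀ t ∈ T, t ∈ N := fun t ht => hT ▸ Submodule.subset_span ht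
    let s := ∏ t ∈ T, c t
    have hs : s ∉ m := by
      intro h
      obtain ⟨t, ht, htm⟩ := (hmp.prod_mem_iff).mp h
      exact hc2 t (hTN t ht) htm
    have hsN : ∀ y ∈ N, s • y ∈ r • (⊤ : Submodule R M) := by
      intro y hy
      rw [← hT] at hy
      induction hy using Submodule.span_induction with
      | mem t ht =>
        obtain ⟨b, hb⟩ := Finset.dvd_prod_of_mem c ht
        have : s = b * c t := by rw [mul_comm]; exact hb
        rw [this, mul_smul]
        exact Submodule.smul_mem _ _ (hc1 t (hTN t ht))
      | zero => rw [smul_zero]; exact Submodule.zero_mem _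
      | add a b _ _ ha hb => rw [smul_add]; exact Submodule.add_mem _ ha hb
      | smul a y _ hy => rw [smul_comm]; exact Submodule.smul_mem _ _ hy
    have hrange : LinearMap.range (algebraMap R (Module.End R N) s) ≤
        (Ideal.span {r}) • (⊤ : Submodule R N) := by
      rintro _ ⟨y, rfl⟩
      obtain ⟨z, -, hz⟩ := (Submodule.mem_smul_pointwise_iff_exists _ _ _).mp (hsN y.1 y.2)
      have hzN : z ∈ N := by
        intro p hp
        apply hreg
        change r • p • z = r • 0
        rw [smul_comm, hz, smul_comm, y.2 p hp, smul_zero, smul_zero]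
      have e : (algebraMap R (Module.End R N) s) y = r • (⟨z, hzN⟩ : N) := by
        apply Subtype.ext
        rw [Module.algebraMap_end_apply]
        exact hz.symm
      rw [e]
      exact Submodule.smul_mem_smul (Ideal.mem_span_singleton_self r) trivial
    obtain ⟨p, hpm, -, hcoef, hev⟩ :=
      LinearMap.exists_monic_and_natDegree_eq_and_coeff_mem_pow_and_aeval_eq_zero _ _ _ hrange
    rw [Polynomial.aeval_algebraMap_apply] at hev
    have h1 : (Polynomial.aeval s p) • x = 0 := by
      have := congrArg (fun f : Module.End R N => ((f ⟨x, hxN⟩ : N) : M)) hev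
      simpa [Module.algebraMap_end_apply] using this
    have h2 : Polynomial.eval s p ∈ m := by
      rw [← Polynomial.coe_aeval_eq_eval]; exact hPm ((hx _).mp h1)
    rw [hpm.as_sum, Polynomial.eval_add, Polynomial.eval_pow, Polynomial.eval_X,
      Polynomial.eval_finsetSum] at h2
    have h3 : ∑ i ∈ Finset.range p.natDegree,
        Polynomial.eval s (Polynomial.C (p.coeff i) * Polynomial.X ^ i) ∈ m := by
      refine Ideal.sum_mem _ fun i hi => ?_
      rw [Polynomial.eval_mul, Polynomial.eval_C]
      refine Ideal.mul_mem_right _ _ ?_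
      have h4 := hcoef i
      have h5 : Ideal.span {r} ^ (p.natDegree - i) ≤ m := by
        refine (Ideal.pow_le_self ?_).trans ((Ideal.span_singleton_le_iff_mem _).mpr hr)
        have := Finset.mem_range.mp hi
        omega
      exact h5 h4
    exact hs (hmp.mem_of_pow_mem _ ((Ideal.add_mem_iff_left _ h3).mp h2))
  obtain ⟨y, hyN, hy⟩ := key
  let yb : QuotSMulTop r M := Submodule.Quotient.mk y
  have hyb : ∀ s : R, s • yb = 0 ↔ s • y ∈ r • (⊤ : Submodule R M) := by
    intro s
    rw [← Submodule.Quotient.mk_smul, Submodule.Quotient.mk_eq_zero]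
  let L := Submodule.span R {yb}
  have hann : ∀ s, s ∈ Module.annihilator R L ↔ s • yb = 0 := by
    intro s
    exact Submodule.mem_annihilator_span_singleton yb s
  have hle : Module.annihilator R L ≤ m := fun s hs => hy s ((hyb s).mp ((hann s).mp hs))
  obtain ⟨Q, hQ, hQm⟩ := Ideal.exists_minimalPrimes_le hle
  have hQa := Module.associatedPrimes.minimalPrimes_annihilator_subset_associatedPrimes R L hQ
  have hQb : IsAssociatedPrime Q (QuotSMulTop r M) :=
    IsAssociatedPrime.map_of_injective L.subtype hQa (Submodule.subtype_injective _)
  obtain ⟨hQp, z, hz⟩ := isAssociatedPrime_iff.mp hQb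
  refine ⟨Q, hQp, hQm, ?_, ?_, z, ?_⟩
  · intro p hp
    apply hQ.1.2
    rw [hann, hyb, hyN p hp]
    exact Submodule.zero_mem _
  · apply hQ.1.2
    rw [hann, hyb]
    exact Submodule.smul_mem_pointwise_smul _ _ _ trivial
  · intro a
    rw [hz, Submodule.mem_colon_singleton, Submodule.mem_bot]

theorem length_le_ringKrullDim {R : Type} [CommRing R] [IsNoetherianRing R] (m : Ideal R)
    [m.IsPrime] (rs : List R) :
    ∀ {M : Type} [AddCommGroup M] [Module R M] [Module.Finite R M], (∀ r ∈ rs, r ∈ m) →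
      RingTheory.Sequence.IsWeaklyRegular M rs → ∀ {P : Ideal R}, P.IsPrime → P ≤ m →
      ∀ {x : M}, (∀ a : R, a • x = 0 ↔ a ∈ P) →
      ((rs.length : ℕ) : WithBot ℕ∞) ≤ ringKrullDim (R ⧸ P) := by
  induction rs with
  | nil =>
    intro M _ _ _ _ _ P hP _ x _
    simp only [List.length_nil, Nat.cast_zero]
    exact ringKrullDim_nonneg_of_nontrivial
  | cons r rs ih =>
    intro M _ _ _ hm hreg P hP hPm x hx
    rw [RingTheory.Sequence.isWeaklyRegular_cons_iff] at hreg
    obtain ⟨Q, hQ, hQm, hPQ, hrQ, y, hy⟩ :=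
      exists_ass_step m (hm r (by simp)) hreg.1 hPm hx
    have h1 := ih (fun r hr => hm r (by simp [hr])) hreg.2 hQ hQm hy
    have hrP : r ∉ P := by
      intro h
      have h0 : x = 0 := hreg.1 (by simpa using (hx r).mpr h)
      exact hP.ne_top ((Ideal.eq_top_iff_one _).mpr ((hx 1).mp (by rw [h0, smul_zero])))
    have h2 : ringKrullDim (R ⧸ Q) + 1 ≤ ringKrullDim (R ⧸ P) := by
      refine ringKrullDim_succ_le_of_surjective (Ideal.Quotient.factor hPQ)
        (Ideal.Quotient.factor_surjective hPQ) (r := Ideal.Quotient.mk P r) ?_ ?_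
      · rw [mem_nonZeroDivisors_iff_ne_zero]
        exact fun h => hrP (Ideal.Quotient.eq_zero_iff_mem.mp h)
      · rw [Ideal.Quotient.factor_mk]
        exact Ideal.Quotient.eq_zero_iff_mem.mpr hrQ
    refine le_trans ?_ h2
    rw [List.length_cons, Nat.cast_add, Nat.cast_one]
    gcongr

end DepthUpper

section Main
variable {V : Type} [DecidableEq V] [Fintype V] {K : Type} [Field K] {Adj : V → V → Prop}

theorem mul_monomial_mem (hirr : ∀ a, ¬ Adj a a) {W : Finset V} (f : MvPolynomial V K)
    (s : V →₀ ℕ) :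
    f * monomial s 1 ∈ J K Adj W ↔ ∀ u ∈ f.support, ¬ Mon Adj W (u + s) := by
  rw [mem_J hirr]
  constructor
  · intro h u hu
    apply h
    rw [mem_support_iff, coeff_mul_monomial, mul_one]
    exact mem_support_iff.mp hu
  · intro h u hu
    rw [mem_support_iff, coeff_mul_monomial'] at hu
    split_ifs at hu with hle
    · have := h (u - s) (by rw [mem_support_iff]; simpa using hu)
      rwa [tsub_add_cancel_of_le hle] at this
    · exact absurd rfl hu

/-- The exponent vector that is constant `c` on `U` and zero elsewhere. -/
noncomputable def indU (U : Finset V) (c : ℕ) : V →₀ ℕ :=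
  Finsupp.equivFunOnFinite.symm fun v => if v ∈ U then c else 0

theorem indU_apply (U : Finset V) (c : ℕ) (v : V) : indU U c v = if v ∈ U then c else 0 := rfl

theorem indU_support (U : Finset V) (c : ℕ) : (indU U (c + 1)).support = U := by
  ext v
  rw [Finsupp.mem_support_iff, indU_apply]
  simp

theorem mem_ofList_smul (I : Ideal (MvPolynomial V K)) (L : List (MvPolynomial V K))
    (f : MvPolynomial V K) :
    Ideal.Quotient.mk I f ∈
      (Ideal.ofList L • ⊤ : Submodule (MvPolynomial V K) (MvPolynomial V K ⧸ I)) ↔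
    f ∈ I ⊔ Ideal.ofList L := by
  rw [Ideal.smul_top_eq_map, Submodule.restrictScalars_mem, Ideal.Quotient.algebraMap_eq,
    Ideal.mem_quotient_iff_mem_sup, sup_comm]

theorem ofList_theta (θ : ℕ → MvPolynomial V K) (i : ℕ) :
    Ideal.ofList ((List.range i).map θ) = Th θ i := by
  unfold Ideal.ofList Th
  congr 1
  ext x
  simp

theorem J_le_ker (hirr : ∀ a, ¬ Adj a a) :
    J K Adj Finset.univ ≤ RingHom.ker (constantCoeff : MvPolynomial V K →+* K) := by
  intro f hf
  rw [RingHom.mem_ker, constantCoeff_eq]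
  by_contra h
  refine (mem_J hirr).mp hf 0 (mem_support_iff.mpr h) ⟨by simp, ?_⟩
  intro a ha
  simp at ha

theorem theta_mem (blk : V → ℕ) (j : ℕ) :
    theta K blk j ∈ Ideal.span (Set.range (X : V → MvPolynomial V K)) :=
  Ideal.sum_mem _ fun v _ => Ideal.subset_span ⟨v, rfl⟩

theorem span_X_le_ker : Ideal.span (Set.range (X : V → MvPolynomial V K)) ≤
    RingHom.ker (constantCoeff : MvPolynomial V K →+* K) := by
  apply Ideal.span_le.mpr
  rintro _ ⟨v, rfl⟩
  simp

theorem isRegular_of_good (hsym : ∀ a b, Adj a b → Adj b a) (hirr : ∀ a, ¬ Adj a a)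
    {blk : V → ℕ} {d : ℕ} (h : Good Adj blk d Finset.univ) :
    RingTheory.Sequence.IsRegular (MvPolynomial V K ⧸ J K Adj Finset.univ)
      ((List.range d).map (theta K blk)) := by
  have hW := WR_good (K := K) hsym hirr h
  refine ⟨⟨?_⟩, ?_⟩
  · intro i hi
    have hi' : i < d := by simpa using hi
    rw [isSMulRegular_quotient_iff_mem_of_smul_mem]
    intro x
    obtain ⟨f, rfl⟩ := Ideal.Quotient.mk_surjective x
    have e1 : ((List.range d).map (theta K blk))[i] = theta K blk i := by simp
    have e2 : ((List.range d).map (theta K blk)).take i = (List.range i).map (theta K blk) := by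
      rw [← List.map_take, List.take_range, min_eq_left hi'.le]
    have e3 : theta K blk i • Ideal.Quotient.mk (J K Adj Finset.univ) f =
      Ideal.Quotient.mk (J K Adj Finset.univ) (theta K blk i * f) := by
      rw [map_mul]; rfl
    rw [e1, e2, e3, mem_ofList_smul, mem_ofList_smul, ofList_theta]
    exact hW i hi' f
  · intro htop
    have h1 : Ideal.Quotient.mk (J K Adj Finset.univ) 1 ∈
        (Ideal.ofList ((List.range d).map (theta K blk)) • ⊤ :
          Submodule (MvPolynomial V K) (MvPolynomial V K ⧸ J K Adj Finset.univ)) := by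
      rw [← htop]; trivial
    rw [mem_ofList_smul, ofList_theta] at h1
    have h2 : J K Adj Finset.univ ⊔ Th (theta K blk) d ≤
        RingHom.ker (constantCoeff : MvPolynomial V K →+* K) := by
      refine sup_le (J_le_ker hirr) (Ideal.span_le.mpr ?_)
      rintro _ ⟨j, -, rfl⟩
      exact span_X_le_ker (theta_mem blk j)
    have h3 := h2 h1
    rw [RingHom.mem_ker, map_one] at h3
    exact one_ne_zero h3

/-- The evaluation killing the variables outside `U`. -/
noncomputable def killU (K : Type) [Field K] (U : Finset V) :
    MvPolynomial V K →ₐ[K] MvPolynomial V K :=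
  aeval fun v => if v ∈ U then X v else 0

theorem killU_eq_zero_iff (U : Finset V) (f : MvPolynomial V K) :
    killU K U f = 0 ↔ ∀ u ∈ f.support, ¬ u.support ⊆ U := by
  have key : killU K U f = 0 ↔ f ∈ J K (fun _ _ : V => False) U := by
    constructor
    · have hsub : ∀ f : MvPolynomial V K, f - killU K U f ∈ J K (fun _ _ : V => False) U := by
        intro f
        induction f using MvPolynomial.induction_on with
        | C a => simp [killU]
        | add p q hp hq =>
          have : p + q - killU K U (p + q) = (p - killU K U p) + (q - killU K U q) := by
            rw [map_add]; ring
          rw [this]; exact Ideal.add_mem _ hp hq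
        | mul_X p u hp =>
          have hu : X u - killU K U (X u) ∈ J K (fun _ _ : V => False) U := by
            simp only [killU, aeval_X]
            split_ifs with h
            · simp
            · rw [sub_zero]
              exact Ideal.subset_span ⟨_, Or.inr ⟨u, h, rfl⟩, rfl⟩
          have : p * X u - killU K U (p * X u) =
              (p - killU K U p) * X u + killU K U p * (X u - killU K U (X u)) := by
            rw [map_mul]; ring
          rw [this]
          exact Ideal.add_mem _ (Ideal.mul_mem_right _ _ hp) (Ideal.mul_mem_left _ _ hu)
      intro h
      have := hsub f
      rwa [h, sub_zero] at this
    · intro h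
      have hle : J K (fun _ _ : V => False) U ≤ RingHom.ker (killU K U) := by
        apply Ideal.span_le.mpr
        rintro _ ⟨u, (⟨a, b, hab, rfl⟩ | ⟨v, hv, rfl⟩), rfl⟩
        · exact hab.elim
        · change killU K U (X v) = 0
          simp [killU, hv]
      exact hle h
  rw [key, mem_J (fun _ h => h)]
  refine forall₂_congr fun u _ => ?_
  simp [Mon, Ind]

theorem ringKrullDim_killU_le (U : Finset V) :
    ringKrullDim (MvPolynomial V K ⧸ RingHom.ker (killU K U)) ≤ (U.card : ℕ) := by
  let g : MvPolynomial U K →+* MvPolynomial V K ⧸ RingHom.ker (killU K U) :=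
    (Ideal.Quotient.mk _).comp (rename (R := K) (Subtype.val : U → V)).toRingHom
  have hg : Function.Surjective g := by
    intro x
    obtain ⟨f, rfl⟩ := Ideal.Quotient.mk_surjective x
    induction f using MvPolynomial.induction_on with
    | C a => exact ⟨C a, by simp [g]⟩
    | add p q hp hq =>
      obtain ⟨a, ha⟩ := hp
      obtain ⟨b, hb⟩ := hq
      exact ⟨a + b, by rw [map_add, ha, hb, map_add]⟩
    | mul_X p u hp =>
      obtain ⟨a, ha⟩ := hp
      by_cases hu : u ∈ U
      · exact ⟨a * X ⟨u, hu⟩, by rw [map_mul, ha, map_mul]; simp [g]⟩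
      · refine ⟨0, ?_⟩
        rw [map_zero, eq_comm, Ideal.Quotient.eq_zero_iff_mem, RingHom.mem_ker, map_mul]
        simp [killU, hu]
  refine (ringKrullDim_le_of_surjective g hg).trans ?_
  rw [MvPolynomial.ringKrullDim_of_isNoetherianRing, ringKrullDim_eq_zero_of_field]
  simp

theorem Mon_add_indU {U : Finset V} (hU : Ind Adj U) (hdom : ∀ v, v ∉ U → ∃ u ∈ U, Adj v u)
    (u : V →₀ ℕ) : Mon Adj Finset.univ (u + indU U 1) ↔ u.support ⊆ U := by
  have hs : (u + indU U 1).support = u.support ∪ U := by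
    ext x
    simp only [Finsupp.mem_support_iff, Finsupp.add_apply, indU_apply, Finset.mem_union]
    split_ifs with h <;> simp [h]
  unfold Mon
  rw [hs]
  constructor
  · rintro ⟨-, h⟩ v hv
    by_contra hvU
    obtain ⟨w, hw, hvw⟩ := hdom v hvU
    exact h v (Finset.mem_union_left _ hv) w (Finset.mem_union_right _ hw) hvw
  · intro h
    rw [Finset.union_eq_right.mpr h]
    exact ⟨Finset.subset_univ _, hU⟩

theorem length_le_card (hirr : ∀ a, ¬ Adj a a) {U : Finset V} (hU : Ind Adj U)
    (hdom : ∀ v, v ∉ U → ∃ u ∈ U, Adj v u) (rs : List (MvPolynomial V K))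
    (hrs : ∀ f ∈ rs, f ∈ Ideal.span (Set.range (X : V → MvPolynomial V K)))
    (hreg : RingTheory.Sequence.IsRegular (MvPolynomial V K ⧸ J K Adj Finset.univ) rs) :
    rs.length ≤ U.card := by
  have hm : (RingHom.ker (constantCoeff : MvPolynomial V K →+* K)).IsPrime :=
    RingHom.ker_isPrime _
  have hP : (RingHom.ker (killU K U)).IsPrime := RingHom.ker_isPrime _
  have hPm : RingHom.ker (killU K U) ≤
      RingHom.ker (constantCoeff : MvPolynomial V K →+* K) := by
    intro f hf
    rw [RingHom.mem_ker, constantCoeff_eq]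
    by_contra h
    exact (killU_eq_zero_iff U f).mp hf 0 (mem_support_iff.mpr h) (by simp)
  have hx : ∀ a : MvPolynomial V K,
      a • (Ideal.Quotient.mk (J K Adj Finset.univ) (monomial (indU U 1) 1)) = 0 ↔
        a ∈ RingHom.ker (killU K U) := by
    intro a
    have e : a • (Ideal.Quotient.mk (J K Adj Finset.univ) (monomial (indU U 1) 1)) =
      Ideal.Quotient.mk (J K Adj Finset.univ) (a * monomial (indU U 1) 1) := by
      rw [map_mul]; rfl
    rw [e, Ideal.Quotient.eq_zero_iff_mem, mul_monomial_mem hirr, RingHom.mem_ker,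
      killU_eq_zero_iff]
    exact forall₂_congr fun u _ => by rw [Mon_add_indU hU hdom]
  have h1 := length_le_ringKrullDim _ rs (fun r hr => span_X_le_ker (hrs r hr))
    hreg.toIsWeaklyRegular hP hPm hx
  have h2 := h1.trans (ringKrullDim_killU_le U)
  exact_mod_cast h2

theorem rdepth_eq (hsym : ∀ a b, Adj a b → Adj b a) (hirr : ∀ a, ¬ Adj a a)
    {blk : V → ℕ} {d : ℕ} (h : Good Adj blk d Finset.univ) {U : Finset V} (hU : Ind Adj U)
    (hdom : ∀ v, v ∉ U → ∃ u ∈ U, Adj v u) (hd : U.card ≤ d) :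
    rdepth K V (MvPolynomial V K ⧸ J K Adj Finset.univ) = d := by
  apply IsGreatest.csSup_eq
  constructor
  · refine ⟨(List.range d).map (theta K blk), by simp, ?_, isRegular_of_good hsym hirr h⟩
    intro f hf
    obtain ⟨j, -, rfl⟩ := List.mem_map.mp hf
    exact theta_mem blk j
  · rintro _ ⟨rs, rfl, hrs, hreg⟩
    exact (length_le_card hirr hU hdom rs hrs hreg).trans hd

theorem card_le_of_decomp (hirr : ∀ a, ¬ Adj a a) {U : Finset V} (hU : Ind Adj U)
    (hdom : ∀ v, v ∉ U → ∃ u ∈ U, Adj v u) {r : ℕ}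
    (w : Fin r → MvPolynomial V K ⧸ J K Adj Finset.univ) (A : Fin r → Finset V)
    (h : IsStanleyDecomp K V _ w A) : sInf (Set.range fun i => (A i).card) ≤ U.card := by
  by_contra hlt
  push Not at hlt
  obtain ⟨hfree, -, htop⟩ := h
  have hA : ∀ i, U.card < (A i).card := fun i => lt_of_lt_of_le hlt (Nat.sInf_le ⟨i, rfl⟩)
  have hind : ∀ i, Ind Adj (A i) := by
    intro i a ha b hb hab
    have h1 : (X a * X b : MvPolynomial V K) = 0 := by
      apply hfree i
      · intro x hx
        have := vars_mul (R := K) (X a) (X b) hx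
        rw [vars_X, vars_X] at this
        rcases Finset.mem_union.mp this with h | h
        · rw [Finset.mem_singleton.mp h]; exact ha
        · rw [Finset.mem_singleton.mp h]; exact hb
      · obtain ⟨p, hp⟩ := Ideal.Quotient.mk_surjective (w i)
        rw [← hp]
        change Ideal.Quotient.mk (J K Adj Finset.univ) (X a * X b * p) = 0
        rw [Ideal.Quotient.eq_zero_iff_mem]
        refine Ideal.mul_mem_right _ _ (Ideal.subset_span ⟨_, Or.inl ⟨a, b, hab, rfl⟩, ?_⟩)
        simp [X, monomial_mul]
    exact mul_ne_zero (X_ne_zero a) (X_ne_zero b) h1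
  have hnot : ∀ i, ∃ v ∈ U, v ∉ A i := by
    intro i
    by_contra hcon
    push Not at hcon
    have : A i ⊆ U := by
      intro v hv
      by_contra hvU
      obtain ⟨u, hu, hvu⟩ := hdom v hvU
      exact hind i v hv u (hcon u hu) hvu
    exact absurd (Finset.card_le_card this) (not_le.mpr (hA i))
  choose p hp using fun i => Ideal.Quotient.mk_surjective (w i)
  let D := ∑ i, (p i).totalDegree
  let e := indU U (D + 1)
  let Z : Submodule K (MvPolynomial V K ⧸ J K Adj Finset.univ) :=
    Submodule.map (Ideal.Quotient.mkₐ K (J K Adj Finset.univ)).toLinearMap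
      (LinearMap.ker (lcoeff K e))
  have hle : (⨆ i, stanleySpace K V _ (w i) (A i)) ≤ Z := by
    refine iSup_le fun i => Submodule.span_le.mpr ?_
    rintro _ ⟨u, hu, rfl⟩
    refine ⟨monomial u 1 * p i, ?_, ?_⟩
    · change coeff e (monomial u 1 * p i) = 0
      by_contra hne
      rw [coeff_monomial_mul'] at hne
      split_ifs at hne with hle
      · rw [one_mul] at hne
        obtain ⟨v, hvU, hvA⟩ := hnot i
        have h1 : u v = 0 := by
          by_contra h0
          exact hvA (hu (Finsupp.mem_support_iff.mpr h0))
        have h2 : (e - u) v = D + 1 := by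
          rw [Finsupp.tsub_apply, h1]
          simp [e, indU_apply, hvU]
        have h3 : (e - u) v ≤ (p i).totalDegree := by
          refine le_trans ?_ (le_totalDegree (mem_support_iff.mpr hne))
          by_cases h0 : v ∈ (e - u).support
          · exact Finset.single_le_sum (f := fun x => (e - u) x) (fun _ _ => Nat.zero_le _) h0
          · rw [Finsupp.notMem_support_iff.mp h0]; exact Nat.zero_le _
        have h4 : (p i).totalDegree ≤ D :=
          Finset.single_le_sum (f := fun i => (p i).totalDegree) (fun _ _ => Nat.zero_le _)
            (Finset.mem_univ i)
        omega
      · exact hne rfl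
    · rw [← hp i]
      rfl
  rw [htop] at hle
  obtain ⟨f, hf0, hf⟩ := hle (show Ideal.Quotient.mk (J K Adj Finset.univ) (monomial e 1) ∈ ⊤ from
    trivial)
  have hf0' : coeff e f = 0 := hf0
  have hf' : f - monomial e 1 ∈ J K Adj Finset.univ := Ideal.Quotient.eq.mp hf
  refine (mem_J hirr).mp hf' e ?_ ⟨Finset.subset_univ _, ?_⟩
  · rw [mem_support_iff, coeff_sub, hf0', coeff_monomial, if_pos rfl]
    simp
  · rw [indU_support]; exact hU

theorem exists_partition (hsym : ∀ a b, Adj a b → Adj b a) (hirr : ∀ a, ¬ Adj a a)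
    {blk : V → ℕ} {d : ℕ} {W : Finset V} (h : Good Adj blk d W) :
    ∃ (ι : Type) (_ : Fintype ι) (w : ι → V →₀ ℕ) (A : ι → Finset V),
      (∀ i, d ≤ (A i).card) ∧ (∀ i u, u.support ⊆ A i → Mon Adj W (w i + u)) ∧
      (∀ m, Mon Adj W m → ∃ i u, u.support ⊆ A i ∧ m = w i + u) ∧
      (∀ i j u u', u.support ⊆ A i → u'.support ⊆ A j → w i + u = w j + u' → i = j) := by
  induction h with
  | leaf W h hb =>
    refine ⟨Unit, inferInstance, fun _ => 0, fun _ => W, ?_, ?_, ?_, ?_⟩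
    · intro _
      have : Finset.range d ⊆ W.image blk := by
        intro j hj
        obtain ⟨v, hv, rfl⟩ := hb j (Finset.mem_range.mp hj)
        exact Finset.mem_image_of_mem _ hv
      simpa using (Finset.card_le_card this).trans Finset.card_image_le
    · intro _ u hu
      rw [zero_add]
      exact ⟨hu, fun a ha b hb => h a (hu ha) b (hu hb)⟩
    · intro m hm
      exact ⟨(), m, hm.1, by rw [zero_add]⟩
    · intros; rfl
  | split W W1 v hv hW1 _ _ ih1 ih2 =>
    obtain ⟨ι1, _, w1, A1, c1, m1, e1, u1⟩ := ih1
    obtain ⟨ι2, _, w2, A2, c2, m2, e2, u2⟩ := ih2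
    have hne : ∀ i j u u', u'.support ⊆ A2 j →
        (Finsupp.single v 1 + w1 i) + u ≠ w2 j + u' := by
      intro i j u u' hu' he
      have h1 := (m2 j u' hu').1
      rw [← he] at h1
      have h3 : v ∈ W.erase v := h1 (by rw [Finsupp.mem_support_iff]; simp)
      exact absurd h3 (Finset.notMem_erase v W)
    refine ⟨ι1 ⊕ ι2, inferInstance, Sum.elim (fun i => Finsupp.single v 1 + w1 i) w2,
      Sum.elim A1 A2, ?_, ?_, ?_, ?_⟩
    · rintro (i | i)
      · exact c1 i
      · exact c2 i
    · rintro (i | i) u hu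
      · change Mon Adj W (Finsupp.single v 1 + w1 i + u)
        rw [add_assoc, Mon_single_add hsym hirr hv hW1]
        exact m1 i u hu
      · exact ⟨(m2 i u hu).1.trans (Finset.erase_subset _ _), (m2 i u hu).2⟩
    · intro m hm
      by_cases hmv : m v = 0
      · obtain ⟨i, u, hu, he⟩ := e2 m ⟨fun x hx => Finset.mem_erase.mpr
          ⟨fun hxv => Finsupp.mem_support_iff.mp hx (hxv ▸ hmv), hm.1 hx⟩, hm.2⟩
        exact ⟨Sum.inr i, u, hu, he⟩
      · have hle : Finsupp.single v 1 ≤ m := by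
          rw [Finsupp.single_le_iff]; omega
        have hm' : m = Finsupp.single v 1 + (m - Finsupp.single v 1) :=
          (add_tsub_cancel_of_le hle).symm
        have h1 := hm
        rw [hm', Mon_single_add hsym hirr hv hW1] at h1
        obtain ⟨i, u, hu, he⟩ := e1 _ h1
        refine ⟨Sum.inl i, u, hu, ?_⟩
        change m = Finsupp.single v 1 + w1 i + u
        rw [add_assoc, ← he]
        exact hm'
    · rintro (i | i) (j | j) u u' hu hu' he
      · refine congrArg Sum.inl (u1 i j u u' hu hu' ?_)
        change Finsupp.single v 1 + w1 i + u = Finsupp.single v 1 + w1 j + u' at he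
        rw [add_assoc, add_assoc] at he
        exact add_left_cancel he
      · exact absurd he (hne i j u u' hu')
      · exact absurd he.symm (hne j i u' u hu)
      · exact congrArg Sum.inr (u2 i j u u' hu hu' he)

theorem exists_decomp (hsym : ∀ a b, Adj a b → Adj b a) (hirr : ∀ a, ¬ Adj a a)
    {blk : V → ℕ} {d : ℕ} (h : Good Adj blk d Finset.univ) :
    ∃ (r : ℕ) (w : Fin r → MvPolynomial V K ⧸ J K Adj Finset.univ) (A : Fin r → Finset V),
      IsStanleyDecomp K V _ w A ∧ 0 < r ∧ ∀ i, d ≤ (A i).card := by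
  classical
  obtain ⟨ι, _, w0, A0, c0, m0, e0, u0⟩ := exists_partition hsym hirr h
  let eq := Fintype.equivFin ι
  obtain ⟨w, hw⟩ : ∃ w : Fin (Fintype.card ι) → V →₀ ℕ, w = fun i => w0 (eq.symm i) := ⟨_, rfl⟩
  obtain ⟨A, hA⟩ : ∃ A : Fin (Fintype.card ι) → Finset V, A = fun i => A0 (eq.symm i) := ⟨_, rfl⟩
  have c1 : ∀ i, d ≤ (A i).card := fun i => by rw [hA]; exact c0 _
  have m1 : ∀ i u, u.support ⊆ A i → Mon Adj Finset.univ (w i + u) := fun i u => by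
    rw [hA, hw]; exact m0 _ u
  have e1 : ∀ m, Mon Adj Finset.univ m → ∃ i u, u.support ⊆ A i ∧ m = w i + u := by
    intro m hm
    obtain ⟨i, u, hu, he⟩ := e0 m hm
    exact ⟨eq i, u, by simpa [hA] using hu, by simpa [hw] using he⟩
  have u1 : ∀ i j u u', u.support ⊆ A i → u'.support ⊆ A j → w i + u = w j + u' → i = j := by
    intro i j u u' hu hu' he
    rw [hA] at hu hu'
    rw [hw] at he
    exact eq.symm.injective (u0 _ _ u u' hu hu' he)
  let q := (Ideal.Quotient.mkₐ K (J K Adj Finset.univ)).toLinearMap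
  have hq : ∀ f, q f = Ideal.Quotient.mk (J K Adj Finset.univ) f := fun f => rfl
  let T : Fin (Fintype.card ι) → Set (V →₀ ℕ) := fun i => {m | ∃ u, u.support ⊆ A i ∧ m = w i + u}
  have hst : ∀ i, stanleySpace K V _ (Ideal.Quotient.mk (J K Adj Finset.univ) (monomial (w i) 1))
      (A i) = (restrictSupport K (T i)).map q := by
    intro i
    rw [restrictSupport_eq_span, Submodule.map_span, ← Set.image_comp]
    unfold stanleySpace
    congr 1
    have hmm : ∀ u : V →₀ ℕ, (monomial u (1 : K) : MvPolynomial V K) •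
        Ideal.Quotient.mk (J K Adj Finset.univ) (monomial (w i) 1) =
        q (monomial (w i + u) 1) := by
      intro u
      change Ideal.Quotient.mk (J K Adj Finset.univ) (monomial u 1 * monomial (w i) 1) = _
      rw [monomial_mul, one_mul, add_comm, hq]
    ext x
    constructor
    · rintro ⟨u, hu, rfl⟩
      exact ⟨w i + u, ⟨u, by exact_mod_cast hu, rfl⟩, (hmm u).symm⟩
    · rintro ⟨_, ⟨u, hu, rfl⟩, rfl⟩
      exact ⟨u, by exact_mod_cast hu, (hmm u).symm⟩
  refine ⟨_, fun i => Ideal.Quotient.mk _ (monomial (w i) 1), A, ⟨?_, ?_, ?_⟩, ?_, c1⟩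
  · intro i f hf hfw
    have hmem : f * monomial (w i) 1 ∈ J K Adj Finset.univ := Ideal.Quotient.eq_zero_iff_mem.mp hfw
    rw [mul_monomial_mem hirr] at hmem
    rw [← support_eq_empty, Finset.eq_empty_iff_forall_notMem]
    intro u hu
    refine hmem u hu ?_
    rw [add_comm]
    refine m1 i u fun x hx => ?_
    have : x ∈ f.vars := (mem_vars x).mpr ⟨u, hu, hx⟩
    exact_mod_cast hf this
  · intro i
    simp only [hst]
    rw [Submodule.disjoint_def]
    intro x hx hx'
    have hle : (⨆ j, ⨆ (_ : j ≠ i), (restrictSupport K (T j)).map q) ≤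
        (restrictSupport K (⋃ j, ⋃ (_ : j ≠ i), T j)).map q := by
      refine iSup₂_le fun j hj => Submodule.map_mono (restrictSupport_mono K ?_)
      exact Set.subset_biUnion_of_mem (u := fun j => T j) (show j ∈ {j | j ≠ i} from hj)
    obtain ⟨g, hg, hgx⟩ := hle hx'
    obtain ⟨f, hf, rfl⟩ := hx
    have hf' : ↑f.support ⊆ T i := hf
    have hg' : ↑g.support ⊆ ⋃ j, ⋃ (_ : j ≠ i), T j := hg
    have hTm : ∀ j, ∀ m ∈ T j, Mon Adj Finset.univ m := by
      rintro j _ ⟨u, hu, rfl⟩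
      exact m1 j u hu
    have hJ : g - f ∈ J K Adj Finset.univ := Ideal.Quotient.eq.mp hgx
    have hgf : g - f = 0 := by
      rw [← support_eq_empty, Finset.eq_empty_iff_forall_notMem]
      intro u hu
      refine (mem_J hirr).mp hJ u hu ?_
      rcases Finset.mem_union.mp (support_sub V g f hu) with h | h
      · obtain ⟨j, hj⟩ := Set.mem_iUnion.mp (hg' h)
        obtain ⟨_, hj⟩ := Set.mem_iUnion.mp hj
        exact hTm j u hj
      · exact hTm i u (hf' h)
    have hf0 : f = 0 := by
      rw [← support_eq_empty, Finset.eq_empty_iff_forall_notMem]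
      intro m hm
      obtain ⟨u, hu, he⟩ := hf' hm
      rw [← sub_eq_zero.mp hgf] at hm
      obtain ⟨j, hj⟩ := Set.mem_iUnion.mp (hg' hm)
      obtain ⟨hji, u', hu', he'⟩ := Set.mem_iUnion.mp hj
      exact hji (u1 j i u' u hu' hu (he'.symm.trans he))
    rw [hf0, map_zero]
  · rw [eq_top_iff]
    intro x _
    obtain ⟨f, rfl⟩ := Ideal.Quotient.mk_surjective x
    rw [← hq, f.as_sum, map_sum]
    refine Submodule.sum_mem _ fun m _ => ?_
    by_cases hm : Mon Adj Finset.univ m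
    · obtain ⟨i, u, hu, he⟩ := e1 m hm
      refine Submodule.mem_iSup_of_mem i ?_
      rw [hst]
      exact ⟨_, (monomial_mem_restrictSupport K).mpr (Or.inl ⟨u, hu, he⟩), rfl⟩
    · have : q (monomial m (coeff m f)) = 0 := by
        rw [hq, Ideal.Quotient.eq_zero_iff_mem, mem_J hirr]
        intro u hu
        rw [Finset.mem_singleton.mp (support_monomial_subset hu)]
        exact hm
      rw [this]
      exact Submodule.zero_mem _
  · obtain ⟨i, -⟩ := e1 0 ⟨by simp, fun a ha => by simp at ha⟩
    exact lt_of_le_of_lt (Nat.zero_le _) i.2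

theorem sdepth_eq (hsym : ∀ a b, Adj a b → Adj b a) (hirr : ∀ a, ¬ Adj a a)
    {blk : V → ℕ} {d : ℕ} (h : Good Adj blk d Finset.univ) {U : Finset V} (hU : Ind Adj U)
    (hdom : ∀ v, v ∉ U → ∃ u ∈ U, Adj v u) (hd : U.card ≤ d) :
    sdepth K V (MvPolynomial V K ⧸ J K Adj Finset.univ) = d := by
  apply IsGreatest.csSup_eq
  constructor
  · obtain ⟨r, w, A, hdec, hr, hA⟩ := exists_decomp (K := K) hsym hirr h
    refine ⟨r, w, A, hdec, le_antisymm ?_ ((card_le_of_decomp hirr hU hdom w A hdec).trans hd)⟩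
    refine le_csInf ⟨_, ⟨⟨0, hr⟩, rfl⟩⟩ ?_
    rintro _ ⟨i, rfl⟩
    exact hA i
  · rintro _ ⟨r, w, A, hdec, rfl⟩
    exact (card_le_of_decomp hirr hU hdom w A hdec).trans hd

end Main

section Path
open Classical

theorem pAdj_iff {n : ℕ} (a b : Fin n × Fin 2) : pAdj n 2 a b ↔
    ¬ (a.1.val = b.1.val ∧ a.2.val = b.2.val) ∧ a.1.val ≤ b.1.val + 1 ∧ b.1.val ≤ a.1.val + 1 := by
  have e : a = b ↔ (a.1.val = b.1.val ∧ a.2.val = b.2.val) := by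
    rw [Prod.ext_iff, Fin.ext_iff, Fin.ext_iff]
  have h1 := a.2.isLt
  have h2 := b.2.isLt
  unfold pAdj
  rw [Ne, e, abs_le, abs_le]
  omega

theorem pair_eq_iff {n : ℕ} (a b : Fin n × Fin 2) :
    a = b ↔ (a.1.val = b.1.val ∧ a.2.val = b.2.val) := by
  rw [Prod.ext_iff, Fin.ext_iff, Fin.ext_iff]

/-- The block of a vertex. -/
def pblk (n : ℕ) (v : Fin n × Fin 2) : ℕ := (v.1.val + 1) / 3

/-- The states of the recursive decomposition. -/
def St (n k : ℕ) (L W : Finset (Fin n × Fin 2)) : Prop :=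
  (∀ x, x ∈ W ↔ x ∈ L ∨ k ≤ x.1.val) ∧ Ind (pAdj n 2) L ∧ (∀ x ∈ L, x.1.val + 2 ≤ k) ∧
    ∀ j, j < (k + 2) / 3 → ∃ v ∈ L, pblk n v = j

theorem good_split {n : ℕ} {blk : Fin n × Fin 2 → ℕ} {d : ℕ} {W : Finset (Fin n × Fin 2)}
    (v : Fin n × Fin 2)
    (hv : v ∈ W) (h1 : Good (pAdj n 2) blk d (W.filter fun x => ¬ pAdj n 2 v x))
    (h2 : Good (pAdj n 2) blk d (W.erase v)) : Good (pAdj n 2) blk d W :=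
  Good.split W _ v hv (fun x => by simp) h1 h2

theorem st_insert {n k k' : ℕ} {L W W' : Finset (Fin n × Fin 2)} (h : St n k L W)
    (v : Fin n × Fin 2) (hv : k ≤ v.1.val) (hk : v.1.val + 2 ≤ k')
    (hb : ∀ j, (k + 2) / 3 ≤ j → j < (k' + 2) / 3 → j = (v.1.val + 1) / 3)
    (hW : ∀ x, x ∈ W' ↔ x ∈ insert v L ∨ k' ≤ x.1.val) : St n k' (insert v L) W' := by
  obtain ⟨-, hi, hl, hm⟩ := h
  refine ⟨hW, ?_, ?_, ?_⟩
  · intro a ha b hb'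
    rw [Finset.mem_insert] at ha hb'
    rcases ha with rfl | ha <;> rcases hb' with rfl | hb'
    · rw [pAdj_iff]; omega
    · have := hl b hb'
      rw [pAdj_iff]; omega
    · have := hl a ha
      rw [pAdj_iff]; omega
    · exact hi a ha b hb'
  · intro x hx
    rcases Finset.mem_insert.mp hx with rfl | hx
    · exact hk
    · have := hl x hx
      omega
  · intro j hj
    by_cases hjk : j < (k + 2) / 3
    · obtain ⟨u, hu, e⟩ := hm j hjk
      exact ⟨u, Finset.mem_insert_of_mem hu, e⟩
    · exact ⟨v, Finset.mem_insert_self _ _, (hb j (by omega) hj).symm⟩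

theorem good_state (n : ℕ) : ∀ m k L W, n ≤ k + m → St n k L W →
    Good (pAdj n 2) (pblk n) ((n + 2) / 3) W := by
  intro m
  induction m using Nat.strong_induction_on with
  | _ m ih =>
  intro k L W hm hS
  have hS0 := hS
  obtain ⟨hW, hi, hl, hmt⟩ := hS
  have step : ∀ k' L' W', k < k' → St n k' L' W' →
      k < n → Good (pAdj n 2) (pblk n) ((n + 2) / 3) W' := by
    intro k' L' W' h1 h2 h3
    exact ih (m - 1) (by omega) k' L' W' (by omega) h2
  by_cases hkn : n ≤ k
  · have e : W = L := by
      ext x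
      rw [hW]
      have := x.1.isLt
      constructor
      · rintro (h | h)
        · exact h
        · omega
      · exact Or.inl
    subst e
    exact Good.leaf _ hi fun j hj => hmt j (by omega)
  push Not at hkn
  -- the two vertices of column `k`
  obtain ⟨a, ha1, ha2⟩ : ∃ a : Fin n × Fin 2, a.1.val = k ∧ a.2.val = 0 :=
    ⟨(⟨k, hkn⟩, 0), rfl, rfl⟩
  obtain ⟨b, hb1, hb2⟩ : ∃ b : Fin n × Fin 2, b.1.val = k ∧ b.2.val = 1 :=
    ⟨(⟨k, hkn⟩, 1), rfl, rfl⟩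
  by_cases hk : k % 3 = 1
  · refine good_split a ?_ ?_ ?_
    · rw [hW]; omega
    · refine step (k + 2) (insert a L) _ (by omega) (st_insert hS0 a ?_ ?_ ?_ ?_) hkn
      · omega
      · omega
      · omega
      · intro x
        have hx2 := x.2.isLt
        simp only [Finset.mem_filter, hW, Finset.mem_insert, pAdj_iff, pair_eq_iff]
        by_cases hx : x ∈ L
        · have := hl x hx
          simp only [hx, true_or, or_true, true_and, iff_true]
          omega
        · simp only [hx, false_or, or_false]
          omega
    · refine good_split b ?_ ?_ ?_
      · simp only [Finset.mem_erase, hW, ne_eq, pair_eq_iff]; omega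
      · refine step (k + 2) (insert b L) _ (by omega) (st_insert hS0 b ?_ ?_ ?_ ?_) hkn
        · omega
        · omega
        · omega
        · intro x
          have hx2 := x.2.isLt
          simp only [Finset.mem_filter, Finset.mem_erase, hW, Finset.mem_insert, pAdj_iff,
            pair_eq_iff, ne_eq]
          by_cases hx : x ∈ L
          · have := hl x hx
            simp only [hx, true_or, or_true, true_and, iff_true, and_true]
            omega
          · simp only [hx, false_or, or_false]
            omega
      · refine step (k + 1) L _ (by omega) ⟨?_, hi, ?_, ?_⟩ hkn
        · intro x
          have hx2 := x.2.isLt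
          simp only [Finset.mem_erase, hW, pair_eq_iff, ne_eq]
          by_cases hx : x ∈ L
          · have := hl x hx
            simp only [hx, true_or, iff_true, and_true]
            omega
          · simp only [hx, false_or]
            omega
        · intro x hx
          have := hl x hx
          omega
        · intro j hj
          exact hmt j (by omega)
  · -- the part where column `k + 1` has been removed
    have main : ∀ W' : Finset (Fin n × Fin 2),
        (∀ x, x ∈ W' ↔ x ∈ L ∨ x.1.val = k ∨ k + 2 ≤ x.1.val) →
        Good (pAdj n 2) (pblk n) ((n + 2) / 3) W' := by
      intro W' hW'
      refine good_split a ?_ ?_ ?_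
      · rw [hW']; omega
      · refine step (k + 2) (insert a L) _ (by omega) (st_insert hS0 a ?_ ?_ ?_ ?_) hkn
        · omega
        · omega
        · omega
        · intro x
          have hx2 := x.2.isLt
          simp only [Finset.mem_filter, hW', Finset.mem_insert, pAdj_iff, pair_eq_iff]
          by_cases hx : x ∈ L
          · have := hl x hx
            simp only [hx, true_or, or_true, true_and, iff_true]
            omega
          · simp only [hx, false_or, or_false]
            omega
      · refine step (k + 2) (insert b L) _ (by omega) (st_insert hS0 b ?_ ?_ ?_ ?_) hkn
        · omega
        · omega
        · omega
        · intro x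
          have hx2 := x.2.isLt
          simp only [Finset.mem_erase, hW', Finset.mem_insert, pair_eq_iff, ne_eq]
          by_cases hx : x ∈ L
          · have := hl x hx
            simp only [hx, true_or, or_true, iff_true, and_true]
            omega
          · simp only [hx, false_or, or_false]
            omega
    by_cases hk1 : k + 1 < n
    · obtain ⟨c, hc1, hc2⟩ : ∃ c : Fin n × Fin 2, c.1.val = k + 1 ∧ c.2.val = 0 :=
        ⟨(⟨k + 1, hk1⟩, 0), rfl, rfl⟩
      obtain ⟨e, he1, he2⟩ : ∃ e : Fin n × Fin 2, e.1.val = k + 1 ∧ e.2.val = 1 :=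
        ⟨(⟨k + 1, hk1⟩, 1), rfl, rfl⟩
      refine good_split c ?_ ?_ ?_
      · rw [hW]; omega
      · refine step (k + 3) (insert c L) _ (by omega) (st_insert hS0 c ?_ ?_ ?_ ?_) hkn
        · omega
        · omega
        · omega
        · intro x
          have hx2 := x.2.isLt
          simp only [Finset.mem_filter, hW, Finset.mem_insert, pAdj_iff, pair_eq_iff]
          by_cases hx : x ∈ L
          · have := hl x hx
            simp only [hx, true_or, or_true, true_and, iff_true]
            omega
          · simp only [hx, false_or, or_false]
            omega
      · refine good_split e ?_ ?_ ?_
        · simp only [Finset.mem_erase, hW, ne_eq, pair_eq_iff]; omega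
        · refine step (k + 3) (insert e L) _ (by omega) (st_insert hS0 e ?_ ?_ ?_ ?_) hkn
          · omega
          · omega
          · omega
          · intro x
            have hx2 := x.2.isLt
            simp only [Finset.mem_filter, Finset.mem_erase, hW, Finset.mem_insert, pAdj_iff,
              pair_eq_iff, ne_eq]
            by_cases hx : x ∈ L
            · have := hl x hx
              simp only [hx, true_or, or_true, true_and, iff_true, and_true]
              omega
            · simp only [hx, false_or, or_false]
              omega
        · apply main
          intro x
          have hx2 := x.2.isLt
          simp only [Finset.mem_erase, hW, pair_eq_iff, ne_eq]
          by_cases hx : x ∈ L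
          · have := hl x hx
            simp only [hx, true_or, iff_true, and_true]
            omega
          · simp only [hx, false_or]
            omega
    · apply main
      intro x
      have hx1 := x.1.isLt
      rw [hW]
      by_cases hx : x ∈ L
      · simp only [hx, true_or]
      · simp only [hx, false_or]
        omega

theorem good_univ (n : ℕ) : Good (pAdj n 2) (pblk n) ((n + 2) / 3) Finset.univ := by
  refine good_state n n 0 ∅ Finset.univ (by omega) ⟨by simp, ?_, by simp, ?_⟩
  · intro a ha
    simp at ha
  · intro j hj
    omega

theorem exists_dom (n : ℕ) (hn : 1 ≤ n) : ∃ U : Finset (Fin n × Fin 2), Ind (pAdj n 2) U ∧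
    (∀ v, v ∉ U → ∃ u ∈ U, pAdj n 2 v u) ∧ U.card ≤ (n + 2) / 3 := by
  refine ⟨(Finset.range ((n + 2) / 3)).image
    fun j => (⟨min (3 * j + 1) (n - 1), by omega⟩, 0), ?_, ?_, ?_⟩
  · intro a ha b hb
    obtain ⟨i, hi, rfl⟩ := Finset.mem_image.mp ha
    obtain ⟨j, hj, rfl⟩ := Finset.mem_image.mp hb
    rw [Finset.mem_range] at hi hj
    rw [pAdj_iff]
    simp only
    rintro ⟨h1, h2, h3⟩
    have h4 : i ≠ j := by
      rintro rfl
      simp at h1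
    omega
  · intro v hv
    have hlt := v.1.isLt
    have hmem : ((⟨min (3 * (v.1.val / 3) + 1) (n - 1), by omega⟩, 0) : Fin n × Fin 2) ∈
        (Finset.range ((n + 2) / 3)).image
          fun j => ((⟨min (3 * j + 1) (n - 1), by omega⟩, 0) : Fin n × Fin 2) :=
      Finset.mem_image.mpr ⟨v.1.val / 3, by rw [Finset.mem_range]; omega, rfl⟩
    refine ⟨_, hmem, ?_⟩
    rw [pAdj_iff]
    refine ⟨?_, ?_, ?_⟩
    · rw [← pair_eq_iff]
      intro e
      exact hv (e ▸ hmem)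
    · simp only
      omega
    · simp only
      omega
  · exact Finset.card_image_le.trans (by simp)

theorem pAdj_symm {n : ℕ} (a b : Fin n × Fin 2) (h : pAdj n 2 a b) : pAdj n 2 b a := by
  rw [pAdj_iff] at h ⊢
  omega

theorem pAdj_irrefl {n : ℕ} (a : Fin n × Fin 2) : ¬ pAdj n 2 a a := fun h => h.1 rfl

end Path

end SD

/-- For every integer `n ≥ 1`,
`depth(S_{n,2}/I(P_{n,2})) = sdepth(S_{n,2}/I(P_{n,2})) = ⌈n/3⌉`. -/
theorem depth_sdepth_quotient_edgeIdeal_P_n_2 (K : Type) [Field K] (n : ℕ) (hn : 1 ≤ n) :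
    rdepth K (Fin n × Fin 2)
        (MvPolynomial (Fin n × Fin 2) K ⧸ edgeIdeal K (pAdj n 2)) = (n + 2) / 3 ∧
    sdepth K (Fin n × Fin 2)
        (MvPolynomial (Fin n × Fin 2) K ⧸ edgeIdeal K (pAdj n 2)) = (n + 2) / 3 := by

  obtain ⟨U, hU, hdom, hcard⟩ := SD.exists_dom n hn
  have hgood := SD.good_univ n
  rw [SD.edgeIdeal_eq]
  exact ⟨SD.rdepth_eq SD.pAdj_symm SD.pAdj_irrefl (by convert hgood) hU hdom hcard,
    SD.sdepth_eq SD.pAdj_symm SD.pAdj_irrefl (by convert hgood) hU hdom hcard⟩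
end

section
/- For every integer n ≥ 1, depth(S_{n,3}/I(P_{n,3})) = sdepth(S_{n,3}/I(P_{n,3})) = ⌈n/3⌉. -/
open MvPolynomial

set_option linter.unusedSectionVars false
theorem depth_upper_aux {R : Type} [CommRing R] [IsNoetherianRing R] (m : Ideal R) [m.IsPrime]
    (rs : List R) : ∀ (M : Type) [AddCommGroup M] [Module R M] [Module.Finite R M],
    (∀ x ∈ rs, x ∈ m) → RingTheory.Sequence.IsWeaklyRegular M rs →
    ∀ (p : Ideal R), p.IsPrime → p ≤ m → ∀ y : M, (∀ s : R, s • y = 0 ↔ s ∈ p) →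
    (rs.length : WithBot ℕ∞) ≤ ringKrullDim (R ⧸ p) := by
  induction rs with
  | nil =>
    intro M _ _ _ _ _ p hp _ y _
    have : Nontrivial (R ⧸ p) := Ideal.Quotient.nontrivial_iff.mpr hp.ne_top
    simpa using (ringKrullDim_nonneg_of_nontrivial (R := R ⧸ p))
  | cons x rs ih =>
    intro M _ _ _ hm hreg p hp hpm y hy
    rw [RingTheory.Sequence.isWeaklyRegular_cons_iff] at hreg
    obtain ⟨hx, hreg⟩ := hreg
    have hxm : x ∈ m := hm x (by simp)
    have hxp : x ∉ p := by
      intro h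
      have h1 := (hy x).2 h
      have h2 : y = 0 := hx (by simpa using h1)
      have : (1 : R) ∈ p := (hy 1).1 (by simp [h2])
      exact hp.ne_top ((Ideal.eq_top_iff_one p).2 this)
    -- N
    let N : Submodule R M :=
      { carrier := {z | ∀ s ∈ p, s • z = 0}
        add_mem' := by
          intro a b ha hb s hs
          rw [smul_add, ha s hs, hb s hs, add_zero]
        zero_mem' := by intro s hs; simp
        smul_mem' := by
          intro c a ha s hs
          rw [smul_comm, ha s hs, smul_zero] }
    have hyN : y ∈ N := fun s hs => (hy s).2 hs
    let π : M →ₗ[R] QuotSMulTop x M := Submodule.mkQ _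
    let N' : Submodule R (QuotSMulTop x M) := N.map π
    have hann : Module.annihilator R N' ≤ m := by
      intro s hs
      rw [Module.mem_annihilator] at hs
      have key : ∀ z ∈ N, ∃ z' ∈ N, s • z = x • z' := by
        intro z hz
        have h1 := hs ⟨π z, Submodule.mem_map_of_mem hz⟩
        have h2 : π (s • z) = 0 := by
          rw [map_smul]
          exact congrArg Subtype.val h1
        rw [Submodule.mkQ_apply, Submodule.Quotient.mk_eq_zero,
          Submodule.mem_smul_pointwise_iff_exists] at h2
        obtain ⟨z', -, hz'⟩ := h2
        refine ⟨z', ?_, hz'.symm⟩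
        intro t ht
        apply hx
        change x • t • z' = x • 0
        rw [smul_comm, hz', smul_comm, hz t ht, smul_zero, smul_zero]
      obtain ⟨q, hmon, -, hcoeff, hq⟩ :=
        LinearMap.exists_monic_and_natDegree_eq_and_coeff_mem_pow_and_aeval_eq_zero
          (R := R) (M := N) (LinearMap.lsmul R N s) (Ideal.span {x}) (by
            rintro _ ⟨⟨z, hz⟩, rfl⟩
            obtain ⟨z', hz', h⟩ := key z hz
            have : (LinearMap.lsmul R N s) ⟨z, hz⟩ = x • (⟨z', hz'⟩ : N) := Subtype.ext h
            rw [this]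
            exact Submodule.smul_mem_smul (Ideal.mem_span_singleton_self x) trivial)
      have h3 : q.eval s ∈ p := by
        rw [← hy]
        have h4 : (Polynomial.aeval (LinearMap.lsmul R N s) q) ⟨y, hyN⟩ = q.eval s • ⟨y, hyN⟩ := by
          have : LinearMap.lsmul R N s = algebraMap R (Module.End R N) s := rfl
          rw [this, Polynomial.aeval_algebraMap_apply]
          simp
        rw [hq] at h4
        exact (congrArg Subtype.val h4).symm
      have h5 : q.eval s - s ^ q.natDegree ∈ m := by
        rw [Polynomial.eval_eq_sum_range, Finset.sum_range_succ, hmon.coeff_natDegree, one_mul,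
          add_sub_cancel_right]
        refine Ideal.sum_mem _ fun i hi => Ideal.mul_mem_right _ _ ?_
        have hi' : q.natDegree - i ≠ 0 := by
          have := Finset.mem_range.1 hi; omega
        have h6 := hcoeff i
        exact (Ideal.span_singleton_le_iff_mem _).2 hxm (Ideal.pow_le_self hi' h6)
      have h7 : s ^ q.natDegree ∈ m := by
        have := m.sub_mem (hpm h3) h5
        simpa using this
      exact Ideal.IsPrime.mem_of_pow_mem inferInstance _ h7
    obtain ⟨q, hq, hqm⟩ := Ideal.exists_minimalPrimes_le hann
    have hqa := Module.associatedPrimes.minimalPrimes_annihilator_subset_associatedPrimes R N' hq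
    have hqle := hq.1.2
    rw [AssociatedPrimes.mem_iff, isAssociatedPrime_iff] at hqa
    obtain ⟨hqp, y', hy'⟩ := hqa
    have hmem : ∀ s ∈ Module.annihilator R N', s ∈ q := fun s hs => hqle hs
    have hxq : x ∈ q := by
      apply hmem
      rw [Module.mem_annihilator]
      rintro ⟨_, z, hz, rfl⟩
      apply Subtype.ext
      change x • π z = 0
      rw [← map_smul, Submodule.mkQ_apply, Submodule.Quotient.mk_eq_zero]
      exact Submodule.smul_mem_pointwise_smul _ _ _ trivial
    have hpq : p ≤ q := by
      intro s hs
      apply hmem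
      rw [Module.mem_annihilator]
      rintro ⟨_, z, hz, rfl⟩
      apply Subtype.ext
      change s • π z = 0
      rw [← map_smul, hz s hs, map_zero]
    have := ih (QuotSMulTop x M) (fun z hz => hm z (by simp [hz])) hreg q hqp hqm y'.1 (by
      intro s
      rw [hy', Submodule.mem_colon_singleton, Submodule.mem_bot]
      rw [← Submodule.coe_smul, Submodule.coe_eq_zero])
    have h8 : ringKrullDim (R ⧸ q) + 1 ≤ ringKrullDim (R ⧸ p) := by
      refine ringKrullDim_succ_le_of_surjective (Ideal.Quotient.factor hpq)
        (Ideal.Quotient.factor_surjective hpq) (r := Ideal.Quotient.mk p x) ?_ ?_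
      · apply mem_nonZeroDivisors_of_ne_zero
        rwa [Ne, Ideal.Quotient.eq_zero_iff_mem]
      · rw [Ideal.Quotient.factor_mk, Ideal.Quotient.eq_zero_iff_mem]
        exact hxq
    refine le_trans ?_ h8
    rw [List.length_cons]
    push_cast
    gcongr

section General

variable {K : Type} [Field K] {V : Type} [Fintype V] [DecidableEq V]

theorem mem_edgeIdeal_iff (Adj : V → V → Prop) (f : MvPolynomial V K) :
    f ∈ edgeIdeal K Adj ↔ ∀ u ∈ f.support, ∃ a b, Adj a b ∧
      (Finsupp.single a 1 + Finsupp.single b 1 : V →₀ ℕ) ≤ u := by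
  have : edgeIdeal K Adj = Ideal.span ((fun s => monomial s (1 : K)) ''
      {s | ∃ a b, Adj a b ∧ s = Finsupp.single a 1 + Finsupp.single b 1}) := by
    unfold edgeIdeal
    congr 1
    ext p
    constructor
    · rintro ⟨a, b, h, rfl⟩
      exact ⟨_, ⟨a, b, h, rfl⟩, by simp [X, monomial_mul]⟩
    · rintro ⟨_, ⟨a, b, h, rfl⟩, rfl⟩
      exact ⟨a, b, h, by simp [X, monomial_mul]⟩
  rw [this, mem_ideal_span_monomial_image]
  constructor
  · intro h u hu
    obtain ⟨_, ⟨a, b, hab, rfl⟩, h2⟩ := h u hu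
    exact ⟨a, b, hab, h2⟩
  · intro h u hu
    obtain ⟨a, b, hab, h2⟩ := h u hu
    exact ⟨_, ⟨a, b, hab, rfl⟩, h2⟩

/-- Independent sets. -/
def IndepSet (Adj : V → V → Prop) (F : Finset V) : Prop := ∀ a ∈ F, ∀ b ∈ F, ¬ Adj a b

theorem not_edge_le {Adj : V → V → Prop} {H : Finset V} (hH : IndepSet Adj H) {u : V →₀ ℕ}
    (hu : u.support ⊆ H) {a b : V} (hab : Adj a b)
    (h : (Finsupp.single a 1 + Finsupp.single b 1 : V →₀ ℕ) ≤ u) : False := by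
  have ha := h a
  have hb := h b
  simp only [Finsupp.add_apply, Finsupp.single_eq_same] at ha hb
  refine hH a (hu ?_) b (hu ?_) hab <;> rw [Finsupp.mem_support_iff] <;> omega

theorem edge_le {Adj : V → V → Prop} (hirr : ∀ a, ¬ Adj a a) {u : V →₀ ℕ}
    {a b : V} (hab : Adj a b) (ha : a ∈ u.support) (hb : b ∈ u.support) :
    (Finsupp.single a 1 + Finsupp.single b 1 : V →₀ ℕ) ≤ u := by
  have hne : a ≠ b := by rintro rfl; exact hirr _ hab
  rw [Finsupp.mem_support_iff] at ha hb
  intro x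
  rw [Finsupp.add_apply, Finsupp.single_apply, Finsupp.single_apply]
  split_ifs with h1 h2 h2
  · exact absurd (h1.trans h2.symm) hne
  · subst h1; omega
  · subst h2; omega
  · omega

/-- Exponent vector with constant value `N` on `F`. -/
noncomputable def ev (F : Finset V) (N : ℕ) : V →₀ ℕ := Finsupp.indicator F (fun _ _ => N)

theorem ev_apply (F : Finset V) (N : ℕ) (x : V) : ev F N x = if x ∈ F then N else 0 := by
  simp [ev, Finsupp.indicator_apply]

theorem ev_support (F : Finset V) (N : ℕ) : (ev F N).support ⊆ F := by
  intro x hx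
  rw [Finsupp.mem_support_iff, ev_apply] at hx
  by_contra h
  simp [h] at hx

theorem ev_one_le_iff (F : Finset V) (u : V →₀ ℕ) : ev F 1 ≤ u ↔ F ⊆ u.support := by
  constructor
  · intro h x hx
    have := h x
    rw [ev_apply, if_pos hx] at this
    rw [Finsupp.mem_support_iff]; omega
  · intro h x
    rw [ev_apply]
    split_ifs with hx
    · have := h hx
      rw [Finsupp.mem_support_iff] at this; omega
    · exact Nat.zero_le _

theorem sdepth_upper_aux (Adj : V → V → Prop) (D : Finset V)
    (hD : IndepSet Adj D) (hdom : ∀ x ∉ D, ∃ y ∈ D, Adj x y) {r : ℕ}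
    (w : Fin r → MvPolynomial V K ⧸ edgeIdeal K Adj) (A : Fin r → Finset V)
    (h : IsStanleyDecomp K V (MvPolynomial V K ⧸ edgeIdeal K Adj) w A) : ∃ i, A i = D := by
  obtain ⟨hfree, -, htop⟩ := h
  have hw : ∀ i, ∃ W : MvPolynomial V K, Ideal.Quotient.mk (edgeIdeal K Adj) W = w i :=
    fun i => Ideal.Quotient.mk_surjective (w i)
  choose W hW using hw
  have hsub : ∃ i, D ⊆ A i := by
    by_contra hcon
    push Not at hcon
    let N := (∑ i, (W i).totalDegree) + 1
    let T : Submodule K (MvPolynomial V K ⧸ edgeIdeal K Adj) :=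
      (LinearMap.ker (lcoeff K (ev D N))).map
        (Ideal.Quotient.mkₐ K (edgeIdeal K Adj)).toLinearMap
    have hT : (⊤ : Submodule K (MvPolynomial V K ⧸ edgeIdeal K Adj)) ≤ T := by
      rw [← htop]
      refine iSup_le fun i => Submodule.span_le.2 ?_
      rintro _ ⟨u, hu, rfl⟩
      refine ⟨monomial u 1 * W i, ?_, ?_⟩
      · change coeff (ev D N) (monomial u 1 * W i) = 0
        rw [coeff_monomial_mul']
        split_ifs
        · rw [one_mul]
          obtain ⟨y, hyD, hyA⟩ := Finset.not_subset.1 (hcon i)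
          have huy : u y = 0 := by
            by_contra h0
            exact hyA (hu (Finsupp.mem_support_iff.2 h0))
          have hval : (ev D N - u) y = N := by
            rw [Finsupp.tsub_apply, ev_apply, if_pos hyD, huy]; rfl
          apply coeff_eq_zero_of_totalDegree_lt
          have h1 : (W i).totalDegree ≤ ∑ i, (W i).totalDegree :=
            Finset.single_le_sum (f := fun i => (W i).totalDegree) (fun _ _ => Nat.zero_le _)
              (Finset.mem_univ i)
          have h2 : N ≤ ∑ x ∈ (ev D N - u).support, (ev D N - u) x := by
            refine hval.symm.le.trans ?_
            exact Finset.single_le_sum (f := fun x => (ev D N - u) x) (fun _ _ => Nat.zero_le _)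
              (Finsupp.mem_support_iff.2 (by rw [hval]; exact Nat.succ_ne_zero _))
          exact lt_of_lt_of_le (Nat.lt_succ_of_le h1) h2
        · rfl
      · rw [← hW i]
        rfl
    obtain ⟨g, hg, hg'⟩ := hT (Submodule.mem_top (x := Ideal.Quotient.mk _ (monomial (ev D N) 1)))
    have hg0 : coeff (ev D N) g = 0 := hg
    have hmem : g - monomial (ev D N) 1 ∈ edgeIdeal K Adj := Ideal.Quotient.eq.1 hg'
    rw [mem_edgeIdeal_iff] at hmem
    obtain ⟨a, b, hab, hle⟩ := hmem (ev D N) (by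
      rw [mem_support_iff, coeff_sub, hg0, coeff_monomial, if_pos rfl]; simp)
    exact not_edge_le hD (ev_support D N) hab hle
  obtain ⟨i, hi⟩ := hsub
  refine ⟨i, Finset.Subset.antisymm ?_ hi⟩
  intro x hx
  by_contra hxD
  obtain ⟨y, hy, hxy⟩ := hdom x hxD
  have := hfree i (X x * X y) (by
      intro z hz
      have h2 := vars_mul (X x) (X y) hz
      rw [vars_X, vars_X] at h2
      simp only [Finset.mem_union, Finset.mem_singleton] at h2
      rcases h2 with rfl | rfl
      · exact hx
      · exact hi hy) (by
      rw [← hW i]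
      change Ideal.Quotient.mk _ (X x * X y * W i) = 0
      rw [Ideal.Quotient.eq_zero_iff_mem]
      exact Ideal.mul_mem_right _ _ (Ideal.subset_span ⟨x, y, hxy, rfl⟩))
  exact mul_ne_zero (X_ne_zero x) (X_ne_zero y) this

theorem rdepth_upper_aux (Adj : V → V → Prop) (D : Finset V)
    (hD : IndepSet Adj D) (hdom : ∀ x ∉ D, ∃ y ∈ D, Adj x y) (rs : List (MvPolynomial V K))
    (hrs : ∀ f ∈ rs, f ∈ Ideal.span (Set.range (X : V → MvPolynomial V K)))
    (hreg : RingTheory.Sequence.IsRegular (MvPolynomial V K ⧸ edgeIdeal K Adj) rs) :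
    rs.length ≤ D.card := by
  let φ : MvPolynomial V K →ₐ[K] MvPolynomial D K :=
    aeval (fun x => if h : x ∈ D then X ⟨x, h⟩ else 0)
  have hφs : Function.Surjective φ := by
    intro g
    refine ⟨rename Subtype.val g, ?_⟩
    rw [aeval_rename]
    conv_rhs => rw [← aeval_X_left_apply g]
    congr 2
    funext x
    simp
  let p : Ideal (MvPolynomial V K) := RingHom.ker φ
  have hp : p.IsPrime := RingHom.ker_isPrime _
  have hIp : edgeIdeal K Adj ≤ p := by
    refine Ideal.span_le.2 ?_
    rintro _ ⟨a, b, hab, rfl⟩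
    change φ (X a * X b) = 0
    rw [map_mul, aeval_X, aeval_X]
    by_cases ha : a ∈ D
    · by_cases hb : b ∈ D
      · exact absurd hab (hD a ha b hb)
      · rw [dif_neg hb, mul_zero]
    · rw [dif_neg ha, zero_mul]
  have hpX : p ≤ Ideal.span (X '' {x | x ∉ D}) := by
    intro f hf
    let ψ : MvPolynomial D K →ₐ[K] MvPolynomial V K := rename Subtype.val
    have h1 : ∀ f, f - ψ (φ f) ∈ Ideal.span (X '' {x | x ∉ D} : Set (MvPolynomial V K)) := by
      intro f
      rw [← Ideal.Quotient.eq_zero_iff_mem, map_sub, sub_eq_zero]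
      have : (Ideal.Quotient.mkₐ K (Ideal.span (X '' {x | x ∉ D} : Set (MvPolynomial V K)))) =
          (Ideal.Quotient.mkₐ K _).comp (ψ.comp φ) := by
        apply algHom_ext
        intro x
        simp only [AlgHom.comp_apply, φ, aeval_X, ψ]
        by_cases hx : x ∈ D
        · rw [dif_pos hx, rename_X]
        · rw [dif_neg hx, map_zero, map_zero]
          exact Ideal.Quotient.eq_zero_iff_mem.2 (Ideal.subset_span ⟨x, hx, rfl⟩)
      exact DFunLike.congr_fun this f
    have h2 := h1 f
    have h3 : φ f = 0 := hf
    rwa [h3, map_zero, sub_zero] at h2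
  have hpm : p ≤ Ideal.span (Set.range (X : V → MvPolynomial V K)) :=
    hpX.trans (Ideal.span_mono (Set.image_subset_range _ _))
  have hm : (Ideal.span (Set.range (X : V → MvPolynomial V K))).IsPrime := by
    have : Ideal.span (Set.range (X : V → MvPolynomial V K)) =
        RingHom.ker (constantCoeff (σ := V) (R := K)) := by
      apply le_antisymm
      · refine Ideal.span_le.2 ?_
        rintro _ ⟨x, rfl⟩
        exact constantCoeff_X _ x
      · intro f hf
        rw [← Set.image_univ, mem_ideal_span_X_image]
        intro u hu
        by_contra hcon
        push Not at hcon
        have hu0 : u = 0 := by ext x; exact hcon x trivial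
        subst hu0
        exact mem_support_iff.1 hu hf
    rw [this]
    exact RingHom.ker_isPrime _
  have hy : ∀ s : MvPolynomial V K,
      s • Ideal.Quotient.mk (edgeIdeal K Adj) (∏ x ∈ D, X x) = 0 ↔ s ∈ p := by
    intro s
    change Ideal.Quotient.mk (edgeIdeal K Adj) (s * ∏ x ∈ D, X x) = 0 ↔ _
    rw [Ideal.Quotient.eq_zero_iff_mem]
    constructor
    · intro h
      rcases hp.mem_or_mem (hIp h) with h1 | h1
      · exact h1
      · exfalso
        have h2 : φ (∏ x ∈ D, X x) = 0 := h1
        rw [map_prod, Finset.prod_eq_zero_iff] at h2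
        obtain ⟨x, hx, h3⟩ := h2
        rw [aeval_X, dif_pos hx] at h3
        exact X_ne_zero _ h3
    · intro h
      have : Ideal.span (X '' {x | x ∉ D}) ≤
          (Submodule.comap (LinearMap.mulRight (MvPolynomial V K) (∏ x ∈ D, X x))
            (edgeIdeal K Adj) : Ideal (MvPolynomial V K)) := by
        refine Ideal.span_le.2 ?_
        rintro _ ⟨x, hx, rfl⟩
        change X x * ∏ x ∈ D, X x ∈ edgeIdeal K Adj
        obtain ⟨y, hy, hxy⟩ := hdom x hx
        rw [← Finset.mul_prod_erase D _ hy, ← mul_assoc]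
        exact Ideal.mul_mem_right _ _ (Ideal.subset_span ⟨x, y, hxy, rfl⟩)
      exact this (hpX h)
  have h1 := depth_upper_aux (Ideal.span (Set.range (X : V → MvPolynomial V K))) rs
    (MvPolynomial V K ⧸ edgeIdeal K Adj) hrs hreg.toIsWeaklyRegular p hp hpm _ hy
  have h2 : ringKrullDim (MvPolynomial V K ⧸ p) = D.card := by
    have h3 : ringKrullDim (MvPolynomial V K ⧸ p) = ringKrullDim (MvPolynomial D K) :=
      ringKrullDim_eq_of_ringEquiv
        (RingHom.quotientKerEquivOfSurjective (f := φ.toRingHom) hφs)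
    rw [h3, MvPolynomial.ringKrullDim_of_isNoetherianRing, ringKrullDim_eq_zero_of_field]
    simp
  rw [h2] at h1
  exact_mod_cast h1

/-- Packing data: centres `c k`, `k < r`, with pairwise disjoint closed neighbourhoods. -/
def Packing (Adj : V → V → Prop) (r : ℕ) (c : ℕ → V) : Prop :=
  ∀ k < r, ∀ l < r, ∀ x, (x = c k ∨ Adj (c k) x) → (x = c l ∨ Adj (c l) x) → k = l

/-- The set of centres. -/
def cset (r : ℕ) (c : ℕ → V) : Finset V := (Finset.range r).image c

open Classical in
/-- The top of the interval starting in `F`. -/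
noncomputable def topSet (Adj : V → V → Prop) (r : ℕ) (c : ℕ → V) (F : Finset V) : Finset V :=
  F ∪ (cset r c).filter (fun x => ∀ a ∈ F, ¬ Adj x a)

/-- Bottoms of the intervals. -/
def IsBottom (Adj : V → V → Prop) (r : ℕ) (c : ℕ → V) (F : Finset V) : Prop :=
  IndepSet Adj F ∧ Disjoint F (cset r c)

theorem mem_topSet {Adj : V → V → Prop} {r : ℕ} {c : ℕ → V} {F : Finset V} {x : V} :
    x ∈ topSet Adj r c F ↔ x ∈ F ∨ (x ∈ cset r c ∧ ∀ a ∈ F, ¬ Adj x a) := by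
  simp [topSet]

theorem topSet_indep {Adj : V → V → Prop} (hsymm : ∀ a b, Adj a b → Adj b a)
    (hirr : ∀ a, ¬ Adj a a) {r : ℕ} {c : ℕ → V} (hc : Packing Adj r c) {F : Finset V}
    (hF : IndepSet Adj F) : IndepSet Adj (topSet Adj r c F) := by
  intro a ha b hb hab
  rw [mem_topSet] at ha hb
  rcases ha with ha | ⟨ha, ha'⟩
  · rcases hb with hb | ⟨hb, hb'⟩
    · exact hF a ha b hb hab
    · exact hb' a ha (hsymm _ _ hab)
  · rcases hb with hb | ⟨hb, hb'⟩
    · exact ha' b hb hab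
    · simp only [cset, Finset.mem_image, Finset.mem_range] at ha hb
      obtain ⟨k, hk, rfl⟩ := ha
      obtain ⟨l, hl, rfl⟩ := hb
      have := hc k hk l hl (c l) (Or.inr hab) (Or.inl rfl)
      subst this
      exact hirr _ hab

theorem topSet_hits {Adj : V → V → Prop} {r : ℕ} {c : ℕ → V} (F : Finset V) (k : ℕ) (hk : k < r) :
    ∃ x ∈ topSet Adj r c F, x = c k ∨ Adj (c k) x := by
  by_cases h : ∃ a ∈ F, Adj (c k) a
  · obtain ⟨a, ha, hka⟩ := h
    exact ⟨a, mem_topSet.2 (Or.inl ha), Or.inr hka⟩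
  · push Not at h
    refine ⟨c k, mem_topSet.2 (Or.inr ⟨?_, h⟩), Or.inl rfl⟩
    exact Finset.mem_image_of_mem _ (Finset.mem_range.2 hk)

theorem card_topSet {Adj : V → V → Prop} {r : ℕ} {c : ℕ → V} (hc : Packing Adj r c)
    (F : Finset V) : r ≤ (topSet Adj r c F).card := by
  have : Nonempty V := ⟨c 0⟩
  choose! h hh1 hh2 using fun k (hk : k < r) => topSet_hits (Adj := Adj) (c := c) F k hk
  have : (Finset.range r).card ≤ (topSet Adj r c F).card := by
    refine Finset.card_le_card_of_injOn h (fun k hk => hh1 k (Finset.mem_range.1 hk)) ?_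
    intro k hk l hl hkl
    have hk' : k < r := by simpa using hk
    have hl' : l < r := by simpa using hl
    exact hc k hk' l hl' (h k) (hh2 k hk') (hkl ▸ hh2 l hl')
  simpa using this

theorem stanley_exists (Adj : V → V → Prop) (hsymm : ∀ a b, Adj a b → Adj b a)
    (hirr : ∀ a, ¬ Adj a a) (r : ℕ) (c : ℕ → V) (hc : Packing Adj r c) :
    ∃ (s : ℕ) (w : Fin s → MvPolynomial V K ⧸ edgeIdeal K Adj) (A : Fin s → Finset V),
      IsStanleyDecomp K V (MvPolynomial V K ⧸ edgeIdeal K Adj) w A ∧ 0 < s ∧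
      ∀ i, r ≤ (A i).card := by
  classical
  let ι := {F : Finset V // IsBottom Adj r c F}
  let e : Fin (Fintype.card ι) ≃ ι := (Fintype.equivFin ι).symm
  let I := edgeIdeal K Adj
  let S : Fin (Fintype.card ι) → Set (V →₀ ℕ) := fun i =>
    {u | (e i).1 ⊆ u.support ∧ u.support ⊆ topSet Adj r c (e i).1}
  have hstan : ∀ i, stanleySpace K V (MvPolynomial V K ⧸ edgeIdeal K Adj)
      (Ideal.Quotient.mk _ (monomial (ev (e i).1 1) 1)) (topSet Adj r c (e i).1) =
      (restrictSupport K (S i)).map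
        (Ideal.Quotient.mkₐ K (edgeIdeal K Adj)).toLinearMap := by
    intro i
    rw [restrictSupport_eq_span, Submodule.map_span, stanleySpace]
    congr 1
    ext z
    constructor
    · rintro ⟨u, hu, rfl⟩
      refine ⟨_, ⟨u + ev (e i).1 1, ⟨?_, ?_⟩, rfl⟩, ?_⟩
      · rw [← ev_one_le_iff]; exact le_add_self
      · refine Finsupp.support_add.trans (Finset.union_subset (by exact_mod_cast hu) ?_)
        exact (ev_support _ _).trans (fun x hx => mem_topSet.2 (Or.inl hx))
      · change Ideal.Quotient.mk _ _ = Ideal.Quotient.mk _ (monomial u 1 * monomial _ 1)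
        rw [monomial_mul, one_mul]
    · rintro ⟨_, ⟨u, ⟨hu1, hu2⟩, rfl⟩, rfl⟩
      refine ⟨u - ev (e i).1 1, ?_, ?_⟩
      · have : (u - ev (e i).1 1).support ⊆ u.support := Finsupp.support_mono tsub_le_self
        exact_mod_cast this.trans hu2
      · change Ideal.Quotient.mk _ _ = Ideal.Quotient.mk _ (monomial _ 1 * monomial _ 1)
        rw [monomial_mul, one_mul, tsub_add_cancel_of_le ((ev_one_le_iff _ _).2 hu1)]
  have hSindep : ∀ i, ∀ u ∈ S i, IndepSet Adj u.support := by
    intro i u hu a ha b hb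
    exact topSet_indep hsymm hirr hc (e i).2.1 a (hu.2 ha) b (hu.2 hb)
  have hSuniq : ∀ i j, ∀ u, u ∈ S i → u ∈ S j → i = j := by
    have key : ∀ i, ∀ u ∈ S i, (e i).1 = u.support \ cset r c := by
      intro i u hu
      ext x
      rw [Finset.mem_sdiff]
      constructor
      · intro hx
        exact ⟨hu.1 hx, Finset.disjoint_left.1 (e i).2.2 hx⟩
      · rintro ⟨hx, hx'⟩
        rcases mem_topSet.1 (hu.2 hx) with h | h
        · exact h
        · exact absurd h.1 hx'
    intro i j u hi hj
    apply e.injective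
    apply Subtype.ext
    rw [key i u hi, key j u hj]
  refine ⟨Fintype.card ι, fun i => Ideal.Quotient.mk _ (monomial (ev (e i).1 1) 1),
    fun i => topSet Adj r c (e i).1, ⟨?_, ?_, ?_⟩, ?_, ?_⟩
  · intro i f hf hf0
    have hmem : f * monomial (ev (e i).1 1) 1 ∈ edgeIdeal K Adj :=
      Ideal.Quotient.eq_zero_iff_mem.1 hf0
    rw [mem_edgeIdeal_iff] at hmem
    by_contra hne
    obtain ⟨u, hu⟩ := support_nonempty.2 hne
    obtain ⟨a, b, hab, hle⟩ := hmem (u + ev (e i).1 1) (by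
      rw [mem_support_iff, coeff_mul_monomial, mul_one]
      exact mem_support_iff.1 hu)
    refine not_edge_le (topSet_indep hsymm hirr hc (e i).2.1) ?_ hab hle
    refine Finsupp.support_add.trans (Finset.union_subset ?_ ?_)
    · intro x hx
      have : x ∈ f.vars := (mem_vars x).2 ⟨u, hu, hx⟩
      exact_mod_cast hf this
    · exact (ev_support _ _).trans (fun x hx => mem_topSet.2 (Or.inl hx))
  · intro i
    have h2 : (⨆ j, ⨆ (_ : j ≠ i), stanleySpace K V (MvPolynomial V K ⧸ edgeIdeal K Adj)
        (Ideal.Quotient.mk _ (monomial (ev (e j).1 1) 1)) (topSet Adj r c (e j).1)) ≤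
        (restrictSupport K (⋃ j, ⋃ (_ : j ≠ i), S j)).map
        (Ideal.Quotient.mkₐ K (edgeIdeal K Adj)).toLinearMap := by
      refine iSup_le fun j => iSup_le fun hj => ?_
      rw [hstan]
      apply Submodule.map_mono
      apply restrictSupport_mono
      intro u hu
      simp only [Set.mem_iUnion]
      exact ⟨j, hj, hu⟩
    refine Disjoint.mono_right h2 ?_
    change Disjoint (stanleySpace K V (MvPolynomial V K ⧸ edgeIdeal K Adj)
        (Ideal.Quotient.mk _ (monomial (ev (e i).1 1) 1)) (topSet Adj r c (e i).1)) _
    rw [hstan, Submodule.disjoint_def]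
    rintro _ ⟨f, hf, rfl⟩ ⟨g, hg, hfg⟩
    have hmem : g - f ∈ edgeIdeal K Adj := Ideal.Quotient.eq.1 hfg
    have hf' : ∀ u ∈ f.support, u ∈ S i := fun u hu => (mem_restrictSupport_iff K).1 hf hu
    have hg' : ∀ u ∈ g.support, ∃ j, j ≠ i ∧ u ∈ S j := by
      intro u hu
      have := (mem_restrictSupport_iff K).1 hg hu
      simp only [Set.mem_iUnion] at this
      obtain ⟨j, hj, h⟩ := this
      exact ⟨j, hj, h⟩
    have hgf : g = f := by
      rw [← sub_eq_zero]
      by_contra hne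
      obtain ⟨u, hu⟩ := support_nonempty.2 hne
      rw [mem_edgeIdeal_iff] at hmem
      obtain ⟨a, b, hab, hle⟩ := hmem u hu
      have : IndepSet Adj u.support := by
        by_cases hu1 : u ∈ f.support
        · exact hSindep i u (hf' u hu1)
        · have hu2 : u ∈ g.support := by
            rw [mem_support_iff] at hu ⊢
            rw [coeff_sub, notMem_support_iff.1 hu1, sub_zero] at hu
            exact hu
          obtain ⟨j, -, hj⟩ := hg' u hu2
          exact hSindep j u hj
      exact not_edge_le this subset_rfl hab hle
    have hf0 : f = 0 := by
      by_contra hne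
      obtain ⟨u, hu⟩ := support_nonempty.2 hne
      obtain ⟨j, hj, hj'⟩ := hg' u (hgf ▸ hu)
      exact hj (hSuniq j i u hj' (hf' u hu))
    rw [hf0, map_zero]
  · rw [eq_top_iff]
    rintro z -
    obtain ⟨f, rfl⟩ := Ideal.Quotient.mk_surjective z
    induction f using MvPolynomial.induction_on' with
    | add p q hp hq =>
      rw [map_add]
      exact Submodule.add_mem _ hp hq
    | monomial u a =>
      by_cases hu : IndepSet Adj u.support
      · have hB : IsBottom Adj r c (u.support \ cset r c) :=
          ⟨fun a ha b hb => hu a (Finset.mem_sdiff.1 ha).1 b (Finset.mem_sdiff.1 hb).1,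
            Finset.sdiff_disjoint⟩
        refine Submodule.mem_iSup_of_mem (e.symm ⟨_, hB⟩) ?_
        rw [hstan]
        refine ⟨monomial u a, ?_, rfl⟩
        refine (monomial_mem_restrictSupport K).2 (Or.inl ?_)
        change (e (e.symm ⟨_, hB⟩)).1 ⊆ u.support ∧
          u.support ⊆ topSet Adj r c (e (e.symm ⟨_, hB⟩)).1
        rw [Equiv.apply_symm_apply]
        refine ⟨Finset.sdiff_subset, ?_⟩
        intro x hx
        rw [mem_topSet]
        by_cases hxc : x ∈ cset r c
        · exact Or.inr ⟨hxc, fun a ha => hu x hx a (Finset.mem_sdiff.1 ha).1⟩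
        · exact Or.inl (Finset.mem_sdiff.2 ⟨hx, hxc⟩)
      · have : Ideal.Quotient.mk (edgeIdeal K Adj) (monomial u a) = 0 := by
          rw [Ideal.Quotient.eq_zero_iff_mem, mem_edgeIdeal_iff]
          intro v hv
          have hv' : v = u := by
            have := support_monomial_subset hv
            simpa using this
          subst hv'
          unfold IndepSet at hu
          push Not at hu
          obtain ⟨a, ha, b, hb, hab⟩ := hu
          exact ⟨a, b, hab, edge_le hirr hab ha hb⟩
        rw [this]
        exact Submodule.zero_mem _
  · exact Fintype.card_pos_iff.2 ⟨⟨∅, by intro a ha; simp at ha, Finset.disjoint_empty_left _⟩⟩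
  · intro i
    exact card_topSet hc _

/-- The sequence `ℓ 0, …, ℓ (r-1)` is weakly regular modulo the ideal `J`. -/
def WR {R : Type} [CommRing R] (l : ℕ → R) (r : ℕ) (J : Ideal R) : Prop :=
  ∀ k < r, ∀ f, l k * f ∈ J ⊔ Ideal.span (l '' Set.Iio k) → f ∈ J ⊔ Ideal.span (l '' Set.Iio k)

theorem span_Iio_succ {R : Type} [CommRing R] (l : ℕ → R) (k : ℕ) :
    Ideal.span (l '' Set.Iio (k + 1)) = Ideal.span (l '' Set.Iio k) ⊔ Ideal.span {l k} := by
  rw [← Ideal.span_union]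
  congr 1
  ext x
  simp only [Set.mem_image, Set.mem_Iio, Set.mem_union, Set.mem_singleton_iff]
  constructor
  · rintro ⟨i, hi, rfl⟩
    rcases Nat.lt_succ_iff_lt_or_eq.1 hi with h | rfl
    · exact Or.inl ⟨i, h, rfl⟩
    · exact Or.inr rfl
  · rintro (⟨i, hi, rfl⟩ | rfl)
    · exact ⟨i, Nat.lt_succ_of_lt hi, rfl⟩
    · exact ⟨k, Nat.lt_succ_self k, rfl⟩

theorem colon_aux {R : Type} [CommRing R] {l : ℕ → R} {r : ℕ} {J Q : Ideal R} {m : R}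
    (hQ : ∀ f, f * m ∈ J ↔ f ∈ Q) (h1 : WR l r (J ⊔ Ideal.span {m})) (k : ℕ) (hk : k ≤ r) :
    ∀ g, g * m ∈ J ⊔ Ideal.span (l '' Set.Iio k) → g ∈ Q ⊔ Ideal.span (l '' Set.Iio k) := by
  induction k with
  | zero =>
    intro g hg
    have : l '' Set.Iio 0 = ∅ := by ext; simp
    rw [this, Ideal.span_empty, sup_bot_eq] at hg ⊢
    exact (hQ g).1 hg
  | succ k ih =>
    intro g hg
    rw [span_Iio_succ, ← sup_assoc] at hg ⊢
    obtain ⟨a, ha, b, hb, hab⟩ := Submodule.mem_sup.1 hg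
    obtain ⟨h, rfl⟩ := Ideal.mem_span_singleton'.1 hb
    have h2 : h ∈ J ⊔ Ideal.span {m} ⊔ Ideal.span (l '' Set.Iio k) := by
      apply h1 k hk
      have h3 : l k * h = g * m - a := by rw [← hab]; ring
      rw [h3]
      refine Ideal.sub_mem _ ?_ ?_
      · exact (le_sup_of_le_left le_sup_right : Ideal.span {m} ≤ _)
          (Ideal.mul_mem_left _ _ (Ideal.mem_span_singleton_self m))
      · exact (sup_le_sup_right le_sup_left _ : J ⊔ Ideal.span (l '' Set.Iio k) ≤ _) ha
    rw [sup_right_comm] at h2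
    obtain ⟨a', ha', b', hb', hab'⟩ := Submodule.mem_sup.1 h2
    obtain ⟨h', rfl⟩ := Ideal.mem_span_singleton'.1 hb'
    have h4 : g - h' * l k ∈ Q ⊔ Ideal.span (l '' Set.Iio k) := by
      apply ih (Nat.le_of_succ_le hk)
      have : (g - h' * l k) * m = a + a' * l k := by
        linear_combination (-1) * hab + (-l k) * hab'
      rw [this]
      exact Ideal.add_mem _ ha (Ideal.mul_mem_right _ _ ha')
    have h5 : g = (g - h' * l k) + h' * l k := by ring
    rw [h5]
    exact Ideal.add_mem _ ((le_sup_left : _ ≤ _ ⊔ Ideal.span {l k}) h4)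
      ((le_sup_right : Ideal.span {l k} ≤ _)
        (Ideal.mul_mem_left _ _ (Ideal.mem_span_singleton_self _)))

theorem WR_step {R : Type} [CommRing R] {l : ℕ → R} {r : ℕ} {J Q : Ideal R} {m : R}
    (hQ : ∀ f, f * m ∈ J ↔ f ∈ Q) (h1 : WR l r (J ⊔ Ideal.span {m})) (h2 : WR l r Q) :
    WR l r J := by
  intro k hk f hf
  have h3 : f ∈ J ⊔ Ideal.span {m} ⊔ Ideal.span (l '' Set.Iio k) :=
    h1 k hk f ((sup_le_sup_right le_sup_left _ : J ⊔ Ideal.span (l '' Set.Iio k) ≤ _) hf)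
  rw [sup_right_comm] at h3
  obtain ⟨a, ha, b, hb, rfl⟩ := Submodule.mem_sup.1 h3
  obtain ⟨g, rfl⟩ := Ideal.mem_span_singleton'.1 hb
  refine Ideal.add_mem _ ha ?_
  have h4 : (l k * g) * m ∈ J ⊔ Ideal.span (l '' Set.Iio k) := by
    have : (l k * g) * m = l k * (a + g * m) - l k * a := by ring
    rw [this]
    exact Ideal.sub_mem _ hf (Ideal.mul_mem_left _ _ ha)
  have h5 := h2 k hk g (colon_aux hQ h1 k hk.le _ h4)
  obtain ⟨q, hq, t, ht, rfl⟩ := Submodule.mem_sup.1 h5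
  rw [add_mul]
  exact Ideal.add_mem _ ((le_sup_left : J ≤ _) ((hQ q).2 hq))
    ((le_sup_right : _ ≤ J ⊔ _) (Ideal.mul_mem_right _ _ ht))

open Classical in
/-- The linear form attached to the closed neighbourhood of `c k`. -/
noncomputable def lin (K : Type) [Field K] (Adj : V → V → Prop) (c : ℕ → V) (k : ℕ) :
    MvPolynomial V K :=
  ∑ x ∈ Finset.univ.filter (fun x => x = c k ∨ Adj (c k) x), X x

theorem WR_prime {Adj : V → V → Prop} {r : ℕ} {c : ℕ → V} (hc : Packing Adj r c) (H : Finset V)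
    (hH : ∀ k < r, ∃ x ∈ H, x = c k ∨ Adj (c k) x) :
    WR (lin K Adj c) r (Ideal.span (X '' {x | x ∉ H})) := by
  classical
  have : Nonempty V := ⟨c 0⟩
  choose! h hh1 hh2 using hH
  intro k hk f hf
  set J := Ideal.span (X '' {x | x ∉ H}) ⊔ Ideal.span (lin K Adj c '' Set.Iio k) with hJ
  let Nb : ℕ → Finset V := fun i => H.filter (fun x => x = c i ∨ Adj (c i) x)
  let l' : ℕ → MvPolynomial V K := fun i => ∑ x ∈ Nb i, X x
  have hmemX : ∀ x ∉ H, X x ∈ J := fun x hx =>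
    (le_sup_left : _ ≤ J) (Ideal.subset_span ⟨x, hx, rfl⟩)
  have hlin : ∀ i, lin K Adj c i = l' i + ∑ x ∈ Finset.univ.filter
      (fun x => (x = c i ∨ Adj (c i) x) ∧ x ∉ H), X x := by
    intro i
    rw [lin, ← Finset.sum_filter_add_sum_filter_not _ (fun x => x ∈ H), Finset.filter_filter,
      Finset.filter_filter]
    congr 1
    apply Finset.sum_congr _ (fun _ _ => rfl)
    ext x
    simp [Nb, and_comm]
  have hl' : ∀ i < k, l' i ∈ J := by
    intro i hi
    have h1 : l' i = lin K Adj c i - ∑ x ∈ Finset.univ.filter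
      (fun x => (x = c i ∨ Adj (c i) x) ∧ x ∉ H), X x := by rw [hlin]; ring
    rw [h1]
    refine Ideal.sub_mem _ ((le_sup_right : _ ≤ J) (Ideal.subset_span ⟨i, hi, rfl⟩)) ?_
    refine Ideal.sum_mem _ fun x hx => hmemX x ?_
    exact (Finset.mem_filter.1 hx).2.2
  let φ : MvPolynomial V K →ₐ[K] MvPolynomial V K :=
    aeval (fun x => if x ∈ H then X x - ∑ i ∈ Finset.range k, (if x = h i then l' i else 0) else 0)
  have hφ : ∀ g, g - φ g ∈ J := by
    intro g
    rw [← Ideal.Quotient.eq_zero_iff_mem, map_sub, sub_eq_zero]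
    have : (Ideal.Quotient.mkₐ K J) = (Ideal.Quotient.mkₐ K J).comp φ := by
      apply algHom_ext
      intro x
      simp only [AlgHom.comp_apply, φ, aeval_X]
      refine Ideal.Quotient.eq.2 ?_
      split_ifs with hx
      · rw [sub_sub_cancel]
        refine Ideal.sum_mem _ fun i hi => ?_
        split_ifs
        · exact hl' i (Finset.mem_range.1 hi)
        · exact Ideal.zero_mem _
      · rw [sub_zero]
        exact hmemX x hx
    exact DFunLike.congr_fun this g
  have hφlin : ∀ j < r, φ (lin K Adj c j) =
      l' j - ∑ i ∈ Finset.range k, (if i = j then l' i else 0) := by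
    intro j hj
    rw [hlin, map_add, map_sum, map_sum]
    have h1 : ∑ x ∈ Finset.univ.filter (fun x => (x = c j ∨ Adj (c j) x) ∧ x ∉ H),
        φ (X x) = 0 := by
      refine Finset.sum_eq_zero fun x hx => ?_
      rw [aeval_X, if_neg (Finset.mem_filter.1 hx).2.2]
    rw [h1, add_zero]
    have h2 : ∑ x ∈ Nb j, φ (X x) =
        ∑ x ∈ Nb j, (X x - ∑ i ∈ Finset.range k, (if x = h i then l' i else 0)) := by
      refine Finset.sum_congr rfl fun x hx => ?_
      rw [aeval_X, if_pos (Finset.mem_filter.1 hx).1]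
    rw [h2, Finset.sum_sub_distrib, Finset.sum_comm]
    congr 1
    refine Finset.sum_congr rfl fun i hi => ?_
    have hir : i < r := (Finset.mem_range.1 hi).trans hk
    rw [Finset.sum_ite_eq']
    have : h i ∈ Nb j ↔ i = j := by
      constructor
      · intro h3
        exact hc i hir j hj (h i) (hh2 i hir) (Finset.mem_filter.1 h3).2
      · rintro rfl
        exact Finset.mem_filter.2 ⟨hh1 i hir, hh2 i hir⟩
    simp only [this]
  have hφJ : ∀ g ∈ J, φ g = 0 := by
    have : J ≤ RingHom.ker φ := by
      refine sup_le (Ideal.span_le.2 ?_) (Ideal.span_le.2 ?_)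
      · rintro _ ⟨x, hx, rfl⟩
        change φ (X x) = 0
        rw [aeval_X, if_neg hx]
      · rintro _ ⟨i, hi, rfl⟩
        change φ (lin K Adj c i) = 0
        rw [hφlin i (lt_trans hi hk), Finset.sum_ite_eq', if_pos (Finset.mem_range.2 hi), sub_self]
    exact fun g hg => this hg
  have hk' : φ (lin K Adj c k) ≠ 0 := by
    rw [hφlin k hk, Finset.sum_ite_eq', if_neg (by simp), sub_zero]
    intro h0
    have h1 : coeff (Finsupp.single (h k) 1) (l' k) = 0 := by rw [h0, coeff_zero]
    simp only [l', coeff_sum, coeff_X'] at h1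
    have h3 : ∀ x, (Finsupp.single x 1 = (Finsupp.single (h k) 1 : V →₀ ℕ)) ↔ x = h k :=
      fun x => Finsupp.single_left_inj one_ne_zero
    simp only [h3] at h1
    rw [Finset.sum_ite_eq', if_pos (Finset.mem_filter.2 ⟨hh1 k hk, hh2 k hk⟩)] at h1
    exact one_ne_zero h1
  have h6 : φ (lin K Adj c k) * φ f = 0 := by rw [← map_mul]; exact hφJ _ hf
  have h7 : φ f = 0 := (mul_eq_zero.1 h6).resolve_left hk'
  have h8 := hφ f
  rwa [h7, sub_zero] at h8

/-- The ideal generated by the edge ideal and the monomials `x_F`, `F ∈ U`. -/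
noncomputable def upIdeal (K : Type) [Field K] (Adj : V → V → Prop) (U : Finset (Finset V)) :
    Ideal (MvPolynomial V K) :=
  edgeIdeal K Adj ⊔ Ideal.span ((fun F => monomial (ev F 1) (1 : K)) '' (U : Set (Finset V)))

theorem mem_upIdeal_iff (Adj : V → V → Prop) (U : Finset (Finset V)) (f : MvPolynomial V K) :
    f ∈ upIdeal K Adj U ↔ ∀ u ∈ f.support, (∃ a b, Adj a b ∧
      (Finsupp.single a 1 + Finsupp.single b 1 : V →₀ ℕ) ≤ u) ∨ ∃ F ∈ U, ev F 1 ≤ u := by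
  have : upIdeal K Adj U = Ideal.span ((fun s => monomial s (1 : K)) ''
      ({s | ∃ a b, Adj a b ∧ s = Finsupp.single a 1 + Finsupp.single b 1} ∪
        {s | ∃ F ∈ U, s = ev F 1})) := by
    unfold upIdeal edgeIdeal
    rw [← Ideal.span_union]
    congr 1
    ext p
    constructor
    · rintro (⟨a, b, h, rfl⟩ | ⟨F, hF, rfl⟩)
      · exact ⟨_, Or.inl ⟨a, b, h, rfl⟩, by simp [X, monomial_mul]⟩
      · exact ⟨_, Or.inr ⟨F, hF, rfl⟩, rfl⟩
    · rintro ⟨_, ⟨a, b, h, rfl⟩ | ⟨F, hF, rfl⟩, rfl⟩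
      · exact Or.inl ⟨a, b, h, by simp [X, monomial_mul]⟩
      · exact Or.inr ⟨F, hF, rfl⟩
  rw [this, mem_ideal_span_monomial_image]
  constructor
  · intro h u hu
    obtain ⟨_, ⟨a, b, hab, rfl⟩ | ⟨F, hF, rfl⟩, h2⟩ := h u hu
    · exact Or.inl ⟨a, b, hab, h2⟩
    · exact Or.inr ⟨F, hF, h2⟩
  · intro h u hu
    rcases h u hu with ⟨a, b, hab, h2⟩ | ⟨F, hF, h2⟩
    · exact ⟨_, Or.inl ⟨a, b, hab, rfl⟩, h2⟩
    · exact ⟨_, Or.inr ⟨F, hF, rfl⟩, h2⟩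

theorem colon_upIdeal {Adj : V → V → Prop} (hsymm : ∀ a b, Adj a b → Adj b a)
    (hirr : ∀ a, ¬ Adj a a) {r : ℕ} {c : ℕ → V} (hc : Packing Adj r c)
    (U : Finset (Finset V)) (hUB : ∀ F ∈ U, IsBottom Adj r c F) (F : Finset V)
    (hF : IsBottom Adj r c F) (hmin : ∀ G ∈ U, ¬ G ⊆ F)
    (hup : ∀ G, IsBottom Adj r c G → F ⊂ G → G ∈ U) (f : MvPolynomial V K) :
    f * monomial (ev F 1) 1 ∈ upIdeal K Adj U ↔
      f ∈ Ideal.span (X '' {x | x ∉ topSet Adj r c F}) := by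
  constructor
  · intro h
    rw [mem_ideal_span_X_image]
    intro u hu
    by_contra hcon
    push Not at hcon
    have husupp : (u + ev F 1).support ⊆ topSet Adj r c F := by
      refine Finsupp.support_add.trans (Finset.union_subset ?_ ?_)
      · intro x hx
        by_contra hx'
        exact (Finsupp.mem_support_iff.1 hx) (hcon x hx')
      · exact (ev_support _ _).trans (fun x hx => mem_topSet.2 (Or.inl hx))
    rw [mem_upIdeal_iff] at h
    rcases h (u + ev F 1) (by
      rw [mem_support_iff, coeff_mul_monomial, mul_one]
      exact mem_support_iff.1 hu) with ⟨a, b, hab, hle⟩ | ⟨G, hG, hle⟩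
    · exact not_edge_le (topSet_indep hsymm hirr hc hF.1) husupp hab hle
    · rw [ev_one_le_iff] at hle
      apply hmin G hG
      intro x hx
      rcases mem_topSet.1 (husupp (hle hx)) with h1 | h1
      · exact h1
      · exact absurd h1.1 (Finset.disjoint_left.1 (hUB G hG).2 hx)
  · intro h
    have : Ideal.span (X '' {x | x ∉ topSet Adj r c F}) ≤
        (Submodule.comap (LinearMap.mulRight (MvPolynomial V K) (monomial (ev F 1) (1 : K)))
          (upIdeal K Adj U) : Ideal (MvPolynomial V K)) := by
      refine Ideal.span_le.2 ?_
      rintro _ ⟨x, hx, rfl⟩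
      change X x * monomial (ev F 1) 1 ∈ upIdeal K Adj U
      rw [X, monomial_mul, one_mul, mem_upIdeal_iff]
      intro v hv
      have hv' : v = Finsupp.single x 1 + ev F 1 := by
        have := support_monomial_subset hv
        simpa using this
      have hsub : F ⊆ v.support := by
        rw [← ev_one_le_iff, hv']; exact le_add_self
      have hxv : x ∈ v.support := by
        rw [Finsupp.mem_support_iff, hv', Finsupp.add_apply, Finsupp.single_eq_same]; omega
      have hx' : x ∉ topSet Adj r c F := hx
      rw [mem_topSet] at hx'
      push Not at hx'
      by_cases hadj : ∃ a ∈ F, Adj x a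
      · obtain ⟨a, ha, hxa⟩ := hadj
        exact Or.inl ⟨x, a, hxa, edge_le hirr hxa hxv (hsub ha)⟩
      · have hxc : x ∉ cset r c := fun h1 => hadj (hx'.2 h1)
        push Not at hadj
        refine Or.inr ⟨insert x F, hup _ ⟨?_, ?_⟩ (Finset.ssubset_insert hx'.1), ?_⟩
        · intro a ha b hb hab
          rw [Finset.mem_insert] at ha hb
          rcases ha with rfl | ha
          · rcases hb with rfl | hb
            · exact hirr _ hab
            · exact hadj b hb hab
          · rcases hb with rfl | hb
            · exact hadj a ha (hsymm _ _ hab)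
            · exact hF.1 a ha b hb hab
        · exact Finset.disjoint_insert_left.2 ⟨hxc, hF.2⟩
        · rw [ev_one_le_iff]
          exact Finset.insert_subset hxv hsub
    exact this h

theorem WR_edge {Adj : V → V → Prop} (hsymm : ∀ a b, Adj a b → Adj b a)
    (hirr : ∀ a, ¬ Adj a a) {r : ℕ} {c : ℕ → V} (hc : Packing Adj r c) :
    WR (lin K Adj c) r (edgeIdeal K Adj) := by
  classical
  have main : ∀ (N : ℕ) (U : Finset (Finset V)), U.card = N → (∀ F ∈ U, IsBottom Adj r c F) →
      (∀ F ∈ U, ∀ G, IsBottom Adj r c G → F ⊂ G → G ∈ U) →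
      WR (lin K Adj c) r (upIdeal K Adj U) → WR (lin K Adj c) r (edgeIdeal K Adj) := by
    intro N
    induction N with
    | zero =>
      intro U hU _ _ h
      rw [Finset.card_eq_zero] at hU
      subst hU
      simpa [upIdeal] using h
    | succ N ih =>
      intro U hU hUB hup h
      have hne : U.Nonempty := by rw [← Finset.card_pos]; omega
      obtain ⟨F, hFmin⟩ := U.exists_minimal hne
      have hFU : F ∈ U := hFmin.1
      have hup' : ∀ G, IsBottom Adj r c G → F ⊂ G → G ∈ U.erase F := fun G hG hFG =>
        Finset.mem_erase.2 ⟨fun h => by subst h; exact hFG.2 (Finset.Subset.refl _),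
          hup F hFU G hG hFG⟩
      have hno : ∀ G ∈ U.erase F, ¬ G ⊆ F := by
        intro G hG hGF
        have h1 := hFmin.2 (Finset.mem_of_mem_erase hG) hGF
        exact (Finset.mem_erase.1 hG).1 (Finset.Subset.antisymm hGF h1)
      refine ih (U.erase F) (by rw [Finset.card_erase_of_mem hFU]; omega)
        (fun G hG => hUB G (Finset.mem_of_mem_erase hG)) ?_ ?_
      · intro G hG G' hG' hGG'
        refine Finset.mem_erase.2 ⟨?_, hup G (Finset.mem_of_mem_erase hG) G' hG' hGG'⟩
        rintro rfl
        exact hno G hG hGG'.1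
      · refine WR_step (m := monomial (ev F 1) 1)
          (colon_upIdeal hsymm hirr hc _ (fun G hG => hUB G (Finset.mem_of_mem_erase hG)) F
            (hUB F hFU) hno hup') ?_
          (WR_prime hc (topSet Adj r c F) (fun k hk => topSet_hits F k hk))
        have : upIdeal K Adj (U.erase F) ⊔ Ideal.span {monomial (ev F 1) 1} =
            upIdeal K Adj U := by
          unfold upIdeal
          rw [sup_assoc, ← Ideal.span_union]
          congr 2
          conv_rhs => rw [← Finset.insert_erase hFU]
          rw [Finset.coe_insert, Set.image_insert_eq, Set.union_comm]
          rfl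
        rw [this]
        exact h
  refine main _ (Finset.univ.filter (IsBottom Adj r c)) rfl ?_ ?_ ?_
  · intro F hF
    exact (Finset.mem_filter.1 hF).2
  · intro F _ G hG _
    exact Finset.mem_filter.2 ⟨Finset.mem_univ _, hG⟩
  · intro k _ f _
    apply (le_sup_left : upIdeal K Adj _ ≤ _)
    rw [mem_upIdeal_iff]
    intro u _
    refine Or.inr ⟨∅, Finset.mem_filter.2 ⟨Finset.mem_univ _, ?_, Finset.disjoint_empty_left _⟩, ?_⟩
    · intro a ha; simp at ha
    · rw [ev_one_le_iff]; exact Finset.empty_subset _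

theorem mem_ofList_smul_top {R : Type} [CommRing R] (I : Ideal R) (l : ℕ → R) (k : ℕ) (f : R) :
    Ideal.Quotient.mk I f ∈ (Ideal.ofList ((List.range k).map l) • ⊤ : Submodule R (R ⧸ I)) ↔
      f ∈ I ⊔ Ideal.span (l '' Set.Iio k) := by
  have h1 : Ideal.ofList ((List.range k).map l) = Ideal.span (l '' Set.Iio k) := by
    unfold Ideal.ofList
    congr 1
    ext x
    simp
  rw [h1]
  have h2 : (Ideal.span (l '' Set.Iio k) • ⊤ : Submodule R (R ⧸ I)) =
      Submodule.map I.mkQ (Ideal.span (l '' Set.Iio k)) := by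
    have h3 : (⊤ : Submodule R (R ⧸ I)) = Submodule.map I.mkQ ⊤ := by
      rw [Submodule.map_top, Submodule.range_mkQ]
    rw [h3, ← Submodule.map_smul'']
    congr 1
    exact Ideal.mul_top _
  rw [h2]
  constructor
  · rintro ⟨g, hg, hgf⟩
    have : g - f ∈ I := Ideal.Quotient.eq.1 hgf
    have h4 : f = -(g - f) + g := by ring
    rw [h4]
    exact Submodule.add_mem_sup (I.neg_mem this) hg
  · intro hf
    obtain ⟨a, ha, b, hb, rfl⟩ := Submodule.mem_sup.1 hf
    refine ⟨b, hb, ?_⟩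
    refine Ideal.Quotient.eq.2 ?_
    have : b - (a + b) = -a := by ring
    rw [this]
    exact I.neg_mem ha

theorem isRegular_lin {Adj : V → V → Prop} (hsymm : ∀ a b, Adj a b → Adj b a)
    (hirr : ∀ a, ¬ Adj a a) {r : ℕ} {c : ℕ → V} (hc : Packing Adj r c) :
    (∀ f ∈ (List.range r).map (lin K Adj c),
      f ∈ Ideal.span (Set.range (X : V → MvPolynomial V K))) ∧
    RingTheory.Sequence.IsRegular (MvPolynomial V K ⧸ edgeIdeal K Adj)
      ((List.range r).map (lin K Adj c)) := by
  have hlin : ∀ k, lin K Adj c k ∈ Ideal.span (Set.range (X : V → MvPolynomial V K)) := fun k =>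
    Ideal.sum_mem _ fun x _ => Ideal.subset_span ⟨x, rfl⟩
  refine ⟨?_, ⟨⟨?_⟩, ?_⟩⟩
  · intro f hf
    obtain ⟨k, -, rfl⟩ := List.mem_map.1 hf
    exact hlin k
  · intro i hi
    have hi' : i < r := by simpa using hi
    rw [isSMulRegular_quotient_iff_mem_of_smul_mem]
    have htake : ((List.range r).map (lin K Adj c)).take i = (List.range i).map (lin K Adj c) := by
      rw [← List.map_take, List.take_range, min_eq_left hi'.le]
    have hget : ((List.range r).map (lin K Adj c))[i] = lin K Adj c i := by simp
    rw [htake, hget]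
    intro z hz
    obtain ⟨f, rfl⟩ := Ideal.Quotient.mk_surjective z
    have hz' : Ideal.Quotient.mk (edgeIdeal K Adj) (lin K Adj c i * f) ∈
        (Ideal.ofList ((List.range i).map (lin K Adj c)) • ⊤ :
          Submodule (MvPolynomial V K) (MvPolynomial V K ⧸ edgeIdeal K Adj)) := hz
    rw [mem_ofList_smul_top] at hz' ⊢
    exact WR_edge hsymm hirr hc i hi' f hz'
  · intro htop
    have h1 : Ideal.Quotient.mk (edgeIdeal K Adj) 1 ∈
        (Ideal.ofList ((List.range r).map (lin K Adj c)) • ⊤ :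
          Submodule (MvPolynomial V K) (MvPolynomial V K ⧸ edgeIdeal K Adj)) := by
      rw [← htop]; trivial
    rw [mem_ofList_smul_top] at h1
    have h2 : edgeIdeal K Adj ⊔ Ideal.span (lin K Adj c '' Set.Iio r) ≤
        RingHom.ker (constantCoeff (σ := V) (R := K)) := by
      refine sup_le (Ideal.span_le.2 ?_) (Ideal.span_le.2 ?_)
      · rintro _ ⟨a, b, -, rfl⟩
        change constantCoeff (X a * X b) = 0
        simp
      · rintro _ ⟨k, -, rfl⟩
        change constantCoeff (lin K Adj c k) = 0
        simp [lin]
    have h3 : constantCoeff (1 : MvPolynomial V K) = 0 := h2 h1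
    rw [map_one] at h3
    exact one_ne_zero h3

theorem both_depths (Adj : V → V → Prop) (hsymm : ∀ a b, Adj a b → Adj b a)
    (hirr : ∀ a, ¬ Adj a a) (r : ℕ) (c : ℕ → V) (hc : Packing Adj r c) (D : Finset V)
    (hD : IndepSet Adj D) (hdom : ∀ x ∉ D, ∃ y ∈ D, Adj x y) (hcard : D.card ≤ r) :
    rdepth K V (MvPolynomial V K ⧸ edgeIdeal K Adj) = r ∧
    sdepth K V (MvPolynomial V K ⧸ edgeIdeal K Adj) = r := by
  unfold rdepth sdepth
  constructor
  · have hub : ∀ d ∈ { d | ∃ rs : List (MvPolynomial V K), rs.length = d ∧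
        (∀ f ∈ rs, f ∈ Ideal.span (Set.range (X : V → MvPolynomial V K))) ∧
        RingTheory.Sequence.IsRegular (MvPolynomial V K ⧸ edgeIdeal K Adj) rs }, d ≤ r := by
      rintro d ⟨rs, rfl, h1, h2⟩
      exact (rdepth_upper_aux Adj D hD hdom rs h1 h2).trans hcard
    have hmem := isRegular_lin (K := K) hsymm hirr hc
    apply le_antisymm
    · refine csSup_le ?_ hub
      refine ⟨r, _, ?_, hmem.1, hmem.2⟩
      simp
    · apply le_csSup
      · exact ⟨r, hub⟩
      · refine ⟨_, ?_, hmem.1, hmem.2⟩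
        simp
  · have hub : ∀ d ∈ { d | ∃ s, ∃ w : Fin s → MvPolynomial V K ⧸ edgeIdeal K Adj,
        ∃ A : Fin s → Finset V,
        IsStanleyDecomp K V (MvPolynomial V K ⧸ edgeIdeal K Adj) w A ∧
          d = sInf (Set.range fun i => (A i).card) }, d ≤ r := by
      rintro d ⟨s, w, A, h, rfl⟩
      obtain ⟨i, hi⟩ := sdepth_upper_aux Adj D hD hdom w A h
      refine (Nat.sInf_le (Set.mem_range_self (f := fun i => (A i).card) i)).trans ?_
      change (A i).card ≤ r
      rw [hi]
      exact hcard
    obtain ⟨s, w, A, h, hs, hA⟩ := stanley_exists (K := K) Adj hsymm hirr r c hc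
    apply le_antisymm
    · refine csSup_le ?_ hub
      exact ⟨_, s, w, A, h, rfl⟩
    · refine le_csSup_of_le ⟨r, hub⟩ ⟨s, w, A, h, rfl⟩ ?_
      have : Nonempty (Fin s) := ⟨⟨0, hs⟩⟩
      obtain ⟨i, hi⟩ := Nat.sInf_mem (Set.range_nonempty fun i => (A i).card)
      rw [← hi]
      exact hA i

end General

/-- For every integer `n ≥ 1`,
`depth(S_{n,3}/I(P_{n,3})) = sdepth(S_{n,3}/I(P_{n,3})) = ⌈n/3⌉`. -/
theorem depth_sdepth_quotient_edgeIdeal_P_n_3 (K : Type) [Field K] (n : ℕ) (hn : 1 ≤ n) :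
    rdepth K (Fin n × Fin 3)
        (MvPolynomial (Fin n × Fin 3) K ⧸ edgeIdeal K (pAdj n 3)) = (n + 2) / 3 ∧
    sdepth K (Fin n × Fin 3)
        (MvPolynomial (Fin n × Fin 3) K ⧸ edgeIdeal K (pAdj n 3)) = (n + 2) / 3 := by
  classical
  have hone : ∀ j : Fin 3, |((j : ℤ) - ((1 : Fin 3) : ℤ))| ≤ 1 := by decide
  have hone' : ∀ j : Fin 3, |(((1 : Fin 3) : ℤ) - (j : ℤ))| ≤ 1 := by decide
  have hone0 : |((((1 : Fin 3) : ℕ) : ℤ) - (((1 : Fin 3) : ℕ) : ℤ))| ≤ 1 := by decide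
  refine both_depths (pAdj n 3) ?_ ?_ ((n + 2) / 3)
    (fun k => (⟨min (3 * k) (n - 1), by omega⟩, 1)) ?_
    ((Finset.range ((n + 2) / 3)).image (fun k => (⟨min (3 * k + 1) (n - 1), by omega⟩, 1)))
    ?_ ?_ ?_
  · rintro a b ⟨h1, h2, h3⟩
    exact ⟨h1.symm, by rwa [abs_sub_comm], by rwa [abs_sub_comm]⟩
  · rintro a ⟨h1, -⟩
    exact h1 rfl
  · have key : ∀ k < (n + 2) / 3, ∀ x : Fin n × Fin 3,
        (x = (⟨min (3 * k) (n - 1), by omega⟩, 1) ∨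
          pAdj n 3 (⟨min (3 * k) (n - 1), by omega⟩, 1) x) → (x.1.1 + 1) / 3 = k := by
      rintro k hk x (rfl | ⟨-, h, -⟩)
      · change (min (3 * k) (n - 1) + 1) / 3 = k
        omega
      · rw [abs_le] at h
        have h1 := h.1
        have h2 := h.2
        simp only at h1 h2
        omega
    intro k hk l hl x hxk hxl
    rw [← key k hk x hxk, ← key l hl x hxl]
  · intro a ha b hb hab
    simp only [Finset.mem_image, Finset.mem_range] at ha hb
    obtain ⟨k, hk, rfl⟩ := ha
    obtain ⟨l, hl, rfl⟩ := hb
    obtain ⟨h1, h2, -⟩ := hab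
    rw [abs_le] at h2
    have h3 := h2.1
    have h4 := h2.2
    simp only at h3 h4
    have : k = l := by omega
    subst this
    exact h1 rfl
  · intro x hx
    have hx1 := x.1.2
    refine ⟨_, Finset.mem_image.2 ⟨x.1.1 / 3, Finset.mem_range.2 (by omega), rfl⟩, ?_, ?_, ?_⟩
    · rintro h
      apply hx
      exact Finset.mem_image.2 ⟨x.1.1 / 3, Finset.mem_range.2 (by omega), h.symm⟩
    · rw [abs_le]
      simp only
      omega
    · exact hone _
  · exact Finset.card_image_le.trans (by simp)
end

section
/- For every integer n ≥ 3, depth(S_{n,2}/I(C_{n,2})) = ⌈(n−1)/3⌉, and sdepth(S_{n,2}/I(C_{n,2})) ≥ ⌈(n−1)/3⌉. -/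
open MvPolynomial

section Koszul

open scoped Pointwise

/-- Koszul-type differential on (non-alternating) cochains indexed by lists. -/
def DD {R M V : Type} [CommRing R] [AddCommGroup M] [Module R M] (f : V → R) :
    List V → (List V → M) → M
  | [], _ => 0
  | v :: l, φ => f v • φ l - DD f l (fun l' => φ (v :: l'))

variable {R M N P V : Type} [CommRing R] [AddCommGroup M] [Module R M]
  [AddCommGroup N] [Module R N] [AddCommGroup P] [Module R P]

theorem DD_add (f : V → R) (l : List V) (φ ψ : List V → M) :
    DD f l (fun l => φ l + ψ l) = DD f l φ + DD f l ψ := by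
  induction l generalizing φ ψ with
  | nil => simp [DD]
  | cons v l ih => simp only [DD, ih, smul_add]; abel

theorem DD_smul (f : V → R) (l : List V) (r : R) (φ : List V → M) :
    DD f l (fun l => r • φ l) = r • DD f l φ := by
  induction l generalizing φ with
  | nil => simp [DD]
  | cons v l ih => simp only [DD, ih, smul_sub, smul_comm r]

theorem DD_map (f : V → R) (l : List V) (g : M →ₗ[R] N) (φ : List V → M) :
    DD f l (fun l => g (φ l)) = g (DD f l φ) := by
  induction l generalizing φ with
  | nil => simp [DD]
  | cons v l ih => simp only [DD, ih, map_sub, map_smul]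

theorem DD_zero (f : V → R) (l : List V) : DD f l (fun _ => (0 : M)) = 0 := by
  induction l with
  | nil => simp [DD]
  | cons v l ih => simp only [DD, ih, smul_zero, sub_zero]

theorem DD_sub (f : V → R) (l : List V) (φ ψ : List V → M) :
    DD f l (fun l => φ l - ψ l) = DD f l φ - DD f l ψ := by
  induction l generalizing φ ψ with
  | nil => simp [DD]
  | cons v l ih => simp only [DD, ih, smul_sub]; abel

theorem DD_sum {ι : Type} (s : Finset ι) (f : V → R) (l : List V) (φ : ι → List V → M) :
    DD f l (fun l => ∑ i ∈ s, φ i l) = ∑ i ∈ s, DD f l (φ i) := by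
  classical
  induction s using Finset.induction_on with
  | empty => simp [DD_zero]
  | insert a s ha ih => simp only [Finset.sum_insert ha, DD_add, ih]

theorem DD_congr (f : V → R) (p : ℕ) (φ ψ : List V → M)
    (h : ∀ l : List V, l.length = p → φ l = ψ l) (l : List V) (hl : l.length = p + 1) :
    DD f l φ = DD f l ψ := by
  induction l generalizing p φ ψ with
  | nil => simp [DD]
  | cons v l ih =>
    have hl' : l.length = p := by simpa using hl
    simp only [DD, h l hl']
    congr 1
    cases p with
    | zero =>
      have : l = [] := List.eq_nil_of_length_eq_zero hl'
      subst this; simp [DD]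
    | succ p => exact ih p _ _ (fun l' h' => h _ (by simp [h'])) hl'

theorem DD_comm (f g : V → R) (l : List V) (φ : List V → M) :
    DD f l (fun l => DD g l φ) = - DD g l (fun l => DD f l φ) := by
  induction l generalizing φ with
  | nil => simp [DD]
  | cons v l ih =>
    simp only [DD, DD_sub, DD_smul, ih]
    abel

theorem DD_self (f : V → R) (l : List V) (φ : List V → M) :
    DD f l (fun l => DD f l φ) = 0 := by
  induction l generalizing φ with
  | nil => simp [DD]
  | cons v l ih =>
    simp only [DD, DD_sub, DD_smul, ih]
    abel

/-- Vanishing of the cohomology in degrees `< d`. -/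
def Van (M : Type) [AddCommGroup M] [Module R M] (x : V → R) (d : ℕ) : Prop :=
  ∀ p < d, ∀ φ : List V → M, (∀ l : List V, l.length = p + 1 → DD x l φ = 0) →
    ∃ ψ : List V → M, ∀ l : List V, l.length = p → φ l = DD x l ψ

theorem Van.ses (x : V → R) (d : ℕ) (i : N →ₗ[R] M) (g : M →ₗ[R] P)
    (hi : Function.Injective i) (hg : Function.Surjective g)
    (hex : ∀ m, g m = 0 → ∃ n, i n = m) (hN : Van N x d) (hP : Van P x d) : Van M x d := by
  intro p hp φ hφ
  obtain ⟨η, hη⟩ := hP p hp (fun l => g (φ l)) (fun l hl => by rw [DD_map, hφ l hl, map_zero])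
  choose s hs using hg
  have h1 : ∀ l : List V, ∃ n, l.length = p → i n = φ l - DD x l (fun l => s (η l)) := by
    intro l
    by_cases hl : l.length = p
    · obtain ⟨n, hn⟩ := hex (φ l - DD x l (fun l => s (η l))) (by
        rw [map_sub, ← DD_map, hη l hl]; simp [hs])
      exact ⟨n, fun _ => hn⟩
    · exact ⟨0, fun h => absurd h hl⟩
  choose χ hχ using h1
  obtain ⟨ζ, hζ⟩ := hN p hp χ (fun l hl => by
    apply hi
    rw [← DD_map, DD_congr x p _ _ (fun l hl => hχ l hl) l hl, DD_sub, hφ l hl, DD_self]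
    simp)
  refine ⟨fun l => s (η l) + i (ζ l), fun l hl => ?_⟩
  rw [DD_add, DD_map, ← hζ l hl, hχ l hl]
  abel

theorem Van.up [Fintype V] (x : V → R) (d : ℕ) (r : R) (hr : r ∈ Ideal.span (Set.range x))
    (hreg : ∀ m : M, r • m = 0 → m = 0) (g : M →ₗ[R] P) (hg : Function.Surjective g)
    (hex : ∀ m, g m = 0 ↔ ∃ n, r • n = m) (hP : Van P x d) : Van M x (d + 1) := by
  intro p hp φ hφ
  obtain ⟨c, hc⟩ := (Ideal.mem_span_range_iff_exists_fun).1 hr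
  have hψ : ∀ l : List V, l.length = p →
      DD x l (fun l => ∑ w, c w • φ (w :: l)) = r • φ l := by
    intro l hl
    rw [DD_sum]
    simp only [DD_smul]
    rw [← hc, Finset.sum_smul]
    refine Finset.sum_congr rfl fun w _ => ?_
    have := hφ (w :: l) (by simp [hl])
    simp only [DD, sub_eq_zero] at this
    rw [← this, mul_smul]
  generalize (fun l => ∑ w, c w • φ (w :: l)) = ψ at hψ
  cases p with
  | zero =>
    refine ⟨fun _ => 0, fun l hl => ?_⟩
    rw [DD_zero]
    apply hreg
    rw [← hψ l hl, List.eq_nil_of_length_eq_zero hl]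
    rfl
  | succ p =>
    obtain ⟨η, hη⟩ := hP p (by omega) (fun l => g (ψ l)) (fun l hl => by
      rw [DD_map, hψ l hl, hex]; exact ⟨_, rfl⟩)
    choose s hs using hg
    have h1 : ∀ l : List V, ∃ n, l.length = p → r • n = ψ l - DD x l (fun l => s (η l)) := by
      intro l
      by_cases hl : l.length = p
      · obtain ⟨n, hn⟩ := (hex (ψ l - DD x l (fun l => s (η l)))).1 (by
          rw [map_sub, ← DD_map, hη l hl]; simp [hs])
        exact ⟨n, fun _ => hn⟩
      · exact ⟨0, fun h => absurd h hl⟩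
    choose ξ hξ using h1
    refine ⟨ξ, fun l hl => ?_⟩
    rw [← sub_eq_zero]
    apply hreg
    rw [smul_sub, ← hψ l hl, ← DD_smul, DD_congr x p _ _ (fun l hl => hξ l hl) l hl, DD_sub,
      DD_self]
    simp

theorem Van.down (x : V → R) (d : ℕ) (r : R)
    (hreg : ∀ m : M, r • m = 0 → m = 0) (g : M →ₗ[R] P) (hg : Function.Surjective g)
    (hex : ∀ m, g m = 0 ↔ ∃ n, r • n = m) (hM : Van M x (d + 1)) : Van P x d := by
  intro p hp φ hφ
  choose s hs using hg
  have h1 : ∀ l : List V, ∃ n, l.length = p + 1 → r • n = DD x l (fun l => s (φ l)) := by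
    intro l
    by_cases hl : l.length = p + 1
    · obtain ⟨n, hn⟩ := (hex (DD x l (fun l => s (φ l)))).1 (by
        rw [← DD_map]; simp only [hs]; exact hφ l hl)
      exact ⟨n, fun _ => hn⟩
    · exact ⟨0, fun h => absurd h hl⟩
  choose χ hχ using h1
  obtain ⟨η, hη⟩ := hM (p + 1) (by omega) χ (fun l hl => by
    apply hreg
    rw [← DD_smul, DD_congr x (p + 1) _ _ (fun l hl => hχ l hl) l hl, DD_self])
  obtain ⟨ψ, hψ⟩ := hM p (by omega) (fun l => s (φ l) - r • η l) (fun l hl => by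
    rw [DD_sub, DD_smul, ← hη l hl, hχ l hl, sub_self])
  refine ⟨fun l => g (ψ l), fun l hl => ?_⟩
  rw [DD_map, ← hψ l hl, map_sub, hs]
  have : g (r • η l) = 0 := (hex _).2 ⟨_, rfl⟩
  rw [this, sub_zero]

theorem mk_quotSMulTop (r : R) (m : M) :
    (Submodule.mkQ (r • (⊤ : Submodule R M))) m = 0 ↔ ∃ n, r • n = m := by
  rw [Submodule.mkQ_apply, Submodule.Quotient.mk_eq_zero]
  constructor
  · intro h
    obtain ⟨n, _, hn⟩ := Submodule.mem_smul_pointwise_iff_exists _ _ _ |>.1 h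
    exact ⟨n, hn⟩
  · rintro ⟨n, rfl⟩
    exact Submodule.smul_mem_pointwise_smul _ _ _ trivial

theorem Van.of_regular [Fintype V] (x : V → R) (rs : List R) (M : Type) [AddCommGroup M]
    [Module R M]
    (hrs : ∀ f ∈ rs, f ∈ Ideal.span (Set.range x))
    (h : RingTheory.Sequence.IsWeaklyRegular M rs) : Van M x rs.length := by
  induction rs generalizing M with
  | nil => intro p hp; simp at hp
  | cons r rs ih =>
    rw [RingTheory.Sequence.isWeaklyRegular_cons_iff] at h
    have := ih (QuotSMulTop r M) (fun f hf => hrs f (by simp [hf])) h.2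
    refine Van.up x rs.length r (hrs r (by simp)) (fun m hm => ?_)
      (Submodule.mkQ (r • (⊤ : Submodule R M))) (Submodule.mkQ_surjective _)
      (mk_quotSMulTop r) this
    exact h.1 (by simpa using hm)

theorem Van.exists_regular [IsNoetherianRing R] (x : V → R) (d : ℕ)
    (M : Type) [AddCommGroup M] [Module R M] [Module.Finite R M] (h : Van M x d) :
    ∃ rs : List R, rs.length = d ∧ (∀ f ∈ rs, f ∈ Ideal.span (Set.range x)) ∧
      RingTheory.Sequence.IsWeaklyRegular M rs := by
  induction d generalizing M with
  | zero => exact ⟨[], rfl, by simp, RingTheory.Sequence.IsWeaklyRegular.nil R M⟩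
  | succ d ih =>
    have h0 : ∀ m : M, (∀ v, x v • m = 0) → m = 0 := by
      intro m hm
      obtain ⟨ψ, hψ⟩ := h 0 (by omega) (fun _ => m) (fun l hl => by
        match l, hl with
        | [v], _ => simp [DD, hm])
      simpa [DD] using hψ [] rfl
    have hfin := associatedPrimes.finite R M
    have h1 : ¬ ((Ideal.span (Set.range x) : Ideal R) : Set R) ⊆
        ⋃ I ∈ associatedPrimes R M, (I : Set R) := by
      intro hsub
      obtain ⟨I, hI, hle⟩ := (Ideal.subset_union_prime_finite hfin (f := fun I => I) ⊥ ⊥ (fun I hI _ _ =>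
        IsAssociatedPrime.isPrime hI)).1 hsub
      obtain ⟨hprime, y, hy⟩ := isAssociatedPrime_iff.1 hI
      apply hprime.ne_top
      have hy0 : y = 0 := by
        apply h0
        intro v
        have hv : x v ∈ I := hle (Ideal.subset_span ⟨v, rfl⟩)
        rw [hy] at hv
        simpa using hv
      rw [hy, hy0]
      simp
    obtain ⟨r, hr, hr'⟩ := Set.not_subset.1 h1
    have hreg : ∀ m : M, r • m = 0 → m = 0 := by
      intro m hm
      by_contra hne
      apply hr'
      rw [biUnion_associatedPrimes_eq_zero_divisors]
      exact ⟨m, hne, hm⟩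
    have h2 := Van.down x d r hreg (Submodule.mkQ (r • (⊤ : Submodule R M)))
      (Submodule.mkQ_surjective _) (mk_quotSMulTop r) h
    obtain ⟨rs, hl, hm, hw⟩ := ih (QuotSMulTop r M) h2
    refine ⟨r :: rs, by simp [hl], ?_, ?_⟩
    · intro f hf
      rcases List.mem_cons.1 hf with rfl | hf
      · exact hr
      · exact hm f hf
    · rw [RingTheory.Sequence.isWeaklyRegular_cons_iff]
      refine ⟨fun a b hab => ?_, hw⟩
      rw [← sub_eq_zero]
      apply hreg
      rw [smul_sub, sub_eq_zero]; exact hab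

end Koszul

section Monomial

variable {V : Type} (K : Type) [Field K] (Adj : V → V → Prop)

/-- `m` is supported on an independent subset of `W`. -/
def Good (W : Finset V) (m : V →₀ ℕ) : Prop :=
  (∀ v, m v ≠ 0 → v ∈ W) ∧ ∀ a b, Adj a b → m a = 0 ∨ m b = 0

variable {Adj} in
theorem Good.mono {W : Finset V} {m m' : V →₀ ℕ} (h : Good Adj W m) (hm : ∀ v, m' v ≤ m v) :
    Good Adj W m' := by
  refine ⟨fun v hv => h.1 v (by have := hm v; omega), fun a b hab => ?_⟩
  have := hm a
  have := hm b
  rcases h.2 a b hab with h | h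
  · left; omega
  · right; omega

/-- The monomial ideal of polynomials none of whose monomials is good. -/
def JI (W : Finset V) : Ideal (MvPolynomial V K) where
  carrier := {p | ∀ m, Good Adj W m → coeff m p = 0}
  add_mem' := by
    intro a b ha hb m hm
    simp [ha m hm, hb m hm]
  zero_mem' := by intro m _; simp
  smul_mem' := by
    intro c p hp m hm
    classical
    rw [smul_eq_mul, coeff_mul]
    refine Finset.sum_eq_zero fun x hx => ?_
    have hx' := Finset.HasAntidiagonal.mem_antidiagonal.1 hx
    rw [hp x.2 (hm.mono (fun v => by rw [← hx']; simp)), mul_zero]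

theorem mem_JI {W : Finset V} {p : MvPolynomial V K} :
    p ∈ JI K Adj W ↔ ∀ m, Good Adj W m → coeff m p = 0 := Iff.rfl

theorem edgeIdeal_eq_JI [Fintype V] (hirr : ∀ a, ¬ Adj a a) :
    edgeIdeal K Adj = JI K Adj Finset.univ := by
  classical
  apply le_antisymm
  · rw [edgeIdeal, Ideal.span_le]
    rintro p ⟨a, b, hab, rfl⟩ m hm
    rw [X, X, monomial_mul, coeff_monomial, if_neg]
    rintro rfl
    rcases hm.2 a b hab with h | h <;> simp at h
  · intro p hp
    rw [p.as_sum]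
    refine Ideal.sum_mem _ fun m hm => ?_
    have hbad : ¬ Good Adj Finset.univ m := fun h => (mem_support_iff.1 hm) (hp m h)
    have : ∃ a b, Adj a b ∧ m a ≠ 0 ∧ m b ≠ 0 := by
      by_contra hcon
      push Not at hcon
      exact hbad ⟨fun v _ => Finset.mem_univ v, fun a b hab => by
        by_cases h : m a = 0
        · exact Or.inl h
        · exact Or.inr (hcon a b hab h)⟩
    obtain ⟨a, b, hab, ha, hb⟩ := this
    have hne : a ≠ b := by rintro rfl; exact hirr a hab
    have hle : Finsupp.single a 1 + Finsupp.single b 1 ≤ m := by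
      intro v
      simp only [Finsupp.add_apply, Finsupp.single_apply]
      split_ifs with h1 h2 h2
      · exact absurd (h1.trans h2.symm) hne
      · subst h1; omega
      · subst h2; omega
      · omega
    have hm2 : monomial m (coeff m p) = monomial (m - (Finsupp.single a 1 + Finsupp.single b 1))
        (coeff m p) * (X a * X b) := by
      rw [X, X, monomial_mul, monomial_mul, tsub_add_cancel_of_le hle]; simp
    rw [hm2]
    exact Ideal.mul_mem_left _ _ (Ideal.subset_span ⟨a, b, hab, rfl⟩)

open Classical in
/-- Inductive certificates for lower bounds of depth and Stanley depth. -/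
inductive HasD (Adj : V → V → Prop) : ℕ → Finset V → Prop
  | base (W : Finset V) : HasD Adj 0 W
  | split (d : ℕ) (W : Finset V) (v : V) (hv : v ∈ W) (h1 : HasD Adj d (W.erase v))
      (h2 : HasD Adj d (W.filter fun w => ¬ Adj v w)) : HasD Adj d W
  | iso (d : ℕ) (W : Finset V) (v : V) (hv : v ∈ W) (hi : ∀ w ∈ W, ¬ Adj v w)
      (h1 : HasD Adj d (W.erase v)) : HasD Adj (d + 1) W

open Classical in
theorem HasD.packing (hsymm : ∀ a b, Adj a b → Adj b a) (hirr : ∀ a, ¬ Adj a a)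
    (W B : Finset V) (hB : B ⊆ W)
    (hd : ∀ b ∈ B, ∀ b' ∈ B, b ≠ b' → ∀ w ∈ W, (w = b ∨ Adj b w) → ¬ (w = b' ∨ Adj b' w)) :
    HasD Adj B.card W := by
  induction hn : W.card using Nat.strong_induction_on generalizing W B with
  | _ N ih =>
  subst hn
  rcases B.eq_empty_or_nonempty with rfl | ⟨b, hb⟩
  · exact HasD.base W
  have hcard : B.card = (B.erase b).card + 1 := by
    rw [Finset.card_erase_of_mem hb]
    have := Finset.card_pos.2 ⟨b, hb⟩
    omega
  by_cases hiso : ∀ w ∈ W, ¬ Adj b w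
  · rw [hcard]
    refine HasD.iso _ _ b (hB hb) hiso ?_
    refine ih _ (Finset.card_erase_lt_of_mem (hB hb)) _ _ (Finset.erase_subset_erase _ hB) ?_ rfl
    intro c hc c' hc' hne w hw
    exact hd c (Finset.mem_of_mem_erase hc) c' (Finset.mem_of_mem_erase hc') hne w
      (Finset.mem_of_mem_erase hw)
  · push Not at hiso
    obtain ⟨v, hvW, hbv⟩ := hiso
    have hvb : v ≠ b := by rintro rfl; exact hirr _ hbv
    have hnot : ∀ c ∈ B, c ≠ b → ¬ (v = c ∨ Adj c v) := fun c hc hne =>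
      hd b hb c hc (Ne.symm hne) v hvW (Or.inr hbv)
    refine HasD.split _ _ v hvW ?_ ?_
    · refine ih _ (Finset.card_erase_lt_of_mem hvW) _ _ ?_ ?_ rfl
      · intro c hc
        refine Finset.mem_erase.2 ⟨?_, hB hc⟩
        rintro rfl
        exact hnot c hc hvb (Or.inl rfl)
      · intro c hc c' hc' hne w hw
        exact hd c hc c' hc' hne w (Finset.mem_of_mem_erase hw)
    · rw [hcard]
      have hvf : v ∈ W.filter fun w => ¬ Adj v w := Finset.mem_filter.2 ⟨hvW, hirr v⟩
      refine HasD.iso _ _ v hvf (fun w hw => (Finset.mem_filter.1 hw).2) ?_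
      refine ih _ ?_ _ _ ?_ ?_ rfl
      · exact lt_of_lt_of_le (Finset.card_erase_lt_of_mem hvf)
          (Finset.card_le_card (Finset.filter_subset _ _))
      · intro c hc
        have hc' := Finset.mem_erase.1 hc
        have := hnot c hc'.2 hc'.1
        push Not at this
        refine Finset.mem_erase.2 ⟨this.1.symm, Finset.mem_filter.2 ⟨hB hc'.2, fun h => ?_⟩⟩
        exact this.2 (hsymm _ _ h)
      · intro c hc c' hc' hne w hw
        exact hd c (Finset.mem_of_mem_erase hc) c' (Finset.mem_of_mem_erase hc') hne w
          (Finset.mem_filter.1 (Finset.mem_of_mem_erase hw)).1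

variable {Adj}

open Classical in
theorem good_erase {W : Finset V} {v : V} {m : V →₀ ℕ} :
    Good Adj (W.erase v) m ↔ Good Adj W m ∧ m v = 0 := by
  constructor
  · intro h
    refine ⟨⟨fun w hw => Finset.mem_of_mem_erase (h.1 w hw), h.2⟩, ?_⟩
    by_contra hv
    simpa using h.1 v hv
  · rintro ⟨h, hv⟩
    refine ⟨fun w hw => Finset.mem_erase.2 ⟨?_, h.1 w hw⟩, h.2⟩
    rintro rfl
    exact hw hv

open Classical in
theorem good_filter (hsymm : ∀ a b, Adj a b → Adj b a) (hirr : ∀ a, ¬ Adj a a)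
    {W : Finset V} {v : V} (hv : v ∈ W) {m : V →₀ ℕ} :
    Good Adj (W.filter fun w => ¬ Adj v w) m ↔ Good Adj W (m + Finsupp.single v 1) := by
  constructor
  · intro h
    refine ⟨fun w hw => ?_, fun a b hab => ?_⟩
    · by_cases hwv : w = v
      · rwa [hwv]
      · refine (Finset.mem_filter.1 (h.1 w ?_)).1
        simpa [Finsupp.single_apply, Ne.symm hwv] using hw
    · have key : ∀ c, Adj v c → m c = 0 := by
        intro c hc
        by_contra hne
        exact (Finset.mem_filter.1 (h.1 c hne)).2 hc
      by_cases ha : a = v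
      · subst ha
        right
        have : a ≠ b := by rintro rfl; exact hirr _ hab
        simp [this, key b hab]
      · by_cases hb : b = v
        · subst hb
          left
          simp [Ne.symm ha, key a (hsymm _ _ hab)]
        · simpa [Finsupp.single_apply, Ne.symm ha, Ne.symm hb] using h.2 a b hab
  · intro h
    have hm : Good Adj W m := h.mono (by intro w; simp)
    refine ⟨fun w hw => Finset.mem_filter.2 ⟨hm.1 w hw, fun hvw => ?_⟩, hm.2⟩
    rcases h.2 v w hvw with h | h
    · simp at h
    · simp at h; exact hw h.1

theorem coeff_X_mul_ne (v : V) (p : MvPolynomial V K) (m : V →₀ ℕ) (hm : m v ≠ 0) :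
    coeff m (X v * p) = coeff (m - Finsupp.single v 1) p := by
  classical
  rw [coeff_X_mul', if_pos (by simpa using hm)]

open Classical in
theorem van_of_hasD [Fintype V] (hsymm : ∀ a b, Adj a b → Adj b a) (hirr : ∀ a, ¬ Adj a a)
    (d : ℕ) (W : Finset V) (h : HasD Adj d W) :
    Van (MvPolynomial V K ⧸ JI K Adj W) (X : V → MvPolynomial V K) d := by
  have hsurj : ∀ (A B : Ideal (MvPolynomial V K)) (hAB : A ≤ B),
      Function.Surjective (Submodule.mapQ A B LinearMap.id hAB) := by
    intro A B hAB y
    obtain ⟨y, rfl⟩ := Submodule.Quotient.mk_surjective _ y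
    exact ⟨Submodule.Quotient.mk y, by simp⟩
  have hle : ∀ (W : Finset V) (v : V), JI K Adj W ≤ JI K Adj (W.erase v) := by
    intro W v p hp m hm
    exact hp m (good_erase.1 hm).1
  -- if `p` is killed in the deletion, it is a multiple of `X v` modulo `JI W`
  have hker : ∀ (W : Finset V) (v : V) (p : MvPolynomial V K), p ∈ JI K Adj (W.erase v) →
      ∃ q, X v * q - p ∈ JI K Adj W := by
    intro W v p hp
    refine ⟨p.divMonomial (Finsupp.single v 1), fun m hm => ?_⟩
    rw [coeff_sub]
    by_cases hmv : m v = 0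
    · rw [hp m (good_erase.2 ⟨hm, hmv⟩), coeff_X_mul', if_neg (by simpa using hmv), sub_zero]
    · rw [coeff_X_mul_ne _ _ _ _ hmv, coeff_divMonomial, add_tsub_cancel_of_le, sub_self]
      intro w
      rw [Finsupp.single_apply]
      split_ifs with h
      · subst h; omega
      · omega
  induction h with
  | base W => intro p hp; omega
  | split d W v hv h1 h2 ih1 ih2 =>
    have hJ : JI K Adj (W.filter fun w => ¬ Adj v w) ≤
        Submodule.comap (LinearMap.mulLeft (MvPolynomial V K) (X v)) (JI K Adj W) := by
      intro p hp
      rw [Submodule.mem_comap]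
      intro m hm
      rw [LinearMap.mulLeft_apply]
      by_cases hmv : m v = 0
      · rw [coeff_X_mul', if_neg (by simpa using hmv)]
      · rw [coeff_X_mul_ne _ _ _ _ hmv]
        apply hp
        rw [good_filter hsymm hirr hv, tsub_add_cancel_of_le]
        · exact hm
        · intro w
          rw [Finsupp.single_apply]
          split_ifs with h
          · subst h; omega
          · omega
    refine Van.ses _ d (Submodule.mapQ _ _ (LinearMap.mulLeft (MvPolynomial V K) (X v)) hJ)
      (Submodule.mapQ (JI K Adj W) (JI K Adj (W.erase v)) LinearMap.id (hle W v)) ?_ (hsurj _ _ _) ?_ ih2 ih1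
    · rw [injective_iff_map_eq_zero]
      intro y hy
      obtain ⟨y, rfl⟩ := Submodule.Quotient.mk_surjective _ y
      rw [Submodule.mapQ_apply, Submodule.Quotient.mk_eq_zero] at hy
      rw [Submodule.Quotient.mk_eq_zero]
      intro m hm
      have := hy _ ((good_filter hsymm hirr hv).1 hm)
      rw [LinearMap.mulLeft_apply, coeff_X_mul_ne _ _ _ _ (by simp)] at this
      simpa using this
    · intro y hy
      obtain ⟨y, rfl⟩ := Submodule.Quotient.mk_surjective _ y
      rw [Submodule.mapQ_apply, Submodule.Quotient.mk_eq_zero] at hy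
      obtain ⟨q, hq⟩ := hker W v y hy
      refine ⟨Submodule.Quotient.mk q, ?_⟩
      rw [Submodule.mapQ_apply, Submodule.Quotient.eq]
      exact hq
  | iso d W v hv hi h1 ih1 =>
    refine Van.up _ d (X v) (Ideal.subset_span ⟨v, rfl⟩) ?_
      (Submodule.mapQ (JI K Adj W) (JI K Adj (W.erase v)) LinearMap.id (hle W v)) (hsurj _ _ _) ?_ ih1
    · intro y hy
      obtain ⟨y, rfl⟩ := Submodule.Quotient.mk_surjective _ y
      rw [← Submodule.Quotient.mk_smul, Submodule.Quotient.mk_eq_zero, smul_eq_mul] at hy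
      rw [Submodule.Quotient.mk_eq_zero]
      intro m hm
      have hf : (W.filter fun w => ¬ Adj v w) = W := Finset.filter_true_of_mem hi
      have := hy _ ((good_filter hsymm hirr hv).1 (by rw [hf]; exact hm))
      rw [coeff_X_mul_ne _ _ _ _ (by simp)] at this
      simpa using this
    · intro y
      obtain ⟨y, rfl⟩ := Submodule.Quotient.mk_surjective _ y
      rw [Submodule.mapQ_apply, Submodule.Quotient.mk_eq_zero]
      constructor
      · intro hy
        obtain ⟨q, hq⟩ := hker W v y hy
        refine ⟨Submodule.Quotient.mk q, ?_⟩
        rw [← Submodule.Quotient.mk_smul, Submodule.Quotient.eq]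
        exact hq
      · rintro ⟨n, hn⟩
        obtain ⟨n, rfl⟩ := Submodule.Quotient.mk_surjective _ n
        rw [← Submodule.Quotient.mk_smul, Submodule.Quotient.eq, smul_eq_mul] at hn
        intro m hm
        obtain ⟨hm1, hm2⟩ := good_erase.1 hm
        have := hn m hm1
        rw [coeff_sub, coeff_X_mul', if_neg (by simpa using hm2)] at this
        simpa using this

end Monomial

section Stanley

variable {V : Type} [Fintype V] (K : Type) [Field K] {Adj : V → V → Prop}

/-- Exponents of the Stanley space with generator `u` and variables `A`. -/
def sbox (u : V →₀ ℕ) (A : Finset V) : Set (V →₀ ℕ) :=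
  {m | ∀ v, u v ≤ m v ∧ (v ∉ A → m v = u v)}

open Classical in
theorem stanley_comb (hsymm : ∀ a b, Adj a b → Adj b a) (hirr : ∀ a, ¬ Adj a a)
    (d : ℕ) (W : Finset V) (h : HasD Adj d W) :
    ∃ (ι : Type) (_ : Fintype ι) (u : ι → V →₀ ℕ) (A : ι → Finset V),
      (∀ i, d ≤ (A i).card) ∧ (∀ i, ∀ m ∈ sbox (u i) (A i), Good Adj W m) ∧
      ∀ m, Good Adj W m → ∃! i, m ∈ sbox (u i) (A i) := by
  induction h with
  | base W =>
    let ind : Finset V → V →₀ ℕ := fun F => Finsupp.equivFunOnFinite.symm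
      (fun v => if v ∈ F then 1 else 0)
    have hind : ∀ F v, ind F v = if v ∈ F then 1 else 0 := fun F v => rfl
    have hbox : ∀ F m, m ∈ sbox (ind F) F ↔ m.support = F := by
      intro F m
      constructor
      · intro h
        ext v
        have := h v
        rw [hind] at this
        rw [Finsupp.mem_support_iff]
        by_cases hv : v ∈ F
        · simp only [hv, if_true] at this ⊢
          simp only [iff_true]; omega
        · simp only [hv, if_false] at this ⊢
          simpa using this
      · rintro rfl v
        rw [hind]
        by_cases hv : m v = 0
        · simp [hv]
        · simp [hv]; omega
    have hgood : ∀ m, Good Adj W m ↔ Good Adj W (ind m.support) := by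
      intro m
      have h0 : ∀ v, ind m.support v = 0 ↔ m v = 0 := by
        intro v; rw [hind]; simp
      simp only [Good, ne_eq, h0]
    refine ⟨{F : Finset V // Good Adj W (ind F)}, inferInstance, fun F => ind F.1, fun F => F.1,
      fun _ => Nat.zero_le _, ?_, ?_⟩
    · intro F m hm
      rw [hbox] at hm
      rw [hgood, hm]
      exact F.2
    · intro m hm
      refine ⟨⟨m.support, (hgood m).1 hm⟩, (hbox _ _).2 rfl, ?_⟩
      rintro ⟨F, hF⟩ h
      exact Subtype.ext ((hbox _ _).1 h).symm
  | split d W v hv h1 h2 ih1 ih2 =>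
    obtain ⟨ι₁, _, u₁, A₁, hc₁, hg₁, hu₁⟩ := ih1
    obtain ⟨ι₂, _, u₂, A₂, hc₂, hg₂, hu₂⟩ := ih2
    have hsh : ∀ i m, m ∈ sbox (u₂ i + Finsupp.single v 1) (A₂ i) ↔
        ∃ m', m = m' + Finsupp.single v 1 ∧ m' ∈ sbox (u₂ i) (A₂ i) := by
      intro i m
      constructor
      · intro h
        have hle : Finsupp.single v 1 ≤ m := by
          intro w
          have := (h w).1
          simp only [Finsupp.add_apply] at this
          omega
        refine ⟨m - Finsupp.single v 1, (tsub_add_cancel_of_le hle).symm, fun w => ?_⟩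
        have := h w
        have := hle w
        simp only [Finsupp.add_apply, Finsupp.tsub_apply] at *
        constructor
        · omega
        · intro hw
          have := (h w).2 hw
          simp only [Finsupp.add_apply] at this
          omega
      · rintro ⟨m', rfl, h⟩ w
        have := h w
        simp only [Finsupp.add_apply]
        exact ⟨by omega, fun hw => by rw [this.2 hw]⟩
    refine ⟨ι₁ ⊕ ι₂, inferInstance, Sum.elim u₁ (fun i => u₂ i + Finsupp.single v 1),
      Sum.elim A₁ A₂, ?_, ?_, ?_⟩
    · rintro (i | i)
      · exact hc₁ i
      · exact hc₂ i
    · rintro (i | i) m hm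
      · exact (good_erase.1 (hg₁ i m hm)).1
      · obtain ⟨m', rfl, hm'⟩ := (hsh i m).1 hm
        exact (good_filter hsymm hirr hv).1 (hg₂ i m' hm')
    · intro m hm
      by_cases hmv : m v = 0
      · obtain ⟨i, hi, hi'⟩ := hu₁ m (good_erase.2 ⟨hm, hmv⟩)
        refine ⟨Sum.inl i, hi, ?_⟩
        rintro (j | j) hj
        · rw [hi' j hj]
        · obtain ⟨m', rfl, hm'⟩ := (hsh j m).1 hj
          simp at hmv
      · have hle : Finsupp.single v 1 ≤ m := by
          intro w
          rw [Finsupp.single_apply]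
          split_ifs with h
          · subst h; omega
          · omega
        obtain ⟨m', rfl⟩ : ∃ m', m = m' + Finsupp.single v 1 :=
          ⟨m - Finsupp.single v 1, (tsub_add_cancel_of_le hle).symm⟩
        obtain ⟨i, hi, hi'⟩ := hu₂ m' ((good_filter hsymm hirr hv).2 hm)
        refine ⟨Sum.inr i, (hsh i _).2 ⟨m', rfl, hi⟩, ?_⟩
        rintro (j | j) hj
        · exact absurd (good_erase.1 (hg₁ j _ hj)).2 hmv
        · obtain ⟨m'', h1, hm''⟩ := (hsh j _).1 hj
          have := add_right_cancel h1
          subst this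
          rw [hi' j hm'']
  | iso d W v hv hi h1 ih1 =>
    obtain ⟨ι, _, u, A, hc, hg, hu⟩ := ih1
    have hself : ∀ i, u i ∈ sbox (u i) (A i) := fun i w => ⟨le_rfl, fun _ => rfl⟩
    have huv : ∀ i, u i v = 0 := fun i => (good_erase.1 (hg i _ (hself i))).2
    have hvA : ∀ i, v ∉ A i := by
      intro i hvi
      have : u i + Finsupp.single v 1 ∈ sbox (u i) (A i) := by
        intro w
        simp only [Finsupp.add_apply]
        refine ⟨by omega, fun hw => ?_⟩
        have : v ≠ w := by rintro rfl; exact hw hvi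
        simp [this]
      have := (good_erase.1 (hg i _ this)).2
      simp at this
    have hbox : ∀ i m, m ∈ sbox (u i) (insert v (A i)) ↔ m.erase v ∈ sbox (u i) (A i) := by
      intro i m
      refine forall_congr' fun w => ?_
      by_cases hw : w = v
      · subst hw
        simp [huv]
      · simp [hw, Finsupp.erase_ne hw]
    have hgood : ∀ m : V →₀ ℕ, Good Adj W m ↔ Good Adj (W.erase v) (m.erase v) := by
      intro m
      rw [good_erase]
      constructor
      · intro h
        refine ⟨h.mono fun w => ?_, by simp⟩
        by_cases hw : w = v
        · subst hw; simp
        · simp [Finsupp.erase_ne hw]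
      · rintro ⟨h, -⟩
        refine ⟨fun w hw => ?_, fun a b hab => ?_⟩
        · by_cases hwv : w = v
          · rwa [hwv]
          · exact h.1 w (by rwa [Finsupp.erase_ne hwv])
        · by_contra hcon
          push Not at hcon
          have hmW : ∀ w, w ≠ v → m w ≠ 0 → w ∈ W := fun w hwv hw =>
            h.1 w (by rwa [Finsupp.erase_ne hwv])
          by_cases ha : a = v
          · subst ha
            by_cases hb : b = a
            · subst hb; exact hirr _ hab
            · exact hi b (hmW b hb hcon.2) hab
          · by_cases hb : b = v
            · subst hb
              exact hi a (hmW a ha hcon.1) (hsymm _ _ hab)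
            · have := h.2 a b hab
              rw [Finsupp.erase_ne ha, Finsupp.erase_ne hb] at this
              tauto
    refine ⟨ι, inferInstance, u, fun i => insert v (A i), ?_, ?_, ?_⟩
    · intro i
      rw [Finset.card_insert_of_notMem (hvA i)]
      exact Nat.succ_le_succ (hc i)
    · intro i m hm
      rw [hgood]
      exact hg i _ ((hbox i m).1 hm)
    · intro m hm
      obtain ⟨i, hi, hi'⟩ := hu _ ((hgood m).1 hm)
      exact ⟨i, (hbox i m).2 hi, fun j hj => hi' j ((hbox j m).1 hj)⟩

theorem le_sdepth (hsymm : ∀ a b, Adj a b → Adj b a) (hirr : ∀ a, ¬ Adj a a)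
    (d : ℕ) (W : Finset V) (h : HasD Adj d W) :
    d ≤ sdepth K V (MvPolynomial V K ⧸ JI K Adj W) := by
  classical
  obtain ⟨ι, _, u, A, hc, hg, hu⟩ := stanley_comb hsymm hirr d W h
  let e := (Fintype.equivFin ι).symm
  let b : {m // Good Adj W m} → MvPolynomial V K ⧸ JI K Adj W :=
    fun m => Ideal.Quotient.mk _ (monomial m.1 1)
  have hb : LinearIndependent K b := by
    rw [linearIndependent_iff']
    intro s g hs i his
    have h1 : ∑ j ∈ s, g j • b j =
        Ideal.Quotient.mk (JI K Adj W) (∑ j ∈ s, g j • monomial j.1 (1 : K)) := by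
      rw [map_sum]
      rfl
    rw [h1, Ideal.Quotient.eq_zero_iff_mem] at hs
    have := hs i.1 i.2
    rw [coeff_sum, Finset.sum_eq_single i] at this
    · simpa using this
    · intro j _ hj
      rw [coeff_smul, coeff_monomial, if_neg (fun h => hj (Subtype.ext h)), smul_zero]
    · intro h; exact absurd his h
  have hspan : Submodule.span K (Set.range b) = ⊤ := by
    rw [eq_top_iff]
    rintro y -
    obtain ⟨p, rfl⟩ := Ideal.Quotient.mk_surjective y
    rw [p.as_sum, map_sum]
    refine Submodule.sum_mem _ fun m _ => ?_
    by_cases hm : Good Adj W m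
    · have : Ideal.Quotient.mk (JI K Adj W) (monomial m (coeff m p)) = coeff m p • b ⟨m, hm⟩ := by
        have h2 : monomial m (coeff m p) = coeff m p • (monomial m (1 : K)) := by
          rw [smul_monomial]; simp
        rw [h2]
        rfl
      rw [this]
      exact Submodule.smul_mem _ _ (Submodule.subset_span ⟨_, rfl⟩)
    · have : Ideal.Quotient.mk (JI K Adj W) (monomial m (coeff m p)) = 0 := by
        rw [Ideal.Quotient.eq_zero_iff_mem]
        intro m' hm'
        rw [coeff_monomial, if_neg]
        rintro rfl
        exact hm hm'
      rw [this]
      exact Submodule.zero_mem _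
  let w : ι → MvPolynomial V K ⧸ JI K Adj W := fun i => Ideal.Quotient.mk _ (monomial (u i) 1)
  have hbox : ∀ i (u' : V →₀ ℕ), (↑u'.support : Set V) ⊆ ↑(A i) → u' + u i ∈ sbox (u i) (A i) := by
    intro i u' h' v
    simp only [Finsupp.add_apply]
    refine ⟨by omega, fun hv => ?_⟩
    have : u' v = 0 := by
      by_contra hne
      exact hv (h' (by simpa using hne))
    omega
  have hst : ∀ i, stanleySpace K V _ (w i) (A i) =
      Submodule.span K (b '' {m | m.1 ∈ sbox (u i) (A i)}) := by
    intro i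
    unfold stanleySpace
    congr 1
    ext y
    constructor
    · rintro ⟨u', hu', rfl⟩
      refine ⟨⟨u' + u i, hg i _ (hbox i u' hu')⟩, hbox i u' hu', ?_⟩
      change Ideal.Quotient.mk _ _ = Ideal.Quotient.mk _ (monomial u' (1 : K) * monomial (u i) (1 : K))
      rw [monomial_mul, one_mul]
    · rintro ⟨⟨m, hm⟩, hmb, rfl⟩
      have hle : u i ≤ m := fun v => (hmb v).1
      refine ⟨m - u i, ?_, ?_⟩
      · intro v hv
        by_contra hvA
        have := (hmb v).2 hvA
        simp only [Finset.mem_coe, Finsupp.mem_support_iff, Finsupp.tsub_apply] at hv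
        simp only at this
        omega
      · change Ideal.Quotient.mk _ _ =
          Ideal.Quotient.mk _ (monomial (m - u i) (1 : K) * monomial (u i) (1 : K))
        rw [monomial_mul, one_mul, tsub_add_cancel_of_le hle]
  have hind : iSupIndep fun i => stanleySpace K V _ (w i) (A i) := by
    intro i
    simp only [hst]
    have h3 : (⨆ j, ⨆ (_ : j ≠ i), Submodule.span K (b '' {m | m.1 ∈ sbox (u j) (A j)})) =
        Submodule.span K (b '' ⋃ j, ⋃ (_ : j ≠ i), {m | m.1 ∈ sbox (u j) (A j)}) := by
      simp only [Set.image_iUnion, Submodule.span_iUnion]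
    rw [h3]
    apply hb.disjoint_span_image
    rw [Set.disjoint_left]
    intro m hm hm'
    simp only [Set.mem_iUnion, Set.mem_ofPred_eq] at hm hm'
    obtain ⟨j, hj, hmj⟩ := hm'
    exact hj ((hu m.1 m.2).unique hmj hm)
  have htop : (⨆ i, stanleySpace K V _ (w i) (A i)) = ⊤ := by
    simp only [hst]
    rw [← Submodule.span_iUnion, ← Set.image_iUnion, ← hspan]
    congr 1
    rw [← Set.image_univ]
    congr 1
    rw [Set.eq_univ_iff_forall]
    intro m
    obtain ⟨i, hi, _⟩ := hu m.1 m.2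
    exact Set.mem_iUnion.2 ⟨i, hi⟩
  have hdec : IsStanleyDecomp K V (MvPolynomial V K ⧸ JI K Adj W) (w ∘ e) (A ∘ e) := by
    refine ⟨?_, ?_, ?_⟩
    · intro i f hf h0
      have h0' : f * monomial (u (e i)) (1 : K) ∈ JI K Adj W := by
        rw [← Ideal.Quotient.eq_zero_iff_mem]
        exact h0
      ext m
      rw [coeff_zero]
      by_contra hne
      have hms : (↑m.support : Set V) ⊆ ↑(A (e i)) := by
        intro v hv
        apply hf
        simp only [Finset.mem_coe, mem_vars_iff_mem_support]
        exact ⟨m, mem_support_iff.2 hne, hv⟩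
      have := h0' _ (hg (e i) _ (hbox (e i) m hms))
      rw [coeff_mul_monomial, mul_one] at this
      exact hne this
    · exact hind.comp e.injective
    · rw [← htop]
      exact e.iSup_comp (g := fun i => stanleySpace K V _ (w i) (A i))
  obtain ⟨i0, _⟩ := hu 0 ⟨fun v hv => absurd rfl hv, fun a b _ => Or.inl rfl⟩
  have hne : (Set.range fun i => ((A ∘ e) i).card).Nonempty := ⟨_, e.symm i0, rfl⟩
  have hd : d ≤ sInf (Set.range fun i => ((A ∘ e) i).card) := by
    obtain ⟨i, hi⟩ := Nat.sInf_mem hne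
    rw [← hi]
    exact hc _
  refine hd.trans (le_csSup ?_ ⟨_, w ∘ e, A ∘ e, hdec, rfl⟩)
  refine ⟨Fintype.card V, ?_⟩
  rintro _ ⟨r, w', A', -, rfl⟩
  rcases (Set.range fun i => (A' i).card).eq_empty_or_nonempty with h | h
  · rw [h]; simp
  · obtain ⟨i, hi⟩ := Nat.sInf_mem h
    rw [← hi]
    exact Finset.card_le_univ _

end Stanley

section NonVan

variable {V ι : Type} {K : Type} [Field K] {Adj : V → V → Prop}

/-- Wedge product of functions, by Laplace expansion. -/
def wedge : List (V → K) → List V → K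
  | [], [] => 1
  | [], _ :: _ => 0
  | f :: fs, l => DD f l (wedge fs)

theorem DD_ne_zero (f : V → K) (l : List V) (φ : List V → K) (h : DD f l φ ≠ 0) :
    (∃ v ∈ l, f v ≠ 0) ∧ ∃ l', l' ⊆ l ∧ φ l' ≠ 0 := by
  induction l generalizing φ with
  | nil => simp [DD] at h
  | cons v l ih =>
    by_cases h1 : f v • φ l = 0
    · have h2 : DD f l (fun l' => φ (v :: l')) ≠ 0 := by
        intro h2; apply h; simp only [DD, h1, h2, sub_zero]
      obtain ⟨⟨w, hw, hfw⟩, l', hl', hφ⟩ := ih _ h2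
      exact ⟨⟨w, by simp [hw], hfw⟩, v :: l', List.cons_subset_cons v hl', hφ⟩
    · rw [smul_eq_mul] at h1
      exact ⟨⟨v, by simp, left_ne_zero_of_mul h1⟩, l, List.subset_cons_self v l,
        right_ne_zero_of_mul h1⟩

theorem wedge_ne_zero (fs : List (V → K)) (l : List V) (h : wedge fs l ≠ 0) :
    ∀ f ∈ fs, ∃ v ∈ l, f v ≠ 0 := by
  induction fs generalizing l with
  | nil => simp
  | cons g fs ih =>
    intro f hf
    rw [wedge] at h
    obtain ⟨h1, l', hl', h2⟩ := DD_ne_zero g l _ h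
    rcases List.mem_cons.1 hf with rfl | hf
    · exact h1
    · obtain ⟨v, hv, hfv⟩ := ih l' h2 f hf
      exact ⟨v, hl' hv, hfv⟩

theorem DD_wedge_of_mem (fs : List (V → K)) (f : V → K) (hf : f ∈ fs) (l : List V) :
    DD f l (wedge fs) = 0 := by
  induction fs generalizing l with
  | nil => simp at hf
  | cons g fs ih =>
    have : wedge (g :: fs) = fun l => DD g l (wedge fs) := by funext l; rw [wedge]
    rw [this]
    rcases List.mem_cons.1 hf with rfl | hf
    · exact DD_self _ _ _
    · rw [DD_comm]
      simp only [ih hf, DD_zero, neg_zero]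

theorem DD_add_left (f g : V → K) (l : List V) (φ : List V → K) :
    DD (fun v => f v + g v) l φ = DD f l φ + DD g l φ := by
  induction l generalizing φ with
  | nil => simp [DD]
  | cons v l ih => simp only [DD, ih, smul_eq_mul]; ring

theorem DD_sum_left (s : Finset ι) (f : ι → V → K) (l : List V) (φ : List V → K) :
    DD (fun v => ∑ i ∈ s, f i v) l φ = ∑ i ∈ s, DD (f i) l φ := by
  classical
  induction s using Finset.induction_on with
  | empty =>
    simp only [Finset.sum_empty]
    induction l generalizing φ with
    | nil => rfl
    | cons v l ih => simp [DD, ih]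
  | insert a s ha ih => simp only [Finset.sum_insert ha, DD_add_left, ih]

/-- exponent vector of a list -/
noncomputable def mon : List V → V →₀ ℕ
  | [] => 0
  | v :: l => Finsupp.single v 1 + mon l

theorem mon_ne_zero (l : List V) (v : V) (h : mon l v ≠ 0) : v ∈ l := by
  classical
  induction l with
  | nil => simp [mon] at h
  | cons w l ih =>
    by_cases hw : w = v
    · simp [hw]
    · simp only [mon, Finsupp.add_apply, Finsupp.single_apply, hw, if_false, zero_add] at h
      simp [ih h]

theorem mon_mem (l : List V) (v : V) (h : v ∈ l) : mon l v ≠ 0 := by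
  classical
  induction l with
  | nil => simp at h
  | cons w l ih =>
    simp only [mon, Finsupp.add_apply]
    rcases List.mem_cons.1 h with rfl | h
    · simp
    · have := ih h; omega

theorem DD_X_monomial (l : List V) (c : List V → K) :
    DD (X : V → MvPolynomial V K) l (fun l => monomial (mon l) (c l)) =
      monomial (mon l) (DD (fun _ => (1 : K)) l c) := by
  induction l generalizing c with
  | nil => simp [DD]
  | cons v l ih =>
    have h1 : (fun l' => monomial (mon (v :: l')) (c (v :: l'))) =
        fun l' => (X v : MvPolynomial V K) • monomial (mon l') (c (v :: l')) := by
      funext l'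
      rw [smul_eq_mul, X, monomial_mul, one_mul, mon]
    simp only [DD]
    rw [h1, DD_smul, ih (fun l' => c (v :: l')), one_smul, map_sub, smul_eq_mul, smul_eq_mul, X, monomial_mul,
      monomial_mul, one_mul, one_mul, mon]

theorem coeff_DD (l : List V) (a : V →₀ ℕ) (ψ : List V → MvPolynomial V K) :
    coeff (a + mon l) (DD (X : V → MvPolynomial V K) l ψ) =
      DD (fun _ => (1 : K)) l (fun l => coeff (a + mon l) (ψ l)) := by
  induction l generalizing a ψ with
  | nil => simp [DD]
  | cons v l ih =>
    have h1 : ∀ l, a + mon (v :: l) = (a + Finsupp.single v 1) + mon l := by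
      intro l; rw [mon, add_assoc]
    have h2 : ∀ l, a + mon (v :: l) = Finsupp.single v 1 + (a + mon l) := by
      intro l; rw [mon]; abel
    simp only [DD, coeff_sub, smul_eq_mul, one_mul]
    congr 1
    · rw [h2, coeff_X_mul]
    · simp only [h1]
      exact ih _ _

/-- Pairing with the boundary of a cross-polytope. -/
def Zp (a b : ι → V) : List ι → (List V → K) → K
  | [], f => f []
  | i :: L, f => Zp a b L (fun l => f (a i :: l)) - Zp a b L (fun l => f (b i :: l))

theorem Zp_sub (a b : ι → V) (L : List ι) (f g : List V → K) :
    Zp a b L (fun l => f l - g l) = Zp a b L f - Zp a b L g := by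
  induction L generalizing f g with
  | nil => rfl
  | cons i L ih => simp only [Zp, ih]; ring

theorem Zp_congr (a b : ι → V) (L : List ι) (f g : List V → K)
    (h : ∀ l, List.Forall₂ (fun v i => v = a i ∨ v = b i) l L → f l = g l) :
    Zp a b L f = Zp a b L g := by
  induction L generalizing f g with
  | nil => exact h _ List.Forall₂.nil
  | cons i L ih =>
    simp only [Zp]
    rw [ih (fun l => f (a i :: l)) (fun l => g (a i :: l))
        (fun l hl => h _ (List.Forall₂.cons (Or.inl rfl) hl)),
      ih (fun l => f (b i :: l)) (fun l => g (b i :: l))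
        (fun l hl => h _ (List.Forall₂.cons (Or.inr rfl) hl))]

theorem Zp_zero (a b : ι → V) (L : List ι) : Zp a b L (fun _ => (0 : K)) = 0 := by
  induction L with
  | nil => rfl
  | cons i L ih => simp only [Zp, ih, sub_zero]

theorem Zp_DD_one (a b : ι → V) (L : List ι) (ψ : List V → K) :
    Zp a b L (fun l => DD (fun _ => (1 : K)) l ψ) = 0 := by
  induction L generalizing ψ with
  | nil => rfl
  | cons i L ih =>
    simp only [Zp, DD, one_smul, Zp_sub, ih]
    ring

theorem forall₂_mem {a b : ι → V} {L : List ι} {l : List V}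
    (h : List.Forall₂ (fun v i => v = a i ∨ v = b i) l L) :
    ∀ v ∈ l, ∃ i ∈ L, v = a i ∨ v = b i := by
  induction h with
  | nil => simp
  | cons h1 _ ih =>
    intro v hv
    rcases List.mem_cons.1 hv with rfl | hv
    · exact ⟨_, by simp, h1⟩
    · obtain ⟨j, hj, h⟩ := ih v hv
      exact ⟨j, by simp [hj], h⟩

theorem Zp_wedge [DecidableEq ι] (a b : ι → V) (f : ι → V → K)
    (hfa : ∀ i j, f i (a j) = if i = j then 1 else 0) (hfb : ∀ i j, f i (b j) = 0)
    (L : List ι) (hL : L.Nodup) : Zp a b L (wedge (L.map f)) = 1 := by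
  induction L with
  | nil => rfl
  | cons i L ih =>
    obtain ⟨hi, hL⟩ := List.nodup_cons.1 hL
    have hz : ∀ φ : List V → K, Zp a b L (fun l => DD (f i) l φ) = 0 := by
      intro φ
      rw [← Zp_zero (K := K) a b L]
      apply Zp_congr
      intro l hl
      by_contra hne
      obtain ⟨⟨v, hv, hfv⟩, _⟩ := DD_ne_zero _ _ _ hne
      obtain ⟨j, hj, rfl | rfl⟩ := forall₂_mem hl v hv
      · rw [hfa, if_neg (by rintro rfl; exact hi hj)] at hfv
        exact hfv rfl
      · exact hfv (hfb _ _)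
    simp only [List.map_cons, Zp, wedge, DD, Zp_sub, hz, hfa, hfb, if_true, one_smul, zero_smul,
      Zp_zero, sub_zero]
    exact ih hL

theorem not_van [Fintype V] [Fintype ι] [DecidableEq ι] (L : List ι) (hL : L.Nodup)
    (hLu : ∀ i, i ∈ L) (hsymm : ∀ a b, Adj a b → Adj b a) (hirr : ∀ a, ¬ Adj a a)
    (a b : ι → V) (f : ι → V → K)
    (hfa : ∀ i j, f i (a j) = if i = j then 1 else 0) (hfb : ∀ i j, f i (b j) = 0)
    (hind : ∀ i j, i ≠ j → ∀ v w, (v = a i ∨ v = b i) → (w = a j ∨ w = b j) → ¬ Adj v w)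
    (htr : ∀ l : List V, (∃ v ∈ l, 1 - ∑ i, f i v ≠ 0) → (∀ i, ∃ v ∈ l, f i v ≠ 0) →
      ∃ v ∈ l, ∃ w ∈ l, Adj v w) :
    ¬ Van (MvPolynomial V K ⧸ JI K Adj Finset.univ) (X : V → MvPolynomial V K) (L.length + 1) := by
  intro hvan
  classical
  let c : List V → K := wedge (L.map f)
  let φ : List V → MvPolynomial V K := fun l => monomial (mon l) (c l)
  let J := JI K Adj (Finset.univ : Finset V)
  let π := Submodule.mkQ J
  have hcoc : ∀ l, DD (X : V → MvPolynomial V K) l (fun l => π (φ l)) = 0 := by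
    intro l
    rw [DD_map, DD_X_monomial]
    by_cases h0 : DD (fun _ => (1 : K)) l c = 0
    · rw [h0, map_zero, map_zero]
    · rw [Submodule.mkQ_apply, Submodule.Quotient.mk_eq_zero]
      have hdec : (fun _ : V => (1 : K)) =
          fun v => (1 - ∑ i, f i v) + ∑ i, f i v := by funext v; ring
      have h1 : DD (fun v => 1 - ∑ i, f i v) l c ≠ 0 := by
        rw [hdec, DD_add_left, DD_sum_left, Finset.sum_eq_zero, add_zero] at h0
        · exact h0
        · intro i _
          exact DD_wedge_of_mem _ _ (List.mem_map.2 ⟨i, hLu i, rfl⟩) _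
      obtain ⟨h2, l', hl', h3⟩ := DD_ne_zero _ _ _ h1
      obtain ⟨v, hv, w, hw, hvw⟩ := htr l h2 (fun i => by
        obtain ⟨v, hv, h⟩ := wedge_ne_zero _ _ h3 (f i) (List.mem_map.2 ⟨i, hLu i, rfl⟩)
        exact ⟨v, hl' hv, h⟩)
      intro m hm
      rw [coeff_monomial, if_neg]
      rintro rfl
      rcases hm.2 v w hvw with h | h
      · exact mon_mem l v hv h
      · exact mon_mem l w hw h
  obtain ⟨ψ, hψ⟩ := hvan L.length (by omega) _ (fun l _ => hcoc l)
  have hs : ∀ l, ∃ p, π p = ψ l := fun l => Submodule.mkQ_surjective J (ψ l)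
  choose ψ' hψ' using hs
  have hgood : ∀ (L : List ι), L.Nodup → ∀ l,
      List.Forall₂ (fun v i => v = a i ∨ v = b i) l L → ∀ v ∈ l, ∀ w ∈ l, ¬ Adj v w := by
    intro L hL l hl
    induction hl with
    | nil => simp
    | @cons v i l L h1 h2 ih =>
      obtain ⟨hi, hL⟩ := List.nodup_cons.1 hL
      have key : ∀ w ∈ l, ¬ Adj v w := by
        intro w hw
        obtain ⟨j, hj, hwj⟩ := forall₂_mem h2 w hw
        exact hind i j (by rintro rfl; exact hi hj) v w h1 hwj
      intro x hx y hy
      rcases List.mem_cons.1 hx with hx' | hx' <;> rcases List.mem_cons.1 hy with hy' | hy'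
      · rw [hx', hy']; exact hirr _
      · rw [hx']; exact key y hy'
      · rw [hy']; exact fun h => key x hx' (hsymm _ _ h)
      · exact ih hL x hx' y hy'
  have hZ : Zp a b L c = Zp a b L (fun l => DD (fun _ => (1 : K)) l
      (fun l => coeff (0 + mon l) (ψ' l))) := by
    apply Zp_congr
    intro l hl
    have h1 := hψ l hl.length_eq
    rw [show ψ = fun l => π (ψ' l) from funext fun l => (hψ' l).symm] at h1
    rw [DD_map, ← sub_eq_zero, ← map_sub, Submodule.mkQ_apply,
      Submodule.Quotient.mk_eq_zero] at h1
    have h2 := h1 (mon l) ⟨fun v _ => Finset.mem_univ v, fun v w hvw => by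
      by_contra hcon
      push Not at hcon
      exact hgood L hL l hl v (mon_ne_zero l v hcon.1) w (mon_ne_zero l w hcon.2) hvw⟩
    rw [coeff_sub, sub_eq_zero] at h2
    have h3 := coeff_DD l 0 ψ'
    rw [← h3, zero_add, ← h2]
    simp [φ]
  rw [Zp_DD_one, Zp_wedge a b f hfa hfb L hL] at hZ
  exact one_ne_zero hZ

end NonVan

section Cycle

theorem cAdj_iff (n : ℕ) (a b : Fin n × Fin 2) : cAdj n 2 a b ↔
    a ≠ b ∧ ((a.1.val ≤ b.1.val + 1 ∧ b.1.val ≤ a.1.val + 1) ∨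
      n ≤ a.1.val + 1 - b.1.val ∨ n ≤ b.1.val + 1 - a.1.val) := by
  unfold cAdj
  have h1 := a.1.2
  have h2 := b.1.2
  have h3 : |((a.2 : ℤ) - (b.2 : ℤ))| ≤ 1 := by
    have := a.2.2
    have := b.2.2
    rw [abs_le]
    omega
  simp only [h3, and_true]
  refine and_congr_right fun _ => ?_
  rw [min_le_iff]
  omega

theorem cAdj_symm (n : ℕ) (a b : Fin n × Fin 2) (h : cAdj n 2 a b) : cAdj n 2 b a := by
  rw [cAdj_iff] at h ⊢
  exact ⟨h.1.symm, by omega⟩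

theorem cAdj_irr (n : ℕ) (a : Fin n × Fin 2) : ¬ cAdj n 2 a a := fun h => h.1 rfl

theorem packing_fun {n k : ℕ} (W : Finset (Fin n × Fin 2)) (β : Fin k → Fin n × Fin 2)
    (key : Fin n × Fin 2 → ℕ) (hW : ∀ i, β i ∈ W)
    (hk : ∀ i, ∀ w ∈ W, (w = β i ∨ cAdj n 2 (β i) w) → key w = i) :
    HasD (cAdj n 2) k W := by
  classical
  have hinj : Function.Injective β := by
    intro i j hij
    have h1 := hk i (β i) (hW i) (Or.inl rfl)
    have h2 := hk j (β j) (hW j) (Or.inl rfl)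
    rw [hij, h2] at h1
    exact Fin.ext h1.symm
  have hc : (Finset.univ.image β).card = k := by
    rw [Finset.card_image_of_injective _ hinj]; simp
  rw [← hc]
  refine HasD.packing _ (cAdj_symm n) (cAdj_irr n) _ _ ?_ ?_
  · intro x hx
    obtain ⟨i, _, rfl⟩ := Finset.mem_image.1 hx
    exact hW i
  · intro x hx y hy hne w hw h1 h2
    obtain ⟨i, _, rfl⟩ := Finset.mem_image.1 hx
    obtain ⟨j, _, rfl⟩ := Finset.mem_image.1 hy
    apply hne
    have := (hk i w hw h1).symm.trans (hk j w hw h2)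
    rw [Fin.ext this]

theorem hasD_cycle (n : ℕ) (hn : 3 ≤ n) :
    HasD (cAdj n 2) ((n + 1) / 3) Finset.univ := by
  classical
  have h0 : 0 < n := by omega
  have star : ∀ (W : Finset (Fin n × Fin 2)) (s : Fin 2), (∀ w : Fin n × Fin 2, w.1.val ≠ 0 → w ∈ W) →
      (((⟨0, h0⟩, s) : Fin n × Fin 2) ∈ W) →
      HasD (cAdj n 2) ((n + 1) / 3) (W.filter fun w => ¬ cAdj n 2 (⟨0, h0⟩, s) w) := by
    intro W s hW hs
    refine packing_fun _ (fun i => (⟨3 * i.val, by omega⟩, s)) (fun w => (w.1.val + 1) / 3) ?_ ?_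
    · intro i
      rw [Finset.mem_filter]
      by_cases hi : i.val = 0
      · have : ((⟨3 * i.val, by omega⟩, s) : Fin n × Fin 2) = (⟨0, h0⟩, s) := by
          ext <;> simp [hi]
        rw [this]
        exact ⟨hs, cAdj_irr _ _⟩
      · refine ⟨hW _ (by simp [hi]), ?_⟩
        rw [cAdj_iff]
        simp only
        omega
    · intro i w hw h
      have hw2 := (Finset.mem_filter.1 hw).2
      have hne : w.1.val ≠ n - 1 := by
        intro hc
        apply hw2
        rw [cAdj_iff]
        refine ⟨?_, ?_⟩
        · rintro rfl
          simp only at hc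
          omega
        · simp only
          omega
      have hlt := w.1.2
      rcases h with rfl | h
      · simp only; omega
      · rw [cAdj_iff] at h
        simp only at h ⊢
        omega
  refine HasD.split _ _ (⟨0, h0⟩, 0) (Finset.mem_univ _) ?_ (by
    convert star Finset.univ 0 (fun _ _ => Finset.mem_univ _) (Finset.mem_univ _))
  refine HasD.split _ _ (⟨0, h0⟩, 1) (by simp) ?_ ?_
  · refine packing_fun _ (fun i => (⟨3 * i.val + 1, by omega⟩, 0)) (fun w => w.1.val / 3) ?_ ?_
    · intro i
      simp
    · intro i w hw h
      have hne : w.1.val ≠ 0 := by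
        intro hc
        simp only [Finset.mem_erase, Finset.mem_univ, and_true] at hw
        obtain ⟨⟨x, hx⟩, s⟩ := w
        simp only at hc
        subst hc
        fin_cases s <;> simp at hw
      have hlt := w.1.2
      rcases h with rfl | h
      · simp only; omega
      · rw [cAdj_iff] at h
        simp only at h ⊢
        omega
  · convert star (Finset.univ.erase (⟨0, h0⟩, 0)) 1 ?_ ?_
    · intro w hw
      simp only [Finset.mem_erase, Finset.mem_univ, and_true]
      rintro rfl
      exact hw rfl
    · simp

/-- The classes used to build the top-degree cocycle. -/
def cls (n : ℕ) (v : Fin n × Fin 2) (i : ℕ) : Prop :=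
  v.1.val / 3 = i ∧ v.1.val % 3 ≠ 1 ∧ ¬ (n % 3 = 2 ∧ v.1.val = n - 2 ∧ v.2.val = 1)

theorem not_van_cycle (K : Type) [Field K] (n : ℕ) (hn : 3 ≤ n) :
    ¬ Van (MvPolynomial (Fin n × Fin 2) K ⧸ JI K (cAdj n 2) Finset.univ)
      (X : Fin n × Fin 2 → MvPolynomial (Fin n × Fin 2) K) ((n + 1) / 3 + 1) := by
  classical
  have h := not_van (K := K) (Adj := cAdj n 2) (List.finRange ((n + 1) / 3))
    (List.nodup_finRange _) (List.mem_finRange) (cAdj_symm n) (cAdj_irr n)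
    (fun i => (⟨3 * i.val, by omega⟩, 0))
    (fun i => if n % 3 = 2 ∧ i.val + 1 = (n + 1) / 3 then (⟨3 * i.val, by omega⟩, 1)
      else (⟨3 * i.val + 1, by omega⟩, 0))
    (fun i v => if cls n v i.val then 1 else 0) ?_ ?_ ?_ ?_
  · simpa using h
  · intro i j
    refine if_congr ?_ rfl rfl
    rw [Fin.ext_iff]
    simp only [cls]
    simp
    omega
  · intro i j
    rw [if_neg]
    split_ifs with hj
    · simp only [cls]; simp; omega
    · simp only [cls]; simp
  · intro i j hij v w hv hw
    rw [cAdj_iff]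
    have hij' : i.val ≠ j.val := fun h => hij (Fin.ext h)
    have hi := i.2
    have hj := j.2
    have col : ∀ (t : Fin ((n + 1) / 3)) (x : Fin n × Fin 2),
        (x = (⟨3 * t.val, by omega⟩, 0) ∨ x = if n % 3 = 2 ∧ t.val + 1 = (n + 1) / 3 then
          (⟨3 * t.val, by omega⟩, 1) else (⟨3 * t.val + 1, by omega⟩, 0)) →
        x.1.val = 3 * t.val ∨ (x.1.val = 3 * t.val + 1 ∧
          ¬ (n % 3 = 2 ∧ t.val + 1 = (n + 1) / 3)) := by
      intro t x hx
      rcases hx with rfl | rfl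
      · left; rfl
      · split_ifs with hc
        · left; rfl
        · right; exact ⟨rfl, hc⟩
    have h1 := col i v hv
    have h2 := col j w hw
    rintro ⟨-, h3⟩
    omega
  · intro l ⟨v, hv, hv0⟩ hl
    have hl' : ∀ i < (n + 1) / 3, ∃ v ∈ l, cls n v i := by
      intro i hi
      obtain ⟨w, hw, h⟩ := hl ⟨i, hi⟩
      refine ⟨w, hw, ?_⟩
      by_contra hcon
      exact h (if_neg hcon)
    have hv1 : ∀ i < (n + 1) / 3, ¬ cls n v i := by
      intro i hi hcl
      apply hv0
      rw [Finset.sum_eq_single ⟨i, hi⟩, if_pos hcl, sub_self]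
      · intro j _ hj
        rw [if_neg]
        intro h
        exact hj (Fin.ext (h.1.symm.trans hcl.1))
      · simp
    have hlt := v.1.2
    by_contra hcon
    push Not at hcon
    have hno : ∀ x ∈ l, ∀ y ∈ l, x ≠ y → ¬ ((x.1.val ≤ y.1.val + 1 ∧ y.1.val ≤ x.1.val + 1) ∨
      n ≤ x.1.val + 1 - y.1.val ∨ n ≤ y.1.val + 1 - x.1.val) := fun x hx y hy hne h =>
        hcon x hx y hy ((cAdj_iff n x y).2 ⟨hne, h⟩)
    by_cases hc : v.1.val / 3 < (n + 1) / 3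
    · obtain ⟨w, hw, hcl⟩ := hl' _ hc
      have hne : v ≠ w := by
        rintro rfl
        exact hv1 _ hc hcl
      have h1 := hno v hv w hw hne
      have h2 := hv1 _ hc
      have hwlt := w.1.2
      obtain ⟨c1, c2, c3⟩ := hcl
      have h4 : v.1.val % 3 = 1 ∨ (n % 3 = 2 ∧ v.1.val = n - 2 ∧ v.2.val = 1) := by
        by_contra hcc
        push Not at hcc
        exact h2 ⟨rfl, hcc.1, fun hx => hcc.2 hx.1 hx.2.1 hx.2.2⟩
      apply h1
      left
      omega
    · have hvn : v.1.val = n - 1 := by omega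
      have hn3 : n = 3 * ((n + 1) / 3) + 1 := by omega
      have chain : ∀ j ≤ (n + 1) / 3, ∃ w ∈ l, w.1.val + 3 * j = 3 * ((n + 1) / 3) := by
        intro j
        induction j with
        | zero => intro _; exact ⟨v, hv, by omega⟩
        | succ j ih =>
          intro hj
          obtain ⟨x, hx, hxj⟩ := ih (by omega)
          obtain ⟨w, hw, hcl⟩ := hl' ((n + 1) / 3 - (j + 1)) (by omega)
          refine ⟨w, hw, ?_⟩
          obtain ⟨h1, h2, -⟩ := hcl
          have hne : x ≠ w := by
            rintro rfl
            omega
          have := hno x hx w hw hne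
          omega
      obtain ⟨w, hw, hw0⟩ := chain _ le_rfl
      have hne : v ≠ w := by
        rintro rfl
        omega
      have := hno v hv w hw hne
      omega

end Cycle

/-- For every integer `n ≥ 3`, `depth(S_{n,2}/I(C_{n,2})) = ⌈(n−1)/3⌉` and
`sdepth(S_{n,2}/I(C_{n,2})) ≥ ⌈(n−1)/3⌉`. -/
theorem depth_sdepth_quotient_edgeIdeal_C_n_2 (K : Type) [Field K] (n : ℕ) (hn : 3 ≤ n) :
    rdepth K (Fin n × Fin 2)
        (MvPolynomial (Fin n × Fin 2) K ⧸ edgeIdeal K (cAdj n 2)) = (n - 1 + 2) / 3 ∧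
    (n - 1 + 2) / 3 ≤ sdepth K (Fin n × Fin 2)
        (MvPolynomial (Fin n × Fin 2) K ⧸ edgeIdeal K (cAdj n 2)) := by
  have hE : edgeIdeal K (cAdj n 2) = JI K (cAdj n 2) Finset.univ :=
    edgeIdeal_eq_JI K _ (cAdj_irr n)
  have hk : (n - 1 + 2) / 3 = (n + 1) / 3 := by congr 1; omega
  rw [hE, hk]
  have hD := hasD_cycle n hn
  refine ⟨?_, le_sdepth K (cAdj_symm n) (cAdj_irr n) _ _ hD⟩
  have hJm : JI K (cAdj n 2) Finset.univ ≤
      Ideal.span (Set.range (X : Fin n × Fin 2 → MvPolynomial (Fin n × Fin 2) K)) := by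
    rw [← hE, edgeIdeal, Ideal.span_le]
    rintro p ⟨a, b, -, rfl⟩
    exact Ideal.mul_mem_left _ _ (Ideal.subset_span ⟨b, rfl⟩)
  have hm1 : (1 : MvPolynomial (Fin n × Fin 2) K) ∉
      Ideal.span (Set.range (X : Fin n × Fin 2 → MvPolynomial (Fin n × Fin 2) K)) := by
    intro h
    have hle : Ideal.span (Set.range (X : Fin n × Fin 2 → MvPolynomial (Fin n × Fin 2) K)) ≤
        RingHom.ker (constantCoeff (R := K) (σ := Fin n × Fin 2)) := by
      rw [Ideal.span_le]
      rintro _ ⟨v, rfl⟩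
      simp
    have := hle h
    simp at this
  apply IsGreatest.csSup_eq
  constructor
  · obtain ⟨rs, hl, hm, hw⟩ := Van.exists_regular _ _ _
      (van_of_hasD K (cAdj_symm n) (cAdj_irr n) _ _ hD)
    refine ⟨rs, hl, hm, hw, ?_⟩
    intro htop
    have h1 : (Ideal.Quotient.mk (JI K (cAdj n 2) Finset.univ) 1) ∈
        (Ideal.ofList rs • ⊤ : Submodule (MvPolynomial (Fin n × Fin 2) K)
          (MvPolynomial (Fin n × Fin 2) K ⧸ JI K (cAdj n 2) Finset.univ)) := by
      rw [← htop]; trivial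
    have h2 : (Ideal.ofList rs • ⊤ : Submodule (MvPolynomial (Fin n × Fin 2) K)
          (MvPolynomial (Fin n × Fin 2) K ⧸ JI K (cAdj n 2) Finset.univ)) ≤
        Submodule.map (Submodule.mkQ (JI K (cAdj n 2) Finset.univ))
          (Ideal.span (Set.range X)) := by
      rw [Submodule.smul_le]
      intro r hr y _
      obtain ⟨y, rfl⟩ := Submodule.mkQ_surjective _ y
      rw [← map_smul]
      refine Submodule.mem_map_of_mem ?_
      rw [smul_eq_mul]
      refine Ideal.mul_mem_right _ _ ?_
      have : Ideal.ofList rs ≤ Ideal.span (Set.range X) := by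
        rw [Ideal.ofList, Ideal.span_le]
        exact hm
      exact this hr
    obtain ⟨q, hq, hq1⟩ := h2 h1
    have h3 : q - 1 ∈ JI K (cAdj n 2) Finset.univ := (Submodule.Quotient.eq _).1 hq1
    apply hm1
    have := Ideal.sub_mem _ hq (hJm h3)
    simpa using this
  · rintro d ⟨rs, rfl, hm, hw⟩
    by_contra hlt
    push Not at hlt
    apply not_van_cycle K n hn
    have h := Van.of_regular _ rs _ hm hw.toIsWeaklyRegular
    intro p hp
    exact h p (by omega)
end
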